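/- arXiv:2503.06878 — 5 statements merged into one kernel-verified Lean document; each statement's English description precedes it below -/
import Mathlib

section
/- Let G be a finite group. If the set of codegrees of the irreducible complex characters of G has at most three elements, i.e. |cod(G)| ≤ 3, then G is solvable. -/
open scoped Classical

noncomputable section

/-- `χ : G → ℂ` is an irreducible complex character of the group `G`, i.e. it is the
character of some simple (irreducible) finite-dimensional complex representation of `G`. -/
def IsIrrChar (G : Type) [Group G] (χ : G → ℂ) : Prop :=
  ∃ V : FDRep ℂ G, CategoryTheory.Simple V ∧ χ = V.character

/-- The character of `G` induced from the class function `θ` of the subgroup `H`. -/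
def indChar {G : Type} [Group G] (H : Subgroup G) (θ : ↥H → ℂ) : G → ℂ :=
  fun g => (Nat.card H : ℂ)⁻¹ *
    ∑ᶠ x : G, if h : x⁻¹ * g * x ∈ H then θ ⟨x⁻¹ * g * x, h⟩ else 0

/-- `χ` is monomial: it is induced from a linear (degree-one) character of some subgroup,
a linear character of `H` being just a multiplicative homomorphism `H →* ℂ`. -/
def IsMonomialChar {G : Type} [Group G] (χ : G → ℂ) : Prop :=
  ∃ (H : Subgroup G) (lam : ↥H →* ℂ), χ = indChar H ⇑lam

/-- `G` is an `M`-group: every irreducible complex character of `G` is monomial. -/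
def IsMGroup (G : Type) [Group G] : Prop :=
  ∀ χ : G → ℂ, IsIrrChar G χ → IsMonomialChar χ

/-- The kernel of a character `χ` of `G`, as a set: `{g | χ g = χ 1}`. -/
def charKer {G : Type} [Group G] (χ : G → ℂ) : Set G :=
  {g : G | χ g = χ 1}

/-- The codegree of a character: `cod χ = |G : ker χ| / χ(1)`. -/
def codeg {G : Type} [Group G] (χ : G → ℂ) : ℂ :=
  ((Nat.card G : ℂ) / (Nat.card (charKer χ) : ℂ)) / χ 1

/-- The set of codegrees of the irreducible complex characters of `G`. -/
def codSet (G : Type) [Group G] : Set ℂ :=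
  {c : ℂ | ∃ χ : G → ℂ, IsIrrChar G χ ∧ codeg χ = c}

end

open Representation

/-- working notion of irreducible character -/
def IrrC (G : Type) [Group G] (χ : G → ℂ) : Prop :=
  ∃ (V : Type) (_ : AddCommGroup V) (_ : Module ℂ V) (_ : FiniteDimensional ℂ V)
    (ρ : Representation ℂ G V), ρ.IsIrreducible ∧ χ = ρ.character

noncomputable def ip {G : Type} [Group G] [Fintype G] (f h : G → ℂ) : ℂ :=
  (Nat.card G : ℂ)⁻¹ * ∑ g : G, f g * h g⁻¹

section
variable {G : Type} [Group G] [Fintype G]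

lemma ip_add_left (f f' h : G → ℂ) : ip (f + f') h = ip f h + ip f' h := by
  simp [ip, add_mul, Finset.sum_add_distrib, mul_add]

lemma ip_comm (f h : G → ℂ) : ip f h = ip h f := by
  unfold ip
  congr 1
  rw [← Equiv.sum_comp (Equiv.inv G)]
  simp [mul_comm]

lemma ip_zero_left (h : G → ℂ) : ip 0 h = 0 := by simp [ip]

lemma ip_mul_left (f h k : G → ℂ) : ip (f * h) k = ip f ((fun g => h g⁻¹) * k) := by
  simp [ip, mul_assoc]

lemma ip_msum (s : Multiset (G → ℂ)) (h : G → ℂ) :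
    ip s.sum h = (s.map (fun f => ip f h)).sum := by
  induction s using Multiset.induction_on with
  | empty => simp [ip_zero_left]
  | cons a s ih => simp [ip_add_left, ih]

noncomputable instance instInvCard : Invertible (Nat.card G : ℂ) :=
  invertibleOfNonzero (by simp)

lemma ip_char {V W : Type} [AddCommGroup V] [Module ℂ V] [FiniteDimensional ℂ V]
    [AddCommGroup W] [Module ℂ W] [FiniteDimensional ℂ W]
    (ρ : Representation ℂ G V) (σ : Representation ℂ G W) :
    ip σ.character ρ.character = Module.finrank ℂ (IntertwiningMap ρ σ) :=
  card_inv_mul_sum_char_mul_char_eq_finrank ρ σ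

lemma ip_irr {χ ψ : G → ℂ} (hχ : IrrC G χ) (hψ : IrrC G ψ) : ip χ ψ = if χ = ψ then 1 else 0 := by
  obtain ⟨V, _, _, _, ρ, h1, rfl⟩ := hχ
  obtain ⟨W, _, _, _, σ, h2, rfl⟩ := hψ
  have h := char_orthonormal ρ σ
  by_cases he : Nonempty (Representation.Equiv σ ρ)
  · rw [if_pos he] at h
    obtain ⟨e⟩ := he
    rw [if_pos (char_iso e).symm]
    simpa [ip] using h
  · rw [if_neg he] at h
    split_ifs with h3
    · exfalso
      have h' := char_orthonormal ρ ρ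
      rw [if_pos ⟨Representation.Equiv.refl ρ⟩] at h'
      rw [← h3] at h
      rw [h] at h'
      simp at h'
    · simpa [ip] using h

end

section
variable {G : Type} [Group G]

lemma IrrC.one_pos {χ : G → ℂ} (hχ : IrrC G χ) : ∃ d : ℕ, 0 < d ∧ χ 1 = d := by
  obtain ⟨V, _, _, _, ρ, h1, rfl⟩ := hχ
  refine ⟨Module.finrank ℂ V, ?_, by simp⟩
  rw [Module.finrank_pos_iff]
  by_contra hV
  rw [not_nontrivial_iff_subsingleton] at hV
  obtain ⟨a, b, hab⟩ := h1.toNontrivial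
  exact hab (Subrepresentation.toSubmodule_injective (Subsingleton.elim _ _))

lemma char_compl {V : Type} [AddCommGroup V] [Module ℂ V] [FiniteDimensional ℂ V]
    (ρ : Representation ℂ G V) (U U' : Subrepresentation ρ)
    (h : IsCompl U.toSubmodule U'.toSubmodule) :
    ρ.character = U.toRepresentation.character + U'.toRepresentation.character := by
  ext g
  have : ρ g = (Submodule.prodEquivOfIsCompl _ _ h).conj
      ((U.toRepresentation g).prodMap (U'.toRepresentation g)) := by
    refine LinearMap.ext fun v => ?_
    obtain ⟨x, rfl⟩ := (Submodule.prodEquivOfIsCompl _ _ h).surjective v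
    rw [LinearEquiv.conj_apply_apply]
    simp [Subrepresentation.toRepresentation]
  rw [character, this, LinearMap.trace_conj', LinearMap.trace_prodMap']
  rfl

lemma subrep_isCompl {V : Type} [AddCommGroup V] [Module ℂ V]
    {ρ : Representation ℂ G V} {U U' : Subrepresentation ρ} (h : IsCompl U U') :
    IsCompl U.toSubmodule U'.toSubmodule := by
  constructor
  · rw [disjoint_iff]
    exact congrArg Subrepresentation.toSubmodule (disjoint_iff.1 h.1)
  · rw [codisjoint_iff]
    exact congrArg Subrepresentation.toSubmodule (codisjoint_iff.1 h.2)

lemma not_irred_split [Finite G] {V : Type} [AddCommGroup V] [Module ℂ V] [FiniteDimensional ℂ V]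
    (ρ : Representation ℂ G V) (hV : Nontrivial V) (hρ : ¬ ρ.IsIrreducible) :
    ∃ U U' : Subrepresentation ρ, IsCompl U.toSubmodule U'.toSubmodule ∧
      0 < Module.finrank ℂ U.toSubmodule ∧ 0 < Module.finrank ℂ U'.toSubmodule ∧
      Module.finrank ℂ U.toSubmodule + Module.finrank ℂ U'.toSubmodule = Module.finrank ℂ V := by
  have : Fintype G := Fintype.ofFinite G
  have : NeZero (Nat.card G : ℂ) := ⟨by simp⟩
  have : ComplementedLattice (Subrepresentation ρ) := inferInstance
  have hnt : Nontrivial (Subrepresentation ρ) := by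
    refine ⟨⊥, ⊤, fun h => ?_⟩
    have := congrArg Subrepresentation.toSubmodule h
    exact (bot_ne_top (α := Submodule ℂ V)) this
  have : ∃ U : Subrepresentation ρ, U ≠ ⊥ ∧ U ≠ ⊤ := by
    by_contra hc
    push Not at hc
    exact hρ ⟨fun U => by
      by_cases h : U = ⊥
      · exact Or.inl h
      · exact Or.inr (hc U h)⟩
  obtain ⟨U, h1, h2⟩ := this
  obtain ⟨U', hU⟩ := exists_isCompl U
  have hc := subrep_isCompl hU
  refine ⟨U, U', hc, ?_, ?_, Submodule.finrank_add_eq_of_isCompl hc⟩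
  · rw [Nat.pos_iff_ne_zero, Ne, Submodule.finrank_eq_zero]
    intro h
    exact h1 (Subrepresentation.toSubmodule_injective h)
  · rw [Nat.pos_iff_ne_zero, Ne, Submodule.finrank_eq_zero]
    intro h
    rw [h] at hc
    exact h2 (Subrepresentation.toSubmodule_injective (by simpa using! hc.sup_eq_top))

/-- Complete reducibility at the level of characters. -/
lemma char_decomp [Finite G] : ∀ (n : ℕ) (V : Type) [AddCommGroup V] [Module ℂ V]
    [FiniteDimensional ℂ V] (ρ : Representation ℂ G V), Module.finrank ℂ V = n →
    ∃ s : Multiset (G → ℂ), (∀ χ ∈ s, IrrC G χ) ∧ s.sum = ρ.character := by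
  intro n
  induction n using Nat.strong_induction_on with
  | _ n ih =>
    intro V _ _ _ ρ hn
    by_cases hV : Nontrivial V
    · by_cases hρ : ρ.IsIrreducible
      · exact ⟨{ρ.character}, by simpa using ⟨V, _, _, inferInstance, ρ, hρ, rfl⟩, by simp⟩
      · obtain ⟨U, U', hc, h1, h2, h3⟩ := not_irred_split ρ hV hρ
        obtain ⟨s, hs, hs'⟩ := ih _ (by omega) U.toSubmodule U.toRepresentation rfl
        obtain ⟨t, ht, ht'⟩ := ih _ (by omega) U'.toSubmodule U'.toRepresentation rfl
        refine ⟨s + t, ?_, ?_⟩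
        · intro χ hχ
          rcases Multiset.mem_add.1 hχ with h | h
          · exact hs χ h
          · exact ht χ h
        · rw [Multiset.sum_add, hs', ht', ← char_compl ρ U U' hc]
    · rw [not_nontrivial_iff_subsingleton] at hV
      refine ⟨0, by simp, ?_⟩
      ext g
      simp only [character]
      rw [Subsingleton.elim (ρ g) 0]
      simp

lemma irrC_iff [Finite G] (χ : G → ℂ) : IrrC G χ ↔ IsIrrChar G χ := by
  have : Fintype G := Fintype.ofFinite G
  constructor
  · rintro ⟨V, _, _, _, ρ, hρ, rfl⟩
    refine ⟨FDRep.of ρ, ?_, rfl⟩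
    have : NeZero (Nat.card G : ℂ) := ⟨by simp⟩
    rw [FDRep.simple_iff_char_is_norm_one]
    have := ip_char ρ ρ
    rw [IsIrreducible.finrank_intertwiningMap_self] at this
    rw [ip, inv_mul_eq_iff_eq_mul₀ (by simp)] at this
    simpa using! this
  · rintro ⟨V, hV, rfl⟩
    have : NeZero (Nat.card G : ℂ) := ⟨by simp⟩
    rw [FDRep.simple_iff_char_is_norm_one] at hV
    let ρ : Representation ℂ G V := V.ρ
    have hn : ip ρ.character ρ.character = 1 := by
      rw [ip, inv_mul_eq_iff_eq_mul₀ (by simp)]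
      simpa using! hV
    refine ⟨V, inferInstance, inferInstance, inferInstance, ρ, ?_, rfl⟩
    have hnt : Nontrivial V := by
      by_contra hV
      rw [not_nontrivial_iff_subsingleton] at hV
      have : ρ.character = 0 := by
        ext g
        simp only [character]
        rw [Subsingleton.elim (ρ g) 0]
        simp
      rw [this, ip_zero_left] at hn
      simp at hn
    by_contra hρ
    obtain ⟨U, U', hc, h1, h2, h3⟩ := not_irred_split ρ hnt hρ
    rw [char_compl ρ U U' hc, ip_add_left, ip_comm, ip_add_left, ip_comm _ (_ + _), ip_add_left,
      ip_char, ip_char, ip_char, ip_char] at hn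
    have key : ∀ (W : Type) [AddCommGroup W] [Module ℂ W] [FiniteDimensional ℂ W]
        (σ : Representation ℂ G W), 0 < Module.finrank ℂ W →
        0 < Module.finrank ℂ (IntertwiningMap σ σ) := by
      intro W _ _ _ σ hW
      have := ip_char σ σ
      rw [Nat.pos_iff_ne_zero]
      intro h0
      have := Module.finrank_pos_iff.1 hW
      have : FiniteDimensional ℂ (IntertwiningMap σ σ) :=
        Module.Finite.equiv (invariantsEquivIntertwiningMap σ σ)
      have hs : Subsingleton (IntertwiningMap σ σ) := Module.finrank_zero_iff.1 h0
      obtain ⟨w, hw⟩ := exists_ne (0 : W)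
      have := Subsingleton.elim (IntertwiningMap.id σ) 0
      exact hw (by simpa using congrArg (fun f => f w) this)
    have k1 := key _ U.toRepresentation h1
    have k2 := key _ U'.toRepresentation h2
    norm_cast at hn
    omega
end

section
variable {V : Type} [AddCommGroup V] [Module ℂ V] [FiniteDimensional ℂ V]

lemma root_pow_one (f : Module.End ℂ V) (n : ℕ) (hf : f ^ n = 1) (μ : ℂ)
    (hμ : μ ∈ f.charpoly.roots) : μ ^ n = 1 := by
  have h1 : f.HasEigenvalue μ :=
    (Module.End.hasEigenvalue_iff_isRoot_charpoly f μ).2 (Polynomial.isRoot_of_mem_roots hμ)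
  obtain ⟨v, hv⟩ := h1.exists_hasEigenvector
  have h2 := hv.pow_apply n
  rw [hf] at h2
  have h3 : (μ ^ n - 1) • v = 0 := by
    rw [sub_smul, ← h2]; simp
  rcases smul_eq_zero.1 h3 with h | h
  · exact sub_eq_zero.1 h
  · exact absurd h hv.2

lemma trace_roots (f : Module.End ℂ V) : LinearMap.trace ℂ V f = f.charpoly.roots.sum :=
  Module.End.trace_eq_sum_roots_charpoly_of_splits (IsAlgClosed.splits _)

lemma trace_integral (f : Module.End ℂ V) (n : ℕ) (hn : 0 < n) (hf : f ^ n = 1) :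
    IsIntegral ℤ (LinearMap.trace ℂ V f) := by
  rw [trace_roots]
  refine IsIntegral.multiset_sum fun μ hμ => ?_
  refine IsIntegral.of_pow hn ?_
  rw [root_pow_one f n hf μ hμ]
  exact isIntegral_one

lemma msum_eq_card (s : Multiset ℂ) (h : ∀ x ∈ s, ‖x‖ = 1) (hs : s.sum = s.card) :
    ∀ x ∈ s, x = 1 := by
  have hre : ∀ t : Multiset ℂ, (∀ x ∈ t, ‖x‖ = 1) → t.sum.re ≤ t.card := by
    intro t ht
    have : ‖t.sum‖ ≤ (t.map fun x => ‖x‖).sum := norm_multiset_sum_le t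
    rw [Multiset.map_congr rfl ht] at this
    refine (Complex.re_le_norm _).trans (this.trans ?_)
    simp
  intro x hx
  obtain ⟨t, rfl⟩ := Multiset.exists_cons_of_mem hx
  have h1 := hre t fun y hy => h y (Multiset.mem_cons_of_mem hy)
  have h2 : x.re ≤ 1 := by rw [← h x hx]; exact Complex.re_le_norm x
  have h3 := congrArg Complex.re hs
  simp at h3
  have h4 : x.re = 1 := by linarith
  have h5 : ‖x‖ ^ 2 = 1 := by rw [h x hx]; norm_num
  rw [← Complex.normSq_eq_norm_sq, Complex.normSq_apply, h4] at h5
  have h6 : x.im = 0 := by nlinarith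
  exact Complex.ext (by simpa using h4) (by simpa using h6)

lemma eq_one_of_trace (f : Module.End ℂ V) (n : ℕ) (hn : 0 < n) (hf : f ^ n = 1)
    (ht : LinearMap.trace ℂ V f = Module.finrank ℂ V) : f = 1 := by
  have hsp : f.charpoly.Splits := IsAlgClosed.splits _
  have hcard : Multiset.card f.charpoly.roots = Module.finrank ℂ V := by
    rw [← hsp.natDegree_eq_card_roots, LinearMap.charpoly_natDegree]
  rw [trace_roots, ← hcard] at ht
  have h1 := msum_eq_card _ (fun x hx =>
    Complex.norm_eq_one_of_pow_eq_one (root_pow_one f n hf x hx) hn.ne') ht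
  have h2 : f.charpoly = (Polynomial.X - Polynomial.C 1) ^ Module.finrank ℂ V := by
    conv_lhs => rw [hsp.eq_prod_roots_of_monic (LinearMap.charpoly_monic f)]
    rw [Multiset.map_congr rfl (g := fun _ => Polynomial.X - Polynomial.C 1)
      (fun x hx => by rw [h1 x hx])]
    simp [hcard]
  have hs : f.IsSemisimple := by
    refine Module.End.isSemisimple_of_squarefree_aeval_eq_zero
      (p := Polynomial.X ^ n - Polynomial.C 1) ?_ (by simp [hf])
    exact (Polynomial.separable_X_pow_sub_C (1 : ℂ) (by exact_mod_cast hn.ne') one_ne_zero).squarefree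
  have hs' : (f - algebraMap ℂ (Module.End ℂ V) 1).IsSemisimple :=
    Module.End.isSemisimple_sub_algebraMap_iff.2 hs
  have hnil : IsNilpotent (f - algebraMap ℂ (Module.End ℂ V) 1) := by
    refine ⟨Module.finrank ℂ V, ?_⟩
    have := LinearMap.aeval_self_charpoly f
    rw [h2] at this
    simpa using this
  have := Module.End.eq_zero_of_isNilpotent_isSemisimple hnil hs'
  simpa [sub_eq_zero] using this
end

section
variable {G : Type} [Group G] [Finite G]
variable {V : Type} [AddCommGroup V] [Module ℂ V] [FiniteDimensional ℂ V]

lemma rep_pow_card (ρ : Representation ℂ G V) (g : G) : ρ g ^ Nat.card G = 1 := by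
  rw [← map_pow, pow_card_eq_one', map_one]

lemma rep_eq_one_iff (ρ : Representation ℂ G V) (g : G) :
    ρ.character g = ρ.character 1 ↔ ρ g = 1 := by
  constructor
  · intro h
    rw [char_one] at h
    exact eq_one_of_trace _ _ Nat.card_pos (rep_pow_card ρ g) h
  · intro h
    simp [character, h]

lemma char_integral (ρ : Representation ℂ G V) (g : G) : IsIntegral ℤ (ρ.character g) :=
  trace_integral _ _ Nat.card_pos (rep_pow_card ρ g)

/-- Schur's lemma, concretely. -/
lemma schur (ρ : Representation ℂ G V) (hρ : ρ.IsIrreducible) (f : Module.End ℂ V)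
    (hf : ∀ g, f ∘ₗ ρ g = ρ g ∘ₗ f) : ∃ c : ℂ, f = algebraMap ℂ (Module.End ℂ V) c := by
  let F : IntertwiningMap ρ ρ := ⟨f, hf⟩
  obtain ⟨c, hc⟩ := (IsIrreducible.algebraMap_intertwiningMap_bijective_of_isAlgClosed (ρ := ρ)).2 F
  refine ⟨c, ?_⟩
  ext v
  have := congrArg (fun k : IntertwiningMap ρ ρ => k v) hc
  simpa [F] using! this.symm

lemma degree_dvd (ρ : Representation ℂ G V) (hρ : ρ.IsIrreducible) :
    Module.finrank ℂ V ∣ Nat.card G := by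
  have : Fintype G := Fintype.ofFinite G
  let A := integralClosure ℤ ℂ
  let x : MonoidAlgebra A G := ∑ g : G, MonoidAlgebra.single g ⟨ρ.character g⁻¹, char_integral ρ _⟩
  let φ : MonoidAlgebra A G →ₐ[A] Module.End ℂ V := MonoidAlgebra.lift A (Module.End ℂ V) G ρ
  have hz : φ x = ∑ g : G, ρ.character g⁻¹ • ρ g := by
    simp only [x, φ, map_sum, MonoidAlgebra.lift_single]
    rfl
  have hx : IsIntegral A (φ x) := (IsIntegral.of_finite A x).map φ
  have hx' : IsIntegral ℤ (φ x) := isIntegral_trans _ hx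
  obtain ⟨c, hc⟩ := schur ρ hρ (φ x) (by
    intro h
    rw [hz]
    change (∑ g : G, ρ.character g⁻¹ • ρ g) * ρ h = ρ h * (∑ g : G, ρ.character g⁻¹ • ρ g)
    rw [Finset.sum_mul, Finset.mul_sum, ← Equiv.sum_comp (MulAut.conj h).toEquiv]
    refine Finset.sum_congr rfl fun g _ => ?_
    have h1 : ((MulAut.conj h).toEquiv g)⁻¹ = h * g⁻¹ * h⁻¹ := by simp [mul_assoc]
    have h2 : (MulAut.conj h).toEquiv g = h * g * h⁻¹ := by simp
    rw [h1, h2, char_conj, smul_mul_assoc, mul_smul_comm, ← map_mul, ← map_mul]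
    simp)
  have hd : 0 < Module.finrank ℂ V := by
    obtain ⟨d, hd, h⟩ := IrrC.one_pos (G := G) ⟨V, _, _, inferInstance, ρ, hρ, rfl⟩
    rw [char_one] at h
    have : Module.finrank ℂ V = d := by exact_mod_cast h
    omega
  have : Nontrivial V := Module.finrank_pos_iff.1 hd
  have hci : IsIntegral ℤ c := by
    rw [hc] at hx'
    exact (isIntegral_algebraMap_iff (algebraMap ℂ (Module.End ℂ V)).injective).1 hx'
  have htr : c * Module.finrank ℂ V = Nat.card G := by
    have h1 := congrArg (LinearMap.trace ℂ V) hc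
    rw [hz] at h1
    have h2 := ip_char ρ ρ
    rw [IsIrreducible.finrank_intertwiningMap_self, ip, inv_mul_eq_iff_eq_mul₀ (by simp)] at h2
    simp [Algebra.algebraMap_eq_smul_one] at h1
    rw [← h1]
    simp only [Nat.cast_one, mul_one] at h2
    rw [← h2]
    refine Finset.sum_congr rfl fun g _ => ?_
    rw [mul_comm]; rfl
  have hd0 : (Module.finrank ℂ V : ℂ) ≠ 0 := by exact_mod_cast hd.ne'
  let q : ℚ := (Nat.card G : ℚ) / Module.finrank ℂ V
  have hq : (algebraMap ℚ ℂ q) = c := by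
    simp only [q]
    rw [map_div₀, map_natCast, map_natCast, ← htr]
    field_simp
  rw [← hq] at hci
  have hqi : IsIntegral ℤ q := (isIntegral_algebraMap_iff (algebraMap ℚ ℂ).injective).1 hci
  obtain ⟨k, hk⟩ := IsIntegrallyClosed.isIntegral_iff.1 hqi
  have hdQ : (Module.finrank ℂ V : ℚ) ≠ 0 := by exact_mod_cast hd.ne'
  have h5 : (k : ℚ) * Module.finrank ℂ V = Nat.card G := by
    have : (k : ℚ) = q := by simpa using hk
    rw [this]; simp only [q]; field_simp
  have h6 : (k : ℤ) * (Module.finrank ℂ V : ℤ) = (Nat.card G : ℤ) := by exact_mod_cast h5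
  have h7 : (Module.finrank ℂ V : ℤ) ∣ (Nat.card G : ℤ) := ⟨k, by rw [← h6, mul_comm]⟩
  exact_mod_cast h7
end

section
variable {G : Type} [Group G] [Fintype G]

lemma irrC_of_norm {V : Type} [AddCommGroup V] [Module ℂ V] [FiniteDimensional ℂ V]
    (ρ : Representation ℂ G V) (h : ip ρ.character ρ.character = 1) : IrrC G ρ.character := by
  rw [irrC_iff]
  refine ⟨FDRep.of ρ, ?_, rfl⟩
  have : NeZero (Nat.card G : ℂ) := ⟨by simp⟩
  rw [FDRep.simple_iff_char_is_norm_one]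
  rw [ip, inv_mul_eq_iff_eq_mul₀ (by simp)] at h
  simpa using! h

lemma IrrC.inv {χ : G → ℂ} (hχ : IrrC G χ) : IrrC G (fun g => χ g⁻¹) := by
  have h1 : ip χ χ = 1 := by rw [ip_irr hχ hχ, if_pos rfl]
  obtain ⟨V, _, _, _, ρ, hρ, rfl⟩ := hχ
  have h2 : (fun g => ρ.character g⁻¹) = ρ.dual.character := by
    ext g; rw [char_dual]
  rw [h2]
  apply irrC_of_norm
  rw [← h2, ← h1]
  simp only [ip, inv_inv]
  congr 1
  exact Finset.sum_congr rfl fun g _ => mul_comm _ _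

lemma irrC_linear (l : G →* ℂ) : IrrC G (fun g => l g) := by
  let ρ : Representation ℂ G ℂ :=
    { toFun := fun g => l g • (1 : Module.End ℂ ℂ)
      map_one' := by simp
      map_mul' := fun a b => by rw [map_mul, smul_mul_smul_comm, one_mul] }
  have h : (fun g => l g) = ρ.character := by
    ext g
    simp [character, ρ]
  rw [h]
  apply irrC_of_norm
  rw [← h, ip, inv_mul_eq_iff_eq_mul₀ (by simp)]
  simp only [← map_mul, mul_inv_cancel, map_one]
  simp

lemma irrC_one : IrrC G (1 : G → ℂ) := irrC_linear 1

lemma irrC_mul_decomp {χ ψ : G → ℂ} (hχ : IrrC G χ) (hψ : IrrC G ψ) :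
    ∃ s : Multiset (G → ℂ), (∀ φ ∈ s, IrrC G φ) ∧ s.sum = χ * ψ := by
  obtain ⟨V, _, _, _, ρ, h1, rfl⟩ := hχ
  obtain ⟨W, _, _, _, σ, h2, rfl⟩ := hψ
  obtain ⟨s, hs, hs'⟩ := char_decomp _ _ (tprod ρ σ) rfl
  exact ⟨s, hs, by rw [hs', char_tensor]⟩

lemma ip_count (s : Multiset (G → ℂ)) (hs : ∀ φ ∈ s, IrrC G φ) {ψ : G → ℂ} (hψ : IrrC G ψ) :
    ip s.sum ψ = s.count ψ := by
  induction s using Multiset.induction_on with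
  | empty => simp [ip_zero_left]
  | cons a s ih =>
    rw [Multiset.sum_cons, ip_add_left, ih fun φ h => hs φ (Multiset.mem_cons_of_mem h),
      ip_irr (hs a (Multiset.mem_cons_self a s)) hψ, Multiset.count_cons]
    by_cases h : a = ψ
    · simp [h, add_comm]
    · simp [h, Ne.symm h]

lemma msum_deg (s : Multiset (G → ℂ)) (d : ℕ) (hs : ∀ φ ∈ s, φ 1 = d) :
    s.sum 1 = (s.card * d : ℕ) := by
  induction s using Multiset.induction_on with
  | empty => simp
  | cons a s ih =>
    rw [Multiset.sum_cons, Pi.add_apply, ih fun φ h => hs φ (Multiset.mem_cons_of_mem h),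
      hs a (Multiset.mem_cons_self a s)]
    simp; ring

/-- sums of irreducible characters of degree `d` -/
def PureDeg (f : G → ℂ) (d : ℕ) : Prop :=
  ∃ s : Multiset (G → ℂ), (∀ φ ∈ s, IrrC G φ ∧ φ 1 = d) ∧ s.sum = f

lemma PureDeg.ip_eq_zero {f : G → ℂ} {d : ℕ} (h : PureDeg f d) {ψ : G → ℂ} (hψ : IrrC G ψ)
    (hd : ψ 1 ≠ d) : ip f ψ = 0 := by
  obtain ⟨s, hs, rfl⟩ := h
  rw [ip_count s (fun φ h => (hs φ h).1) hψ, Nat.cast_eq_zero, Multiset.count_eq_zero]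
  intro h
  exact hd (hs ψ h).2

lemma dichotomy {m n : ℕ} (hm : 1 < m) (hn : 1 < n) (hmn : m.Coprime n)
    (hdeg : ∀ χ, IrrC G χ → χ ≠ 1 → χ 1 = m ∨ χ 1 = n) {S T : G → ℂ} (hS : IrrC G S)
    (hT : IrrC G T) (hS1 : S 1 = m) (hT1 : T 1 = n) : PureDeg (S * T) m ∨ PureDeg (S * T) n := by
  obtain ⟨s, hs, hsum⟩ := irrC_mul_decomp hS hT
  have hne : m ≠ n := by
    rintro rfl
    simp at hmn; omega
  have h1 : ∀ φ ∈ s, φ 1 = m ∨ φ 1 = n := by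
    intro φ hφ
    refine hdeg φ (hs φ hφ) ?_
    rintro rfl
    have h2 : ip s.sum (1 : G → ℂ) = 0 := by
      rw [hsum, ip_mul_left, mul_one, ip_irr hS hT.inv, if_neg]
      intro h
      have := congrFun h 1
      simp only [inv_one] at this
      rw [hS1, hT1] at this
      exact hne (by exact_mod_cast this)
    rw [ip_count s hs irrC_one, Nat.cast_eq_zero, Multiset.count_eq_zero] at h2
    exact h2 hφ
  have hf := Multiset.filter_add_not (fun φ : G → ℂ => φ 1 = m) s
  set a := s.filter (fun φ : G → ℂ => φ 1 = m) with ha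
  set b := s.filter (fun φ : G → ℂ => ¬ φ 1 = m) with hb
  have ha1 : ∀ φ ∈ a, IrrC G φ ∧ φ 1 = m := fun φ h =>
    ⟨hs φ (Multiset.mem_filter.1 h).1, (Multiset.mem_filter.1 h).2⟩
  have hb1 : ∀ φ ∈ b, IrrC G φ ∧ φ 1 = n := fun φ h =>
    ⟨hs φ (Multiset.mem_filter.1 h).1,
      (h1 φ (Multiset.mem_filter.1 h).1).resolve_left (Multiset.mem_filter.1 h).2⟩
  have hd : s.sum 1 = (m * n : ℕ) := by rw [hsum]; simp [hS1, hT1]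
  rw [← hf, Multiset.sum_add, Pi.add_apply, msum_deg a m fun φ h => (ha1 φ h).2,
    msum_deg b n fun φ h => (hb1 φ h).2] at hd
  have hd' : a.card * m + b.card * n = m * n := by exact_mod_cast hd
  have k1 : n ∣ a.card := by
    have : n ∣ a.card * m := by
      rw [Nat.dvd_add_iff_left (Dvd.intro_left b.card rfl), hd']
      exact Dvd.intro_left m rfl
    exact (hmn.symm).dvd_of_dvd_mul_right this
  obtain ⟨u, hu⟩ := k1
  rcases Nat.eq_zero_or_pos u with h0 | h0
  · right
    have : a = 0 := by rw [← Multiset.card_eq_zero, hu, h0, mul_zero]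
    rw [this, zero_add] at hf
    exact ⟨b, hb1, by rw [hf, hsum]⟩
  · left
    have : b = 0 := by
      rw [← Multiset.card_eq_zero]
      have : m * n ≤ a.card * m := by
        rw [hu]; nlinarith [Nat.zero_le (m * n)]
      have h3 : b.card * n = 0 := by omega
      rcases Nat.mul_eq_zero.1 h3 with h | h
      · exact h
      · omega
    rw [this, add_zero] at hf
    exact ⟨a, ha1, by rw [hf, hsum]⟩

/-- irreducible characters `U` of degree `n` with `S * U` pure of degree `n` -/
def WSet (n : ℕ) (S : G → ℂ) : Set (G → ℂ) :=
  {U | IrrC G U ∧ U 1 = n ∧ PureDeg (S * U) n}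

lemma wset_step {m n : ℕ} (hm : 1 < m) (hn : 1 < n) (hmn : m.Coprime n)
    (hdeg : ∀ χ, IrrC G χ → χ ≠ 1 → χ 1 = m ∨ χ 1 = n) {S : G → ℂ} (hS : IrrC G S)
    (hS1 : S 1 = m) {f : G → ℂ} (hf : f ∈ AddSubmonoid.closure (WSet n S)) :
    S * f ∈ AddSubmonoid.closure (WSet n (fun g => S g⁻¹)) := by
  have hne : m ≠ n := by
    rintro rfl
    simp at hmn; omega
  induction hf using AddSubmonoid.closure_induction with
  | zero => simp
  | add x y _ _ hx hy => rw [mul_add]; exact add_mem hx hy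
  | mem U hU =>
    obtain ⟨hU, hU1, s, hs, hsum⟩ := hU
    rw [← hsum]
    refine multiset_sum_mem _ fun ψ hψ => AddSubmonoid.subset_closure ?_
    refine ⟨(hs ψ hψ).1, (hs ψ hψ).2, ?_⟩
    rcases dichotomy hm hn hmn hdeg hS.inv (hs ψ hψ).1 (by simpa using hS1) (hs ψ hψ).2 with h | h
    · exfalso
      have h0 := h.ip_eq_zero hU (by rw [hU1]; exact_mod_cast hne.symm)
      rw [mul_comm, ip_mul_left, ip_comm] at h0
      simp only [inv_inv] at h0
      have h1 : ip s.sum ψ = 0 := by rw [hsum]; exact h0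
      rw [ip_count s (fun φ h => (hs φ h).1) (hs ψ hψ).1, Nat.cast_eq_zero,
        Multiset.count_eq_zero] at h1
      exact h1 hψ
    · exact h

lemma fusion_aux (hsimple : ∀ K : Subgroup G, K.Normal → K = ⊥ ∨ K = ⊤)
    {m n : ℕ} (hm : 1 < m) (hn : 1 < n) (hmn : m.Coprime n)
    (hdeg : ∀ χ, IrrC G χ → χ ≠ 1 → χ 1 = m ∨ χ 1 = n) {S T : G → ℂ} (hS : IrrC G S)
    (hT : IrrC G T) (hS1 : S 1 = m) (hT1 : T 1 = n) (hp : PureDeg (S * T) n) : False := by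
  set α : G → ℂ := (fun g => S g⁻¹) * S with hα
  have hpow : ∀ k : ℕ, α ^ k * T ∈ AddSubmonoid.closure (WSet n S) := by
    intro k
    induction k with
    | zero =>
      have hmem : T ∈ WSet n S := ⟨hT, hT1, hp⟩
      simpa using AddSubmonoid.subset_closure hmem
    | succ k ih =>
      have h1 := wset_step hm hn hmn hdeg hS hS1 ih
      have h2 := wset_step hm hn hmn hdeg hS.inv (by simpa using hS1) h1
      simp only [inv_inv] at h2
      convert h2 using 1
      rw [hα]; ring
  have hz : ∀ f ∈ AddSubmonoid.closure (WSet n S), ∑ g, f g = 0 := by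
    intro f hf
    induction hf using AddSubmonoid.closure_induction with
    | zero => simp
    | add x y _ _ hx hy => simp [Finset.sum_add_distrib, hx, hy]
    | mem U hU =>
      have h1 := ip_irr hU.1 (irrC_one (G := G))
      rw [if_neg] at h1
      · simpa [ip] using h1
      · rintro rfl
        have := hU.2.1
        simp at this
        have : (1 : ℕ) = n := by exact_mod_cast this
        omega
  have hpoly : ∀ q : Polynomial ℂ, ∑ g, q.eval (α g) * T g = 0 := by
    intro q
    induction q using Polynomial.induction_on' with
    | add p q hp hq => simp [add_mul, Finset.sum_add_distrib, hp, hq]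
    | monomial k a =>
      have := hz _ (hpow k)
      simp only [Polynomial.eval_monomial, mul_assoc, ← Finset.mul_sum]
      simp only [Pi.mul_apply, Pi.pow_apply] at this
      rw [this, mul_zero]
  have hker : ∀ g, α g = α 1 → g = 1 := by
    have hip : ip α (1 : G → ℂ) = 1 := by
      rw [hα, mul_comm, ip_mul_left]
      simp only [inv_inv, mul_one]
      rw [ip_irr hS hS, if_pos rfl]
    obtain ⟨V, _, _, _, ρ, h1, rfl⟩ := hS
    have hch : α = (linHom ρ ρ).character := by
      ext g; rw [char_linHom]; rfl
    have hmem : ∀ g, g ∈ (linHom ρ ρ : G →* _).ker ↔ α g = α 1 := by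
      intro g
      rw [MonoidHom.mem_ker, hch, rep_eq_one_iff]
    intro g hg
    rcases hsimple (linHom ρ ρ : G →* _).ker inferInstance with h | h
    · rw [← hmem, h] at hg
      simpa using hg
    · exfalso
      have : ∀ g, α g = (m : ℂ) ^ 2 := by
        intro g
        rw [(hmem g).1 (by rw [h]; trivial), hα]
        simp only [Pi.mul_apply, inv_one]
        rw [hS1]; ring
      simp only [ip, this, Pi.one_apply, mul_one, Finset.sum_const, Finset.card_univ,
        Fintype.card_eq_nat_card, nsmul_eq_mul] at hip
      rw [inv_mul_cancel_left₀ (by simp)] at hip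
      have : m ^ 2 = 1 := by exact_mod_cast hip
      nlinarith
  let q : Polynomial ℂ := ∏ v ∈ (Finset.univ.image α).erase (α 1), (Polynomial.X - Polynomial.C v)
  have h1 := hpoly q
  rw [Finset.sum_eq_single (1 : G)] at h1
  · rcases mul_eq_zero.1 h1 with h | h
    · simp only [q, Polynomial.eval_prod, Finset.prod_eq_zero_iff] at h
      obtain ⟨v, hv, hv'⟩ := h
      simp [sub_eq_zero] at hv'
      exact (Finset.ne_of_mem_erase hv) hv'.symm
    · rw [hT1] at h
      have : n = 0 := by exact_mod_cast h
      omega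
  · intro g _ hg
    have : q.eval (α g) = 0 := by
      simp only [q, Polynomial.eval_prod, Finset.prod_eq_zero_iff]
      refine ⟨α g, ?_, by simp⟩
      refine Finset.mem_erase.2 ⟨fun h => hg (hker g h), ?_⟩
      exact Finset.mem_image_of_mem _ (Finset.mem_univ _)
    rw [this, zero_mul]
  · simp

lemma fusion (hsimple : ∀ K : Subgroup G, K.Normal → K = ⊥ ∨ K = ⊤)
    {m n : ℕ} (hm : 1 < m) (hn : 1 < n) (hmn : m.Coprime n)
    (hdeg : ∀ χ, IrrC G χ → χ ≠ 1 → χ 1 = m ∨ χ 1 = n) {S T : G → ℂ} (hS : IrrC G S)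
    (hT : IrrC G T) (hS1 : S 1 = m) (hT1 : T 1 = n) : False := by
  rcases dichotomy hm hn hmn hdeg hS hT hS1 hT1 with h | h
  · exact fusion_aux hsimple hn hm hmn.symm (fun χ h h' => (hdeg χ h h').symm) hT hS hT1 hS1
      (by rwa [mul_comm])
  · exact fusion_aux hsimple hm hn hmn hdeg hS hT hS1 hT1 h
end

lemma perfect_hom {N A : Type} [Group N] [CommGroup A] (h : commutator N = ⊤) (f : N →* A) (x : N) :
    f x = 1 := by
  have := Abelianization.commutator_subset_ker f
  rw [h] at this
  exact this (Subgroup.mem_top x)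

section
variable {N A : Type} [Group N] [CommGroup A] {Q : Subgroup N}

/-- maps `N → N` compatible with the cosets of `Q` and with `f` -/
def GoodMap (Q : Subgroup N) (f : N → A) (a : N → N) : Prop :=
  ∀ x y, ((a x)⁻¹ * a y ∈ Q ↔ x⁻¹ * y ∈ Q) ∧ (x⁻¹ * y ∈ Q → f ((a x)⁻¹ * a y) = f (x⁻¹ * y))

/-- transfer factor of a map -/
noncomputable def trf [Finite N] (Q : Subgroup N) (f : N → A) (a : N → N) : A :=
  ∏ᶠ c : N ⧸ Q, f ((a c.out : N ⧸ Q).out⁻¹ * a c.out)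

lemma GoodMap.comp {f : N → A} {a b : N → N} (ha : GoodMap Q f a) (hb : GoodMap Q f b) :
    GoodMap Q f (a ∘ b) := by
  intro x y
  refine ⟨(ha _ _).1.trans (hb _ _).1, fun h => ?_⟩
  exact ((ha _ _).2 ((hb _ _).1.2 h)).trans ((hb _ _).2 h)

lemma out_inv_mul (x : N) : ((x : N ⧸ Q).out)⁻¹ * x ∈ Q := by
  rw [← QuotientGroup.eq]; simp

lemma GoodMap.bij [Finite N] {f : N → A} {b : N → N} (hb : GoodMap Q f b) :
    Function.Bijective (fun c : N ⧸ Q => (b c.out : N ⧸ Q)) := by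
  apply Function.Injective.bijective_of_finite
  intro c d h
  have h := QuotientGroup.eq.1 h
  rw [(hb _ _).1, ← QuotientGroup.eq] at h
  simpa using h

lemma trf_comp [Finite N] {f : N → A} (hf : ∀ x ∈ Q, ∀ y ∈ Q, f (x * y) = f x * f y)
    {a b : N → N} (ha : GoodMap Q f a) (hb : GoodMap Q f b) :
    trf Q f (a ∘ b) = trf Q f a * trf Q f b := by
  have h1 : trf Q f a = ∏ᶠ c : N ⧸ Q,
      f ((a (b c.out : N ⧸ Q).out : N ⧸ Q).out⁻¹ * a (b c.out : N ⧸ Q).out) :=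
    (finprod_eq_of_bijective _ hb.bij fun c => rfl).symm
  rw [h1, trf, trf, ← finprod_mul_distrib (Set.toFinite _) (Set.toFinite _)]
  refine finprod_congr fun c => ?_
  set y := b c.out
  set x := (y : N ⧸ Q).out
  have hxy : x⁻¹ * y ∈ Q := out_inv_mul y
  have h2 : (a x : N ⧸ Q) = a y := QuotientGroup.eq.2 ((ha x y).1.2 hxy)
  show f ((a y : N ⧸ Q).out⁻¹ * a y) = _
  rw [← (ha x y).2 hxy, ← hf _ (out_inv_mul _) _ ((ha x y).1.2 hxy), h2]
  congr 1
  group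

lemma good_left (f : N → A) (n : N) : GoodMap Q f (fun x => n * x) := by
  intro x y
  have : (n * x)⁻¹ * (n * y) = x⁻¹ * y := by group
  simp only [this]
  simp

lemma good_right {f : N → A} (hf : ∀ x ∈ Q, ∀ y ∈ Q, f (x * y) = f x * f y) {q : N} (hq : q ∈ Q) :
    GoodMap Q f (fun x => x * q) := by
  intro x y
  have h : (x * q)⁻¹ * (y * q) = q⁻¹ * (x⁻¹ * y) * q := by group
  simp only [h]
  have hq' := Q.inv_mem hq
  refine ⟨⟨fun h => ?_, fun h => Q.mul_mem (Q.mul_mem hq' h) hq⟩, fun h => ?_⟩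
  · have := Q.mul_mem (Q.mul_mem hq h) hq'
    convert this using 1; group
  · have h1 : f 1 = 1 := by
      have := hf 1 Q.one_mem 1 Q.one_mem
      rw [mul_one] at this
      exact left_eq_mul.1 this
    rw [hf _ (Q.mul_mem hq' h) _ hq, hf _ hq' _ h, mul_comm, ← mul_assoc, ← hf _ hq _ hq']
    simp [h1]

lemma trf_right [Finite N] {f : N → A} {q : N} (hq : q ∈ Q) :
    trf Q f (fun x => x * q) = f q ^ Q.index := by
  have hc : ∀ c : N ⧸ Q, (((c.out * q : N) : N ⧸ Q)).out = c.out := by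
    intro c
    congr 1
    rw [QuotientGroup.mk_mul_of_mem _ hq]; simp
  simp only [trf, hc, inv_mul_cancel_left]
  have := Fintype.ofFinite (N ⧸ Q)
  rw [finprod_eq_prod_of_fintype, Finset.prod_const, Finset.card_univ, Subgroup.index,
    Nat.card_eq_fintype_card]

lemma trf_left_perfect [Finite N] (hN : commutator N = ⊤) {f : N → A}
    (hf : ∀ x ∈ Q, ∀ y ∈ Q, f (x * y) = f x * f y) (n : N) : trf Q f (fun x => n * x) = 1 := by
  let t : N →* A := MonoidHom.mk' (fun n => trf Q f (fun x => n * x)) (by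
    intro a b
    rw [← trf_comp hf (good_left f a) (good_left f b)]
    congr 1
    ext x; simp [mul_assoc])
  exact perfect_hom hN t n

end

section
variable {G : Type} [Group G] [Finite G]

open scoped IsMulCommutative in
lemma inv_char (p : ℕ) [Fact p.Prime] {P : Type} [Group P] [Finite P] (hP : IsPGroup p P)
    (Q : Subgroup P) [Q.Normal] (hQ : Q ≠ ⊥) :
    ∃ f : Q →* ℂˣ, (∀ (g : P) (x y : Q), (y : P) = g * x * g⁻¹ → f y = f x) ∧ ∃ q, f q ≠ 1 := by
  have hnil := hP.isNilpotent
  set R : Subgroup P := ⁅Q, (⊤ : Subgroup P)⁆ with hR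
  have hRQ : ∃ q ∈ Q, q ∉ R := by
    by_contra! hle
    apply hQ
    obtain ⟨n, hn⟩ := Subgroup.nilpotent_iff_lowerCentralSeries.1 hnil
    rw [eq_bot_iff, ← hn]
    clear hn
    induction n with
    | zero => simp
    | succ n ih =>
      rw [Subgroup.lowerCentralSeries_succ]
      exact le_trans hle (Subgroup.commutator_mono ih le_rfl)
  obtain ⟨q, hq, hqR⟩ := hRQ
  let i : Q →* P ⧸ R := (QuotientGroup.mk' R).comp Q.subtype
  have hi : ∀ x, i x ∈ Subgroup.center (P ⧸ R) := by
    intro x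
    rw [Subgroup.mem_center_iff]
    intro g
    induction g using QuotientGroup.induction_on with
    | H g =>
    show ((g * x : P) : P ⧸ R) = ((x * g : P) : P ⧸ R)
    rw [QuotientGroup.eq]
    have := Subgroup.commutator_mem_commutator (Q.inv_mem x.2) (Subgroup.mem_top g⁻¹)
    rw [commutatorElement_def] at this
    convert this using 1
    group
  let j : Q →* Subgroup.center (P ⧸ R) := i.codRestrict _ hi
  have hj : j ⟨q, hq⟩ ≠ 1 := by
    intro h
    have h2 : i ⟨q, hq⟩ = 1 := congrArg Subtype.val h
    exact hqR ((QuotientGroup.eq_one_iff q).1 h2)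
  obtain ⟨φ, hφ⟩ := CommGroup.exists_apply_ne_one_of_hasEnoughRootsOfUnity
    (Subgroup.center (P ⧸ R)) ℂ hj
  refine ⟨φ.comp j, fun g x y hxy => ?_, ⟨q, hq⟩, hφ⟩
  have : j y = j x := by
    apply Subtype.ext
    show ((y : P) : P ⧸ R) = ((x : P) : P ⧸ R)
    rw [hxy]
    have := Subgroup.mem_center_iff.1 (hi x) (g : P ⧸ R)
    show (g : P ⧸ R) * (x : P) * (g : P ⧸ R)⁻¹ = _
    rw [show (g : P ⧸ R) * ((x : P) : P ⧸ R) = ((x : P) : P ⧸ R) * g from this]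
    group
  simp [this]

lemma tate (p : ℕ) [Fact p.Prime] (N : Subgroup G) [N.Normal] (hN : commutator N = ⊤)
    (hp : p ∣ Nat.card N) (P : Sylow p G) :
    ∃ l : P →* ℂˣ, ∃ q : P, (q : G) ∈ N ∧ l q ≠ 1 := by
  set Q : Subgroup N := (P : Subgroup G).subgroupOf N with hQdef
  have hidx : ¬ p ∣ Q.index := by
    intro hd
    apply P.not_dvd_index
    refine dvd_trans hd ?_
    have e1 := Subgroup.relIndex_mul_index (H := N) (K := (P : Subgroup G) ⊔ N) le_sup_right
    have e2 := Subgroup.relIndex_mul_index (H := (P : Subgroup G)) (K := (P : Subgroup G) ⊔ N)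
      le_sup_left
    have e3 := Subgroup.relIndex_mul_index (H := (P : Subgroup G) ⊓ N) (K := N) inf_le_right
    have e4 := Subgroup.relIndex_mul_index (H := (P : Subgroup G) ⊓ N) (K := (P : Subgroup G))
      inf_le_left
    rw [Subgroup.inf_relIndex_right] at e3
    rw [Subgroup.inf_relIndex_left] at e4
    rw [Subgroup.relIndex_sup_right] at e1
    have e5 : (P : Subgroup G).relIndex N = (P : Subgroup G).relIndex ((P : Subgroup G) ⊔ N) := by
      have hx : N.index ≠ 0 := Subgroup.index_ne_zero_of_finite
      apply Nat.eq_of_mul_eq_mul_right (Nat.pos_of_ne_zero hx)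
      rw [e3, ← e4, ← e2, ← e1]
      ring
    rw [← e2, ← e5]
    exact Dvd.intro _ rfl
  have hne : N.subgroupOf (P : Subgroup G) ≠ ⊥ := by
    intro h
    apply hidx
    have : Q = ⊥ := by
      rw [hQdef, Subgroup.subgroupOf_eq_bot, disjoint_comm, ← Subgroup.subgroupOf_eq_bot]
      exact h
    rw [this, Subgroup.index_bot]
    exact hp
  obtain ⟨f, hf, ⟨⟨q, hqN'⟩, hq⟩⟩ := inv_char p P.isPGroup' (N.subgroupOf (P : Subgroup G)) hne
  have hqN : (q : G) ∈ N := hqN'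
  let F : N → ℂˣ := fun x => if h : (x : G) ∈ (P : Subgroup G) then
    f ⟨⟨x, h⟩, by rw [Subgroup.mem_subgroupOf]; exact x.2⟩ else 1
  have hF : ∀ x ∈ Q, ∀ y ∈ Q, F (x * y) = F x * F y := by
    intro x hx y hy
    rw [Subgroup.mem_subgroupOf] at hx hy
    have hxy : ((x * y : N) : G) ∈ (P : Subgroup G) := by simpa using mul_mem hx hy
    simp only [F]
    rw [dif_pos hx, dif_pos hy, dif_pos hxy, ← map_mul]
    rfl
  have hgood : ∀ g : P, GoodMap Q F (fun x => MulAut.conjNormal (g : G) x) := by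
    intro g x y
    rw [← map_inv, ← map_mul]
    generalize x⁻¹ * y = z
    have h1 : MulAut.conjNormal (g : G) z ∈ Q ↔ z ∈ Q := by
      simp only [hQdef, Subgroup.mem_subgroupOf, MulAut.conjNormal_apply]
      rw [Subgroup.mul_mem_cancel_right _ (inv_mem g.2), Subgroup.mul_mem_cancel_left _ g.2]
    refine ⟨h1, fun hz => ?_⟩
    have h2 := h1.2 hz
    rw [Subgroup.mem_subgroupOf] at hz h2
    simp only [F]
    rw [dif_pos hz, dif_pos h2]
    exact hf g _ _ (Subtype.ext (by simp))
  let l : P →* ℂˣ := MonoidHom.mk' (fun g => trf Q F (fun x => MulAut.conjNormal (g : G) x)) (by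
    intro a b
    rw [← trf_comp hF (hgood a) (hgood b)]
    congr 1
    ext x; simp [mul_assoc])
  refine ⟨l, q, hqN, fun h => ?_⟩
  have hqQ : (⟨q, hqN⟩ : N) ∈ Q := by rw [Subgroup.mem_subgroupOf]; exact q.2
  have h1 : (fun x => MulAut.conjNormal (q : G) x) =
      (fun x : N => (⟨q, hqN⟩ : N) * x) ∘ (fun x => x * (⟨q, hqN⟩ : N)⁻¹) := by
    ext x; simp [mul_assoc]
  have h2 : trf Q F (fun x => MulAut.conjNormal (q : G) x) = 1 := h
  rw [h1, trf_comp hF (good_left _ _) (good_right hF (inv_mem hqQ)), trf_left_perfect hN hF,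
    one_mul, trf_right (inv_mem hqQ)] at h2
  have h3 : F (⟨q, hqN⟩ : N)⁻¹ = (f ⟨q, hqN'⟩)⁻¹ := by
    simp only [F]
    rw [dif_pos (show ((⟨q, hqN⟩ : N)⁻¹ : N).1 ∈ (P : Subgroup G) from inv_mem q.2), ← map_inv]
    rfl
  rw [h3, inv_pow, inv_eq_one] at h2
  obtain ⟨k, hk⟩ := P.isPGroup' q
  have h4 : f ⟨q, hqN'⟩ ^ p ^ k = 1 := by
    rw [← map_pow]
    convert map_one f
    exact Subtype.ext hk
  apply hq
  have h5 : Nat.Coprime (p ^ k) Q.index :=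
    Nat.Coprime.pow_left _ ((Nat.Prime.coprime_iff_not_dvd Fact.out).2 hidx)
  rw [← pow_one (f _), ← orderOf_dvd_iff_pow_eq_one, ← h5]
  exact Nat.dvd_gcd (orderOf_dvd_of_pow_eq_one h4) (orderOf_dvd_of_pow_eq_one h2)

end

section
variable {G : Type} [Group G] [Finite G]

/-- vectors fixed by a normal subgroup -/
def fixedSub {V : Type} [AddCommGroup V] [Module ℂ V] (ρ : Representation ℂ G V) (N : Subgroup G)
    [hN : N.Normal] : Subrepresentation ρ where
  toSubmodule :=
    { carrier := {v | ∀ n ∈ N, ρ n v = v}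
      add_mem' := fun {a b} ha hb n hn => by rw [map_add, ha n hn, hb n hn]
      zero_mem' := fun n hn => map_zero _
      smul_mem' := fun c v hv n hn => by rw [map_smul, hv n hn] }
  apply_mem_toSubmodule := fun g v hv n hn => by
    have h1 := hv (g⁻¹ * n * g) (by simpa using hN.conj_mem n hn g⁻¹)
    have h2 : ρ n (ρ g v) = ρ g (ρ (g⁻¹ * n * g) v) := by
      rw [← Module.End.mul_apply, ← Module.End.mul_apply, ← map_mul, ← map_mul]
      congr 2; group
    rw [h2, h1]

/-- the submodule induced from a linear character of `P` -/
def indSub (P : Subgroup G) (l : P →* ℂˣ) : Submodule ℂ (G → ℂ) where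
  carrier := {f | ∀ (g : G) (h : P), f (g * h) = (l h : ℂ) * f g}
  add_mem' := fun {a b} ha hb g h => by simp only [Pi.add_apply]; rw [ha, hb, mul_add]
  zero_mem' := fun g h => by simp
  smul_mem' := fun c f hf g h => by simp only [Pi.smul_apply, smul_eq_mul]; rw [hf]; ring

lemma indSub_finrank (P : Subgroup G) (l : P →* ℂˣ) :
    Module.finrank ℂ (indSub P l) = P.index := by
  have := Fintype.ofFinite (G ⧸ P)
  let e : indSub P l ≃ₗ[ℂ] (G ⧸ P → ℂ) :=
    { toFun := fun f c => f.1 c.out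
      map_add' := fun f g => rfl
      map_smul' := fun c f => rfl
      invFun := fun u => ⟨fun g => (l ⟨_, out_inv_mul (Q := P) g⟩ : ℂ) * u g, by
        intro g h
        have h1 : ((g * h : G) : G ⧸ P) = g := QuotientGroup.mk_mul_of_mem _ h.2
        have h2 : (⟨_, out_inv_mul (Q := P) (g * h)⟩ : P) = ⟨_, out_inv_mul (Q := P) g⟩ * h := by
          apply Subtype.ext
          simp only [Subgroup.coe_mul]
          rw [h1, mul_assoc]
        beta_reduce
        rw [h2, h1, map_mul]
        push_cast
        ring⟩
      left_inv := fun f => by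
        apply Subtype.ext
        ext g
        show (l ⟨_, out_inv_mul (Q := P) g⟩ : ℂ) * f.1 _ = f.1 g
        rw [← f.2]
        simp
      right_inv := fun u => by
        ext c
        have h2 : (⟨_, out_inv_mul (Q := P) c.out⟩ : P) = 1 := by
          apply Subtype.ext
          simp
        show (l ⟨_, out_inv_mul (Q := P) c.out⟩ : ℂ) * u _ = u c
        rw [h2]
        simp }
  rw [e.finrank_eq, Module.finrank_fintype_fun_eq_card, Subgroup.index, Nat.card_eq_fintype_card]

/-- the induced representation -/
def indRep (P : Subgroup G) (l : P →* ℂˣ) : Representation ℂ G (indSub P l) where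
  toFun := fun x =>
    { toFun := fun f => ⟨fun g => f.1 (x⁻¹ * g), fun g h => by beta_reduce; rw [← mul_assoc, f.2]⟩
      map_add' := fun f g => rfl
      map_smul' := fun c f => rfl }
  map_one' := by
    ext f g
    simp
  map_mul' := fun x y => by
    ext f g
    simp [mul_assoc]

lemma indRep_fixed (P N : Subgroup G) [hN : N.Normal] (l : P →* ℂˣ) (q : P) (hq : (q : G) ∈ N)
    (hl : l q ≠ 1) (f : indSub P l) (hf : ∀ n ∈ N, indRep P l n f = f) : f = 0 := by
  apply Subtype.ext
  ext g
  have h1 := hf (g * (q : G)⁻¹ * g⁻¹) (hN.conj_mem _ (inv_mem hq) g)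
  have h2 : f.1 ((g * (q : G)⁻¹ * g⁻¹ : G)⁻¹ * g) = f.1 g := congrFun (congrArg Subtype.val h1) g
  have h3 : ((g * (q : G)⁻¹ * g⁻¹ : G)⁻¹ * g) = g * q := by group
  rw [h3, f.2] at h2
  have h4 : ((l q : ℂ) - 1) * f.1 g = 0 := by rw [sub_mul, h2]; ring
  rcases mul_eq_zero.1 h4 with h | h
  · exact absurd (Units.ext (sub_eq_zero.1 h)) hl
  · exact h

lemma exists_irr_not_dvd (p : ℕ) [Fact p.Prime] (N : Subgroup G) [N.Normal]
    (hN : commutator N = ⊤) (hp : p ∣ Nat.card N) :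
    ∃ χ, IrrC G χ ∧ (∃ n ∈ N, χ n ≠ χ 1) ∧ ∀ d : ℕ, χ 1 = d → ¬ p ∣ d := by
  have : Fintype G := Fintype.ofFinite G
  have P : Sylow p G := default
  obtain ⟨l, q, hq, hl⟩ := tate p N hN hp P
  by_contra! hcon
  obtain ⟨s, hs, hsum⟩ := char_decomp _ _ (indRep (P : Subgroup G) l) rfl
  have hdiv : ∀ φ ∈ s, ∃ k : ℕ, φ 1 = (p * k : ℕ) := by
    intro φ hφ
    have hirr := hs φ hφ
    have hc := ip_count s hs hirr
    rw [hsum] at hc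
    have hex : ∃ n ∈ N, φ n ≠ φ 1 := by
      by_contra! htriv
      obtain ⟨V, _, _, _, ρ, hρ, rfl⟩ := hirr
      rw [ip_char] at hc
      have hpos : 0 < Module.finrank ℂ (IntertwiningMap ρ (indRep (P : Subgroup G) l)) := by
        have : 0 < s.count ρ.character := Multiset.count_pos.2 hφ
        have h2 : Module.finrank ℂ (IntertwiningMap ρ (indRep (P : Subgroup G) l))
          = s.count ρ.character := by exact_mod_cast hc
        omega
      have hnt := Module.nontrivial_of_finrank_pos hpos
      obtain ⟨F, hF⟩ := exists_ne (0 : IntertwiningMap ρ (indRep (P : Subgroup G) l))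
      apply hF
      ext1
      ext1 v
      refine indRep_fixed (P : Subgroup G) N l q hq hl _ fun n hn => ?_
      have h1 := LinearMap.congr_fun (F.isIntertwining' n) v
      have h2 : ρ n = 1 := (rep_eq_one_iff ρ n).1 (htriv n hn)
      rw [LinearMap.comp_apply, h2] at h1
      exact h1.symm
    obtain ⟨d, hd, k, rfl⟩ := hcon φ hirr hex
    exact ⟨k, hd⟩
  have hall : ∃ k : ℕ, s.sum 1 = (p * k : ℕ) := by
    clear hsum hs
    induction s using Multiset.induction_on with
    | empty => exact ⟨0, by simp⟩
    | cons a s ih =>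
      obtain ⟨k, hk⟩ := ih fun φ h => hdiv φ (Multiset.mem_cons_of_mem h)
      obtain ⟨j, hj⟩ := hdiv a (Multiset.mem_cons_self a s)
      refine ⟨j + k, ?_⟩
      rw [Multiset.sum_cons, Pi.add_apply, hk, hj]
      push_cast; ring
  obtain ⟨k, hk⟩ := hall
  rw [hsum, char_one, indSub_finrank] at hk
  exact P.not_dvd_index ⟨k, by exact_mod_cast hk⟩


lemma one_dim_fixed {V : Type} [AddCommGroup V] [Module ℂ V] {N : Type} [Group N]
    (hN : commutator N = ⊤) (ρ : Representation ℂ N V) (v : V) (hv : v ≠ 0)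
    (h : ∀ n, ∃ c : ℂ, ρ n v = c • v) (n : N) : ρ n v = v := by
  choose c hc using h
  have hinj : ∀ a b : ℂ, a • v = b • v → a = b := fun a b h => smul_left_injective ℂ hv h
  let C : N →* ℂ :=
    { toFun := c
      map_one' := hinj _ _ (by rw [← hc]; simp)
      map_mul' := fun a b => hinj _ _ (by
        rw [← hc, map_mul, Module.End.mul_apply, hc b, map_smul, hc a, smul_smul, mul_comm]) }
  have h1 := perfect_hom hN C.toHomUnits n
  have h2 : c n = 1 := congrArg Units.val h1
  rw [hc, h2, one_smul]

lemma coprime_trivial {V : Type} [AddCommGroup V] [Module ℂ V] [FiniteDimensional ℂ V]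
    (ρ : Representation ℂ G V) (hρ : ρ.IsIrreducible) (N : Subgroup G) [hNn : N.Normal]
    (hN : commutator N = ⊤) (hco : (Module.finrank ℂ V).Coprime (Nat.card N)) :
    ∀ n ∈ N, ρ n = 1 := by
  let Inv : Submodule ℂ V → Prop := fun U => ∀ n ∈ N, ∀ v ∈ U, ρ n v ∈ U
  have hVpos : 0 < Module.finrank ℂ V := by
    obtain ⟨d, hd, hd'⟩ := IrrC.one_pos (G := G) ⟨V, _, _, ‹_›, ρ, hρ, rfl⟩
    rw [char_one] at hd'
    have : Module.finrank ℂ V = d := by exact_mod_cast hd'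
    omega
  have hVnt := Module.nontrivial_of_finrank_pos hVpos
  have hex : ∃ w, ∃ U : Submodule ℂ V, U ≠ ⊥ ∧ Inv U ∧ Module.finrank ℂ U = w :=
    ⟨_, ⊤, top_ne_bot, fun _ _ _ _ => Submodule.mem_top, rfl⟩
  obtain ⟨W, hW, hWI, hWw⟩ := Nat.find_spec hex
  set w := Nat.find hex with hw
  have hmin : ∀ U : Submodule ℂ V, U ≠ ⊥ → Inv U → w ≤ Module.finrank ℂ U :=
    fun U h1 h2 => Nat.find_min' hex ⟨U, h1, h2, rfl⟩
  have hwpos : 0 < w := by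
    rw [← hWw]; exact Nat.pos_of_ne_zero fun h => hW (Submodule.finrank_eq_zero.1 h)
  -- `w ∣ |N|`
  have hwN : w ∣ Nat.card N := by
    let W' : Subrepresentation (ρ.comp N.subtype) := ⟨W, fun g v hv => hWI g g.2 v hv⟩
    have hirr : W'.toRepresentation.IsIrreducible := by
      have hWnt : Nontrivial W := Submodule.nontrivial_iff_ne_bot.2 hW
      refine @IsSimpleOrder.mk _ _ _ ?_ ?_
      · refine ⟨⊥, ⊤, fun h => ?_⟩
        have h1 : (⊥ : Submodule ℂ W) = ⊤ := congrArg Subrepresentation.toSubmodule h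
        exact bot_ne_top h1
      · intro U
        by_cases hU : U.toSubmodule = ⊥
        · left
          exact Subrepresentation.toSubmodule_injective hU
        · right
          apply Subrepresentation.toSubmodule_injective
          show U.toSubmodule = (⊤ : Submodule ℂ W)
          apply Submodule.eq_top_of_finrank_eq
          apply le_antisymm (Submodule.finrank_le _)
          rw [show Module.finrank ℂ W'.toSubmodule = w from hWw]
          have h1 : Module.finrank ℂ (Submodule.map W.subtype U.toSubmodule) =
              Module.finrank ℂ U.toSubmodule :=
            (Submodule.equivMapOfInjective W.subtype (Submodule.injective_subtype W) _).symm.finrank_eq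
          rw [← h1]
          apply hmin
          · intro h
            rw [h, finrank_bot] at h1
            exact hU (Submodule.finrank_eq_zero.1 h1.symm)
          · rintro n hn _ ⟨u, hu, rfl⟩
            exact ⟨_, U.apply_mem_toSubmodule ⟨n, hn⟩ hu, rfl⟩
    have := degree_dvd W'.toRepresentation hirr
    rwa [show Module.finrank ℂ W'.toSubmodule = w from hWw] at this
  -- `w ∣ dim V`
  have hwV : w ∣ Module.finrank ℂ V := by
    have key : ∀ k : ℕ, ∃ U : Submodule ℂ V, Inv U ∧ w ∣ Module.finrank ℂ U ∧
        (U = ⊤ ∨ k ≤ Module.finrank ℂ U) := by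
      intro k
      induction k with
      | zero => exact ⟨⊥, fun n hn v hv => by
          rw [Submodule.mem_bot] at hv ⊢; rw [hv, map_zero], by simp, by simp⟩
      | succ k ih =>
        obtain ⟨U, hUI, hUd, hU⟩ := ih
        by_cases hT : U = ⊤
        · exact ⟨U, hUI, hUd, Or.inl hT⟩
        have hk := hU.resolve_left hT
        have hg : ∃ g, ¬ W.map (ρ g) ≤ U := by
          by_contra! hall
          apply hT
          let S : Subrepresentation ρ := ⟨⨆ g, W.map (ρ g), fun g v hv => by
            have h1 : (⨆ g, W.map (ρ g)) ≤ Submodule.comap (ρ g) (⨆ g, W.map (ρ g)) := by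
              refine iSup_le fun x => ?_
              rintro _ ⟨u, hu, rfl⟩
              refine (le_iSup (fun g => W.map (ρ g)) (g * x)) ⟨u, hu, ?_⟩
              rw [map_mul]; rfl
            exact h1 hv⟩
          rcases hρ.eq_bot_or_eq_top S with h | h
          · exfalso
            apply hW
            have h1 : (⨆ g, W.map (ρ g)) = ⊥ := congrArg Subrepresentation.toSubmodule h
            have h2 := le_iSup (fun g => W.map (ρ g)) 1
            rw [h1] at h2
            rw [map_one] at h2
            rw [eq_bot_iff]
            exact fun u hu => h2 ⟨u, hu, rfl⟩
          · have h1 : (⨆ g, W.map (ρ g)) = ⊤ := congrArg Subrepresentation.toSubmodule h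
            rw [eq_top_iff, ← h1]
            exact iSup_le hall
        obtain ⟨g, hg⟩ := hg
        have hgi : Function.Injective (ρ g) := by
          intro a b h
          have := congrArg (ρ g⁻¹) h
          simpa [← Module.End.mul_apply, ← map_mul] using this
        have hgI : Inv (W.map (ρ g)) := by
          rintro n hn _ ⟨u, hu, rfl⟩
          refine ⟨ρ (g⁻¹ * n * g) u, hWI _ (by simpa using hNn.conj_mem n hn g⁻¹) u hu, ?_⟩
          rw [← Module.End.mul_apply, ← Module.End.mul_apply, ← map_mul, ← map_mul]
          congr 2; group
        have hgw : Module.finrank ℂ (W.map (ρ g)) = w := by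
          rw [← hWw]; exact (Submodule.equivMapOfInjective (ρ g) hgi W).symm.finrank_eq
        have hinf : U ⊓ W.map (ρ g) = ⊥ := by
          by_contra hne
          have h1 := hmin _ hne (fun n hn v hv => ⟨hUI n hn v hv.1, hgI n hn v hv.2⟩)
          apply hg
          have h2 : U ⊓ W.map (ρ g) = W.map (ρ g) :=
            Submodule.eq_of_le_of_finrank_le inf_le_right (by rw [hgw]; exact h1)
          rw [← h2]; exact inf_le_left
        have hd := Submodule.finrank_sup_add_finrank_inf_eq U (W.map (ρ g))
        rw [hinf, finrank_bot, add_zero, hgw] at hd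
        refine ⟨U ⊔ W.map (ρ g), ?_, ?_, Or.inr ?_⟩
        · intro n hn v hv
          obtain ⟨a, ha, b, hb, rfl⟩ := Submodule.mem_sup.1 hv
          rw [map_add]
          exact Submodule.add_mem_sup (hUI n hn a ha) (hgI n hn b hb)
        · rw [hd]; exact dvd_add hUd dvd_rfl
        · omega
    obtain ⟨U, _, hd, h⟩ := key (Module.finrank ℂ V + 1)
    have hle := Submodule.finrank_le U
    have hU : U = ⊤ := h.resolve_right (by omega)
    rwa [hU, finrank_top] at hd
  have hw1 : w = 1 := Nat.eq_one_of_dvd_coprimes hco hwV hwN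
  rw [hw1] at hWw
  obtain ⟨⟨v, hvW⟩, hv0, hv⟩ := finrank_eq_one_iff'.1 hWw
  have hv0' : v ≠ 0 := fun h => hv0 (Subtype.ext h)
  have hfix := one_dim_fixed hN (ρ.comp N.subtype) v hv0' (fun n => by
    obtain ⟨c, hc⟩ := hv ⟨ρ n v, hWI n n.2 v hvW⟩
    exact ⟨c, (congrArg Subtype.val hc).symm⟩)
  have hmem : v ∈ (fixedSub ρ N).toSubmodule := fun n hn => hfix ⟨n, hn⟩
  rcases hρ.eq_bot_or_eq_top (fixedSub ρ N) with h | h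
  · rw [h] at hmem
    exact absurd hmem hv0'
  · intro n hn
    ext x
    have : x ∈ (fixedSub ρ N).toSubmodule := by rw [h]; exact Submodule.mem_top
    exact this n hn

end

lemma deg_ne_card {G : Type} [Group G] [Finite G] {V : Type} [AddCommGroup V] [Module ℂ V]
    [FiniteDimensional ℂ V]
    (ρ : Representation ℂ G V) (hρ : ρ.IsIrreducible) (h : Module.finrank ℂ V = Nat.card G) (g : G) :
    ρ g = 1 := by
  have : Fintype G := Fintype.ofFinite G
  have hVnt : Nontrivial V := Module.nontrivial_of_finrank_pos (R := ℂ) (by rw [h]; exact Nat.card_pos)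
  obtain ⟨v, hv⟩ := exists_ne (0 : V)
  let F : (G → ℂ) →ₗ[ℂ] V := Fintype.linearCombination ℂ (fun x => ρ x v)
  have hF : ∀ c, F c = ∑ x, c x • ρ x v := fun c => rfl
  have hmem : ∀ x, ρ x v ∈ LinearMap.range F := fun x =>
    ⟨Pi.single x 1, by simp [hF, Pi.single_apply]⟩
  let R : Subrepresentation ρ := ⟨LinearMap.range F, by
    rintro y _ ⟨c, rfl⟩
    rw [hF, map_sum]
    refine Submodule.sum_mem _ fun x _ => ?_
    rw [map_smul, ← Module.End.mul_apply, ← map_mul]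
    exact Submodule.smul_mem _ _ (hmem _)⟩
  have hsurj : Function.Surjective F := by
    rw [← LinearMap.range_eq_top]
    rcases hρ.eq_bot_or_eq_top R with h | h
    · exfalso
      have h1 : LinearMap.range F = ⊥ := congrArg Subrepresentation.toSubmodule h
      have h2 := hmem 1
      rw [h1] at h2
      simp at h2
      exact hv h2
    · exact congrArg Subrepresentation.toSubmodule h
  have hinj : Function.Injective F := by
    rw [LinearMap.injective_iff_surjective_of_finrank_eq_finrank]
    · exact hsurj
    · rw [h, Module.finrank_fintype_fun_eq_card, Nat.card_eq_fintype_card]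
  have hne : ∑ x, ρ x v ≠ 0 := by
    intro h0
    have h1 : F 1 = F 0 := by simp [hF, h0]
    have h2 := congrFun (hinj h1) 1
    simp at h2
  have hfix : ∑ x, ρ x v ∈ (fixedSub ρ (⊤ : Subgroup G)).toSubmodule := by
    intro y _
    rw [map_sum]
    simp only [← Module.End.mul_apply, ← map_mul]
    exact Fintype.sum_equiv (Equiv.mulLeft y) _ _ fun x => rfl
  rcases hρ.eq_bot_or_eq_top (fixedSub ρ (⊤ : Subgroup G)) with h | h
  · rw [h] at hfix
    exact absurd hfix hne
  · ext x
    have : x ∈ (fixedSub ρ (⊤ : Subgroup G)).toSubmodule := by rw [h]; exact Submodule.mem_top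
    exact this g (Subgroup.mem_top g)

lemma codeg_char {G : Type} [Group G] [Finite G] {V : Type} [AddCommGroup V] [Module ℂ V]
    [FiniteDimensional ℂ V] (ρ : Representation ℂ G V) :
    codeg ρ.character = ((MonoidHom.ker (ρ : G →* _)).index : ℂ) / Module.finrank ℂ V := by
  have h1 : charKer ρ.character = (MonoidHom.ker (ρ : G →* _) : Set G) := by
    ext g
    exact rep_eq_one_iff ρ g
  rw [codeg, char_one, h1]
  congr 1
  have h2 := Subgroup.card_mul_index (MonoidHom.ker (ρ : G →* _))
  rw [← h2]
  have h3 : (Nat.card (MonoidHom.ker (ρ : G →* _)) : ℂ) ≠ 0 := by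
    exact_mod_cast Nat.card_pos.ne'
  push_cast
  exact mul_div_cancel_left₀ _ h3

lemma codSet_quot {G : Type} [Group G] [Finite G] (K : Subgroup G) [K.Normal] :
    codSet (G ⧸ K) ⊆ codSet G := by
  rintro c ⟨χ, hχ, rfl⟩
  rw [← irrC_iff] at hχ
  obtain ⟨V, _, _, _, ρ, hρ, rfl⟩ := hχ
  let σ : Representation ℂ G V := ρ.comp (QuotientGroup.mk' K)
  refine ⟨σ.character, ?_, ?_⟩
  · rw [← irrC_iff]
    refine ⟨V, _, _, ‹_›, σ, ?_, rfl⟩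
    refine @IsSimpleOrder.mk _ _ _ ?_ ?_
    · refine ⟨⊥, ⊤, fun h => ?_⟩
      have h1 : (⊥ : Submodule ℂ V) = ⊤ := congrArg Subrepresentation.toSubmodule h
      have h2 : (⊥ : Subrepresentation ρ) = ⊤ := Subrepresentation.toSubmodule_injective h1
      exact bot_ne_top h2
    · intro U
      let U' : Subrepresentation ρ := ⟨U.toSubmodule, fun g v hv => by
        induction g using QuotientGroup.induction_on with
        | H g => exact U.apply_mem_toSubmodule g hv⟩
      rcases hρ.eq_bot_or_eq_top U' with h | h
      · left
        apply Subrepresentation.toSubmodule_injective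
        have h1 : U.toSubmodule = ⊥ := congrArg Subrepresentation.toSubmodule h
        exact h1
      · right
        apply Subrepresentation.toSubmodule_injective
        have h1 : U.toSubmodule = ⊤ := congrArg Subrepresentation.toSubmodule h
        exact h1
  · rw [codeg_char, codeg_char]
    have h1 : MonoidHom.ker (σ : G →* _) =
      (MonoidHom.ker (ρ : (G ⧸ K) →* _)).comap (QuotientGroup.mk' K) := by
      ext g; rfl
    rw [h1, Subgroup.index_comap_of_surjective _ (QuotientGroup.mk'_surjective K)]

lemma codSet_finite (G : Type) [Group G] [Finite G] : (codSet G).Finite := by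
  have hfin := ((Set.finite_Iic (Nat.card G)).prod (Set.finite_Iic (Nat.card G))).image
    (fun x : ℕ × ℕ => (x.1 : ℂ) / x.2)
  refine hfin.subset ?_
  rintro c ⟨χ, hχ, rfl⟩
  rw [← irrC_iff] at hχ
  obtain ⟨V, _, _, _, ρ, hρ, rfl⟩ := hχ
  rw [codeg_char]
  exact ⟨(_, _), ⟨Nat.le_of_dvd Nat.card_pos (Subgroup.index_dvd_card _),
    Nat.le_of_dvd Nat.card_pos (degree_dvd ρ hρ)⟩, rfl⟩

lemma three_elts {S : Set ℂ} (hS : S.Finite) (h : S.ncard ≤ 3) {x y : ℂ} (hx : x ∈ S) (hy : y ∈ S)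
    (hxy : x ≠ y) : ∃ b, ∀ z ∈ S, z = x ∨ z = y ∨ z = b := by
  by_contra! hcon
  obtain ⟨z, hz, hzx, hzy, _⟩ := hcon x
  obtain ⟨w, hw, hwx, hwy, hwz⟩ := hcon z
  have hsub : ((({x, y, z, w} : Finset ℂ)) : Set ℂ) ⊆ S := by
    intro t ht
    simp at ht
    rcases ht with rfl | rfl | rfl | rfl <;> assumption
  have h1 := Set.ncard_le_ncard hsub hS
  have h2 : ({x, y, z, w} : Finset ℂ).card = 4 := by
    simp [Finset.card_insert_of_notMem, hxy, hzx.symm, hwx.symm, hzy.symm, hwy.symm, hwz.symm]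
  rw [Set.ncard_coe_finset, h2] at h1
  omega

lemma irrC_const {G : Type} [Group G] [Finite G] {χ : G → ℂ} (hχ : IrrC G χ)
    (h : ∀ g, χ g = χ 1) : χ = 1 := by
  have : Fintype G := Fintype.ofFinite G
  by_contra hne
  have h1 := ip_irr hχ irrC_one
  rw [if_neg hne] at h1
  obtain ⟨d, hd, hd'⟩ := hχ.one_pos
  have h2 : χ = fun _ => (d : ℂ) := by ext g; rw [h, hd']
  rw [h2] at h1
  simp [ip] at h1
  omega

lemma codeg_one {G : Type} [Group G] [Finite G] : codeg (1 : G → ℂ) = 1 := by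
  have : charKer (1 : G → ℂ) = Set.univ := by ext; simp [charKer]
  rw [codeg, this]
  have h3 : (Nat.card G : ℂ) ≠ 0 := by
    exact_mod_cast Nat.card_pos.ne'
  simp only [Nat.card_univ, Pi.one_apply, div_one]
  exact div_self h3

lemma exists_residual (G : Type) [Group G] [Finite G] (hG : ¬ IsSolvable G) :
    ∃ N : Subgroup G, N.Normal ∧ commutator N = ⊤ ∧ N ≠ ⊥ ∧
      (∀ K : Subgroup G, ∀ _ : K.Normal, IsSolvable (G ⧸ K) → N ≤ K) ∧
      (commutator G = ⊤ → N = ⊤) := by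
  obtain ⟨n, hn⟩ : ∃ n, ∀ m, Nat.card (derivedSeries G n) ≤ Nat.card (derivedSeries G m) := by
    have hex : ∃ k, ∃ n, Nat.card (derivedSeries G n) = k := ⟨_, 0, rfl⟩
    obtain ⟨n, hn⟩ := Nat.find_spec hex
    exact ⟨n, fun m => by rw [hn]; exact Nat.find_min' hex ⟨m, rfl⟩⟩
  have hle : ∀ m, derivedSeries G n ≤ derivedSeries G m := by
    intro m
    rcases le_total m n with h | h
    · exact derivedSeries_antitone G h
    · exact (Subgroup.eq_of_le_of_card_ge (derivedSeries_antitone G h) (hn m)).ge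
  refine ⟨derivedSeries G n, inferInstance, ?_, ?_, ?_, ?_⟩
  · apply Subgroup.map_injective (Subgroup.subtype_injective (derivedSeries G n))
    rw [Subgroup.map_subtype_commutator, ← MonoidHom.range_eq_map, Subgroup.range_subtype]
    exact le_antisymm (Subgroup.commutator_le_self _) (hle (n + 1))
  · intro h
    exact hG ⟨n, h⟩
  · intro K _ hs
    obtain ⟨m, hm⟩ := hs
    have h1 := map_derivedSeries_le_derivedSeries (QuotientGroup.mk' K) m
    rw [hm] at h1
    intro x hx
    have h2 := h1 ⟨x, hle m hx, rfl⟩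
    rw [Subgroup.mem_bot] at h2
    exact (QuotientGroup.eq_one_iff x).1 h2
  · intro h
    have : ∀ m, derivedSeries G m = ⊤ := by
      intro m
      induction m with
      | zero => rfl
      | succ m ih => rw [derivedSeries_succ, ih]; exact h
    exact this n

lemma solvable_aux : ∀ (n : ℕ) (G : Type) [Group G] [Finite G], Nat.card G = n →
    (codSet G).ncard ≤ 3 → IsSolvable G := by
  intro n
  induction n using Nat.strong_induction_on with
  | _ n ih =>
  intro G _ _ hcard h
  have hfG : Fintype G := Fintype.ofFinite G
  by_contra hG
  obtain ⟨N, hNn, hNp, hNb, hNle, hNtop⟩ := exists_residual G hG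
  have hmin : ∀ K : Subgroup G, K.Normal → K ≠ ⊥ → N ≤ K := by
    intro K hK hKb
    refine hNle K hK (ih _ ?_ (G ⧸ K) rfl
      ((Set.ncard_le_ncard (codSet_quot K) (codSet_finite G)).trans h))
    have h1 := Subgroup.card_eq_card_quotient_mul_card_subgroup K
    have h2 : 1 < Nat.card K := by rwa [Subgroup.one_lt_card_iff_ne_bot]
    have h3 : 0 < Nat.card (G ⧸ K) := Nat.card_pos
    rw [← hcard, h1]
    nlinarith
  have hG0 : (Nat.card G : ℂ) ≠ 0 := by exact_mod_cast Nat.card_pos.ne'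
  -- characters nontrivial on `N`
  have hcod : ∀ χ, IrrC G χ → (∃ x ∈ N, χ x ≠ χ 1) → codeg χ = (Nat.card G : ℂ) / χ 1 := by
    rintro χ ⟨V, _, _, _, ρ, hρ, rfl⟩ ⟨x, hx, hne⟩
    have hk : MonoidHom.ker (ρ : G →* _) = ⊥ := by
      by_contra hk
      exact hne ((rep_eq_one_iff ρ x).2 (hmin _ inferInstance hk hx))
    rw [codeg_char, hk, Subgroup.index_bot, char_one]
  have hmemS : ∀ χ, IrrC G χ → codeg χ ∈ codSet G := fun χ hχ => ⟨χ, (irrC_iff χ).1 hχ, rfl⟩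
  have h1S : (1 : ℂ) ∈ codSet G := by
    rw [← codeg_one (G := G)]; exact hmemS _ irrC_one
  have hdvd : ∀ χ, IrrC G χ → ∀ d : ℕ, χ 1 = d → d ∣ Nat.card G := by
    rintro χ ⟨V, _, _, _, ρ, hρ, rfl⟩ d hd
    rw [char_one] at hd
    have : Module.finrank ℂ V = d := by exact_mod_cast hd
    rw [← this]; exact degree_dvd ρ hρ
  have hdivinj : ∀ a b : ℂ, (Nat.card G : ℂ) / a = (Nat.card G : ℂ) / b → a = b :=
    fun a b h => by
      rw [div_eq_mul_inv, div_eq_mul_inv] at h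
      exact inv_injective (mul_left_cancel₀ hG0 h)
  have hcop : ∀ χ, IrrC G χ → (∃ x ∈ N, χ x ≠ χ 1) → ∀ d : ℕ, χ 1 = d →
      ¬ d.Coprime (Nat.card N) := by
    rintro χ ⟨V, _, _, _, ρ, hρ, rfl⟩ ⟨x, hx, hne⟩ d hd hco
    rw [char_one] at hd
    have : Module.finrank ℂ V = d := by exact_mod_cast hd
    rw [← this] at hco
    exact hne ((rep_eq_one_iff ρ x).2 (coprime_trivial ρ hρ N hNp hco x hx))
  have hN1 : Nat.card N ≠ 1 := by
    have : 1 < Nat.card N := by rwa [Subgroup.one_lt_card_iff_ne_bot]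
    omega
  obtain ⟨p0, hp0, hp0N⟩ := Nat.exists_prime_and_dvd hN1
  have : Fact p0.Prime := ⟨hp0⟩
  obtain ⟨χ₀, hχ₀, hχ₀N, hχ₀p⟩ := exists_irr_not_dvd p0 N hNp hp0N
  obtain ⟨m, hm0, hm⟩ := hχ₀.one_pos
  have hNG : Nat.card N ∣ Nat.card G := Subgroup.card_subgroup_dvd_card N
  by_cases hNT : N = ⊤
  · have hnt : ∀ χ, IrrC G χ → χ ≠ 1 → ∃ x ∈ N, χ x ≠ χ 1 := by
      intro χ hχ hne
      by_contra! hc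
      exact hne (irrC_const hχ fun g => hc g (by rw [hNT]; exact Subgroup.mem_top g))
    have hnt' : ∀ χ : G → ℂ, (∃ x ∈ N, χ x ≠ χ 1) → χ ≠ 1 := by
      rintro χ ⟨x, _, hx⟩ rfl
      exact hx rfl
    have hne1 : ∀ χ, IrrC G χ → χ ≠ 1 → codeg χ ≠ 1 := by
      intro χ hχ hne h1
      have hx := hnt χ hχ hne
      rw [hcod χ hχ hx, div_eq_one_iff_eq (by
        obtain ⟨d, hd, hd'⟩ := hχ.one_pos
        rw [hd']; exact_mod_cast hd.ne')] at h1
      obtain ⟨V, _, _, _, ρ, hρ, rfl⟩ := hχ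
      obtain ⟨x, _, hx⟩ := hx
      rw [char_one] at h1
      refine hx ((rep_eq_one_iff ρ x).2 (deg_ne_card ρ hρ ?_ x))
      exact_mod_cast h1.symm
    have hgt : ∀ χ, IrrC G χ → χ ≠ 1 → ∀ d : ℕ, χ 1 = d → 1 < d := by
      intro χ hχ hne d hd
      obtain ⟨e, he, he'⟩ := hχ.one_pos
      have hde : d = e := by rw [hd] at he'; exact_mod_cast he'
      have := hcop χ hχ (hnt χ hχ hne) d hd
      have : d ≠ 1 := by rintro rfl; exact this (Nat.coprime_one_left _)
      omega
    have hχ₀1 := hnt' χ₀ hχ₀N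
    obtain ⟨b, hb⟩ := three_elts (codSet_finite G) h h1S (hmemS χ₀ hχ₀) (hne1 χ₀ hχ₀ hχ₀1).symm
    have hcard : Nat.card N = Nat.card G := by rw [hNT]; exact Subgroup.card_top
    have hprime : ∀ q : ℕ, q.Prime → q ∣ m → ∃ χ, IrrC G χ ∧ χ ≠ 1 ∧ ∀ d : ℕ, χ 1 = d → ¬ q ∣ d := by
      intro q hq hqm
      have : Fact q.Prime := ⟨hq⟩
      obtain ⟨χ, h1, h2, h3⟩ := exists_irr_not_dvd q N hNp
        (by rw [hcard]; exact hqm.trans (hdvd χ₀ hχ₀ m hm))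
      exact ⟨χ, h1, hnt' χ h2, h3⟩
    have hm1 := hgt χ₀ hχ₀ hχ₀1 m hm
    obtain ⟨q, hq, hqm⟩ := Nat.exists_prime_and_dvd hm1.ne'
    obtain ⟨T, hT, hT1, hTq⟩ := hprime q hq hqm
    obtain ⟨t, ht0, ht⟩ := hT.one_pos
    have key : ∀ χ, IrrC G χ → χ ≠ 1 → codeg χ = codeg χ₀ → χ 1 = m := by
      intro χ hχ hne heq
      rw [hcod χ hχ (hnt χ hχ hne), hcod χ₀ hχ₀ hχ₀N] at heq
      rw [hdivinj _ _ heq, hm]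
    have hTb : codeg T = b := by
      rcases hb _ (hmemS T hT) with h | h | h
      · exact absurd h (hne1 T hT hT1)
      · exact absurd hqm (hTq m (key T hT hT1 h))
      · exact h
    have hdeg : ∀ χ, IrrC G χ → χ ≠ 1 → χ 1 = m ∨ χ 1 = t := by
      intro χ hχ hne
      rcases hb _ (hmemS χ hχ) with h | h | h
      · exact absurd h (hne1 χ hχ hne)
      · exact Or.inl (key χ hχ hne h)
      · right
        rw [← hTb, hcod χ hχ (hnt χ hχ hne), hcod T hT (hnt T hT hT1)] at h
        rw [hdivinj _ _ h, ht]
    have hmt : m.Coprime t := by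
      refine Nat.Coprime.symm (Nat.coprime_of_dvd fun r hr hrt hrm => ?_)
      obtain ⟨χ, h1, h2, h3⟩ := hprime r hr hrm
      rcases hdeg χ h1 h2 with h | h
      · exact h3 _ h hrm
      · exact h3 _ h hrt
    refine fusion (fun K hK => ?_) hm1 (hgt T hT hT1 t ht) hmt hdeg hχ₀ hT hm ht
    by_cases hKb : K = ⊥
    · exact Or.inl hKb
    · right
      rw [eq_top_iff, ← hNT]
      exact hmin K hK hKb
  · have hGc : commutator G ≠ ⊤ := fun hc => hNT (hNtop hc)
    obtain ⟨x, hx⟩ : ∃ x : G, x ∉ commutator G := by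
      by_contra! hc
      exact hGc (eq_top_iff.2 fun x _ => hc x)
    have hx' : Abelianization.of x ≠ 1 := fun h => hx ((QuotientGroup.eq_one_iff x).1 h)
    obtain ⟨φ, hφ⟩ := CommGroup.exists_apply_ne_one_of_hasEnoughRootsOfUnity
      (Abelianization G) ℂ hx'
    let l : G →* ℂˣ := φ.comp Abelianization.of
    have hlirr : IrrC G (fun g => ((Units.coeHom ℂ).comp l) g) := irrC_linear _
    set χl : G → ℂ := fun g => ((Units.coeHom ℂ).comp l) g with hχl
    have hker : charKer χl = (l.ker : Set G) := by
      ext g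
      simp [charKer, hχl, MonoidHom.mem_ker]
    have hNl : N ≤ l.ker := fun y hy => perfect_hom hNp (l.comp N.subtype) ⟨y, hy⟩
    have hNM : Nat.card N ∣ Nat.card l.ker := Subgroup.card_dvd_of_le hNl
    have hcl : codeg χl = (Nat.card G : ℂ) / (Nat.card l.ker : ℂ) := by
      have h1 : χl 1 = 1 := by simp [hχl]
      rw [codeg, h1, div_one, hker]
      rfl
    have hM0 : (Nat.card l.ker : ℂ) ≠ 0 := by exact_mod_cast Nat.card_pos.ne'
    have hcl1 : (1 : ℂ) ≠ codeg χl := by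
      intro h1
      rw [hcl, eq_comm, div_eq_one_iff_eq hM0] at h1
      have h2 : Nat.card G = Nat.card l.ker := by exact_mod_cast h1
      have h3 : l.ker = ⊤ := Subgroup.eq_top_of_card_eq _ h2.symm
      have h4 : x ∈ l.ker := by rw [h3]; exact Subgroup.mem_top x
      exact hφ h4
    obtain ⟨b, hb⟩ := three_elts (codSet_finite G) h h1S (hmemS χl hlirr) hcl1
    have key : ∀ q : ℕ, q.Prime → q ∣ Nat.card N → ∃ χ, IrrC G χ ∧ (∃ x ∈ N, χ x ≠ χ 1) ∧
        (∀ d : ℕ, χ 1 = d → ¬ q ∣ d) ∧ (Nat.card G : ℂ) / χ 1 = b := by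
      intro q hq hqN
      have : Fact q.Prime := ⟨hq⟩
      obtain ⟨χ, h1, h2, h3⟩ := exists_irr_not_dvd q N hNp hqN
      refine ⟨χ, h1, h2, h3, ?_⟩
      rw [← hcod χ h1 h2]
      rcases hb _ (hmemS χ h1) with h | h | h
      · exfalso
        rw [hcod χ h1 h2] at h
        have h4 : χ 1 = (Nat.card G : ℕ) := by
          apply hdivinj
          rw [h, div_self hG0]
        exact h3 _ h4 (hqN.trans hNG)
      · exfalso
        rw [hcod χ h1 h2, hcl] at h
        exact h3 _ (hdivinj _ _ h) (hqN.trans hNM)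
      · exact h
    obtain ⟨χ, h1, h2, h3, h4⟩ := key p0 hp0 hp0N
    obtain ⟨d, hd0, hd⟩ := h1.one_pos
    refine hcop χ h1 h2 d hd (Nat.Coprime.symm (Nat.coprime_of_dvd fun r hr hrN hrd => ?_))
    obtain ⟨ψ, k1, k2, k3, k4⟩ := key r hr hrN
    rw [← h4] at k4
    exact k3 d ((hdivinj _ _ k4).trans hd) hrd

/-- If a finite group `G` has at most three codegrees, then `G` is solvable. -/
theorem solvable_of_card_codSet_le_three (G : Type) [Group G] [Finite G]
    (h : (codSet G).ncard ≤ 3) : IsSolvable G := by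
  exact solvable_aux _ G rfl h
end

section
/- Let G be a finite group. If the set of codegrees of the irreducible complex characters of G has exactly two elements, i.e. |cod(G)| = 2, then G is a nontrivial abelian group, and in particular G is an M-group. -/
open scoped Classical

namespace CodAux

open Module

section
variable {G : Type} [Group G]

lemma pow_card_eq_one {V : Type} [AddCommGroup V] [Module ℂ V]
    (ρ : Representation ℂ G V) (g : G) : (ρ g) ^ Nat.card G = 1 := by
  rw [← map_pow, pow_card_eq_one', map_one]

lemma root_pow [Finite G] {V : Type} [AddCommGroup V] [Module ℂ V] [FiniteDimensional ℂ V]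
    (ρ : Representation ℂ G V) (g : G) (μ : ℂ) (hμ : μ ∈ (ρ g).charpoly.roots) :
    μ ^ Nat.card G = 1 := by
  have h1 : Module.End.HasEigenvalue (ρ g) μ := by
    rw [Module.End.hasEigenvalue_iff_isRoot_charpoly]
    exact Polynomial.isRoot_of_mem_roots hμ
  obtain ⟨v, hv⟩ := h1.exists_hasEigenvector
  have h2 := hv.pow_apply (Nat.card G)
  rw [pow_card_eq_one] at h2
  have h3 : (μ ^ Nat.card G - 1) • v = 0 := by
    rw [sub_smul, ← h2]; simp
  rcases smul_eq_zero.1 h3 with h | h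
  · exact sub_eq_zero.1 h
  · exact absurd h hv.2

lemma isIntegral_char [Finite G] (V : FDRep ℂ G) (g : G) : IsIntegral ℤ (V.character g) := by
  have : V.character g = (V.ρ g).charpoly.roots.sum :=
    Module.End.trace_eq_sum_roots_charpoly_of_splits (IsAlgClosed.splits _)
  rw [this]
  apply IsIntegral.multiset_sum
  intro μ hμ
  apply IsIntegral.of_pow (n := Nat.card G) Nat.card_pos
  rw [root_pow V.ρ g μ hμ]
  exact isIntegral_one

lemma multiset_all_one (s : Multiset ℂ) (h : ∀ μ ∈ s, ‖μ‖ = 1) :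
    s.sum.re ≤ s.card ∧ (s.sum.re = s.card → ∀ μ ∈ s, μ = 1) := by
  induction s using Multiset.induction with
  | empty => simp
  | cons a s ih =>
    obtain ⟨h1, h2⟩ := ih (fun μ hμ => h μ (Multiset.mem_cons_of_mem hμ))
    have ha : ‖a‖ = 1 := h a (Multiset.mem_cons_self a s)
    have hre : a.re ≤ 1 := ha ▸ Complex.re_le_norm a
    simp only [Multiset.sum_cons, Complex.add_re, Multiset.card_cons, Nat.cast_add, Nat.cast_one]
    refine ⟨by linarith, fun he μ hμ => ?_⟩
    rcases Multiset.mem_cons.1 hμ with rfl | hμ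
    · have h3 : μ.re = 1 := by linarith
      have h4 : ‖μ‖ ^ 2 = μ.re * μ.re + μ.im * μ.im := by
        rw [Complex.sq_norm, Complex.normSq_apply]
      rw [ha, h3] at h4
      have h5 : μ.im = 0 := by nlinarith
      exact Complex.ext h3 h5
    · exact h2 (by linarith) μ hμ

lemma mem_charKer_iff [Finite G] (V : FDRep ℂ G) (g : G) :
    g ∈ charKer V.character ↔ V.ρ g = 1 := by
  constructor
  · intro h
    have h : V.character g = V.character 1 := h
    have ht : V.character g = (V.ρ g).charpoly.roots.sum :=
      Module.End.trace_eq_sum_roots_charpoly_of_splits (IsAlgClosed.splits _)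
    have hsp : (V.ρ g).charpoly.Splits := IsAlgClosed.splits _
    have hc : (V.ρ g).charpoly.roots.card = finrank ℂ V := by
      rw [← LinearMap.charpoly_natDegree (V.ρ g)]
      exact hsp.natDegree_eq_card_roots.symm
    have hn : ∀ μ ∈ (V.ρ g).charpoly.roots, ‖μ‖ = 1 := fun μ hμ =>
      Complex.norm_eq_one_of_pow_eq_one (root_pow V.ρ g μ hμ) Nat.card_pos.ne'
    have hall := (multiset_all_one _ hn).2 (by rw [← ht, h, FDRep.char_one, hc]; simp)
    have hrep : (V.ρ g).charpoly.roots = Multiset.replicate (finrank ℂ V) 1 :=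
      Multiset.eq_replicate.2 ⟨hc, hall⟩
    have hcp : (V.ρ g).charpoly = (Polynomial.X - Polynomial.C 1) ^ (finrank ℂ V) := by
      rw [hsp.eq_prod_roots_of_monic (LinearMap.charpoly_monic _), hrep]
      simp
    have hd1 : minpoly ℂ (V.ρ g) ∣ (Polynomial.X - Polynomial.C 1) ^ (finrank ℂ V) :=
      hcp ▸ LinearMap.minpoly_dvd_charpoly _
    have hd2 : minpoly ℂ (V.ρ g) ∣ Polynomial.X ^ (Nat.card G) - 1 := by
      apply minpoly.dvd
      simp [pow_card_eq_one]
    have hsq : Squarefree (minpoly ℂ (V.ρ g)) := by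
      apply Squarefree.squarefree_of_dvd hd2
      apply Polynomial.Separable.squarefree
      have := Polynomial.separable_X_pow_sub_C (1 : ℂ) (n := Nat.card G)
        (by exact_mod_cast Nat.card_pos.ne') one_ne_zero
      simpa using this
    have hd3 : minpoly ℂ (V.ρ g) ∣ (Polynomial.X - Polynomial.C 1) := by
      by_cases h0 : finrank ℂ V = 0
      · rw [h0, pow_zero] at hd1
        exact hd1.trans (one_dvd _)
      · exact (hsq.dvd_pow_iff_dvd h0).1 hd1
    have := (minpoly.dvd_iff).1 hd3
    simpa [sub_eq_zero] using this
  · intro h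
    show V.character g = V.character 1
    simp [FDRep.character, h]

end

section
variable {G : Type} [Group G] [Fintype G]

/-- bilinear pairing of functions -/
noncomputable def pair (χ ψ : G → ℂ) : ℂ := (Nat.card G : ℂ)⁻¹ * ∑ g : G, χ g * ψ g⁻¹

lemma pair_add (a b c : G → ℂ) : pair (a + b) c = pair a c + pair b c := by
  simp [pair, add_mul, Finset.sum_add_distrib, mul_add]

lemma pair_zero (c : G → ℂ) : pair 0 c = 0 := by simp [pair]

lemma isIrr_iff (V : FDRep ℂ G) :
    CategoryTheory.Simple V ↔ pair V.character V.character = 1 := by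
  rw [FDRep.simple_iff_char_is_norm_one, pair]
  have : (Nat.card G : ℂ) ≠ 0 := by exact_mod_cast Nat.card_pos.ne'
  rw [inv_mul_eq_one₀ this, eq_comm]

lemma pair_irr {χ ψ : G → ℂ} (hχ : IsIrrChar G χ) (hψ : IsIrrChar G ψ) :
    pair χ ψ = if χ = ψ then 1 else 0 := by
  split_ifs with h
  · subst h
    obtain ⟨V, hV, rfl⟩ := hχ
    exact (isIrr_iff V).1 hV
  · obtain ⟨V, hV, rfl⟩ := hχ
    obtain ⟨W, hW, rfl⟩ := hψ
    have := invertibleOfNonzero (NeZero.ne (Nat.card G : ℂ))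
    have h2 := FDRep.char_orthonormal V W
    rw [if_neg] at h2
    · exact h2
    · rintro ⟨i⟩
      exact h (FDRep.char_iso i)

lemma pair_multiset (M : Multiset (G → ℂ)) (hM : ∀ χ ∈ M, IsIrrChar G χ) {ψ : G → ℂ}
    (hψ : IsIrrChar G ψ) : pair M.sum ψ = M.count ψ := by
  induction M using Multiset.induction with
  | empty => simp [pair_zero]
  | cons a M ih =>
    rw [Multiset.sum_cons, pair_add, ih (fun χ hχ => hM χ (Multiset.mem_cons_of_mem hχ)),
      pair_irr (hM a (Multiset.mem_cons_self a M)) hψ, Multiset.count_cons]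
    simp only [eq_comm (a := ψ)]
    split_ifs <;> simp [add_comm]

lemma isIrrChar_of_irreducible {V : Type} [AddCommGroup V] [Module ℂ V] [FiniteDimensional ℂ V]
    (ρ : Representation ℂ G V) (h : ρ.IsIrreducible) : IsIrrChar G ρ.character := by
  refine ⟨FDRep.of ρ, ?_, rfl⟩
  rw [isIrr_iff]
  have := invertibleOfNonzero (NeZero.ne (Nat.card G : ℂ))
  have h2 := Representation.char_orthonormal ρ ρ
  rw [if_pos ⟨Representation.Equiv.refl ρ⟩] at h2
  exact_mod_cast h2

lemma exists_decomp (n : ℕ) : ∀ {V : Type} [AddCommGroup V] [Module ℂ V] [FiniteDimensional ℂ V]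
    (ρ : Representation ℂ G V), finrank ℂ V = n →
    ∃ M : Multiset (G → ℂ), (∀ χ ∈ M, IsIrrChar G χ) ∧ M.sum = ρ.character := by
  induction n using Nat.strong_induction_on with
  | _ n ih =>
    intro V _ _ _ ρ hn
    by_cases hirr : ρ.IsIrreducible
    · exact ⟨{ρ.character}, by simpa using isIrrChar_of_irreducible ρ hirr, by simp⟩
    by_cases h0 : n = 0
    · subst h0
      refine ⟨0, by simp, ?_⟩
      ext g
      have : Subsingleton V := finrank_zero_iff.1 hn
      have h1 : ρ g = 0 := Subsingleton.elim _ _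
      simp [Representation.character, h1]
    have hex : ∃ σ : Subrepresentation ρ, σ ≠ ⊥ ∧ σ ≠ ⊤ := by
      by_contra hcon
      push Not at hcon
      apply hirr
      have hnt : Nontrivial (Subrepresentation ρ) := by
        refine ⟨⊥, ⊤, fun he => h0 ?_⟩
        have he2 : (⊥ : Submodule ℂ V) = ⊤ := congrArg Subrepresentation.toSubmodule he
        rw [← hn, ← finrank_top ℂ V, ← he2, finrank_bot]
      exact { eq_bot_or_eq_top := fun a => or_iff_not_imp_left.2 (hcon a) }
    obtain ⟨σ, hb, ht⟩ := hex
    have : NeZero (Nat.card G : ℂ) := inferInstance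
    obtain ⟨τ, hc⟩ := exists_isCompl σ
    have hc' : IsCompl σ.toSubmodule τ.toSubmodule := by
      refine IsCompl.of_eq ?_ ?_
      · rw [← Subrepresentation.toSubmodule_inf, hc.inf_eq_bot]; rfl
      · rw [← Subrepresentation.toSubmodule_sup, hc.sup_eq_top]; rfl
    have hsum := Submodule.finrank_add_eq_of_isCompl hc'
    have hσ : 0 < finrank ℂ σ.toSubmodule := by
      rw [Nat.pos_iff_ne_zero, Ne, Submodule.finrank_eq_zero]
      exact fun h => hb (Subrepresentation.toSubmodule_injective h)
    have hτ : 0 < finrank ℂ τ.toSubmodule := by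
      rw [Nat.pos_iff_ne_zero, Ne, Submodule.finrank_eq_zero]
      intro h
      rw [h] at hc'
      exact ht (Subrepresentation.toSubmodule_injective (eq_top_of_isCompl_bot hc'))
    obtain ⟨M, hM, hM'⟩ := ih _ (by omega) σ.toRepresentation rfl
    obtain ⟨N, hN, hN'⟩ := ih _ (by omega) τ.toRepresentation rfl
    refine ⟨M + N, ?_, ?_⟩
    · intro χ hχ
      rcases Multiset.mem_add.1 hχ with h | h
      exacts [hM _ h, hN _ h]
    · rw [Multiset.sum_add, hM', hN']
      ext g
      have hintg : DirectSum.IsInternal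
          (fun b : Bool => cond b σ.toSubmodule τ.toSubmodule) := by
        rw [DirectSum.isInternal_submodule_iff_isCompl _ (i := true) (j := false) (by simp)
          (by ext b; cases b <;> simp)]
        exact hc'
      have hmt : ∀ b : Bool, Set.MapsTo (ρ g) (cond b σ.toSubmodule τ.toSubmodule : Submodule ℂ V)
          (cond b σ.toSubmodule τ.toSubmodule : Submodule ℂ V) := by
        intro b; cases b
        · exact fun v hv => τ.apply_mem_toSubmodule g hv
        · exact fun v hv => σ.apply_mem_toSubmodule g hv
      have htr := LinearMap.trace_eq_sum_trace_restrict hintg hmt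
      rw [Fintype.sum_bool] at htr
      exact htr.symm

/-- regular character -/
lemma regular_char (g : G) :
    (TannakaDuality.FiniteGroup.leftRegular : Representation ℂ G (G → ℂ)).character g =
      if g = 1 then (Nat.card G : ℂ) else 0 := by
  rw [Representation.character, LinearMap.trace_eq_matrix_trace ℂ (Pi.basisFun ℂ G), Matrix.trace]
  simp only [Matrix.diag, LinearMap.toMatrix_apply, Pi.basisFun_repr, Pi.basisFun_apply,
    TannakaDuality.FiniteGroup.leftRegular_apply]
  split_ifs with h
  · subst h; simp [Nat.card_eq_fintype_card]
  · apply Finset.sum_eq_zero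
    intro x _
    rw [Pi.single_eq_of_ne]
    intro h2
    apply h
    simpa using h2

/-- Irr(G) finite with regular decomposition. -/
lemma exists_irr (G : Type) [Group G] [Fintype G] : ∃ T : Finset (G → ℂ),
    (∀ χ, χ ∈ T ↔ IsIrrChar G χ) ∧
    ∀ g, ∑ χ ∈ T, χ 1 * χ g = if g = 1 then (Nat.card G : ℂ) else 0 := by
  obtain ⟨M, hM, hs⟩ := exists_decomp _
    (TannakaDuality.FiniteGroup.leftRegular : Representation ℂ G (G → ℂ)) rfl
  have hcount : ∀ χ, IsIrrChar G χ → (M.count χ : ℂ) = χ 1 := by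
    intro χ hχ
    rw [← pair_multiset M hM hχ, hs, pair]
    simp only [regular_char]
    have : (Nat.card G : ℂ) ≠ 0 := by exact_mod_cast Nat.card_pos.ne'
    simp
  refine ⟨M.toFinset, fun χ => ⟨fun h => hM χ (Multiset.mem_toFinset.1 h), fun h => ?_⟩, ?_⟩
  · rw [Multiset.mem_toFinset, ← Multiset.count_ne_zero]
    intro h0
    have h1 := hcount χ h
    rw [h0] at h1
    obtain ⟨V, hV, rfl⟩ := h
    rw [FDRep.char_one] at h1
    have h1 : finrank ℂ V = 0 := by exact_mod_cast h1.symm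
    have h2 := (isIrr_iff V).1 hV
    have : Subsingleton V := finrank_zero_iff.1 h1
    have h3 : V.character = 0 := by
      ext g
      have h1 : V.ρ g = 0 := Subsingleton.elim _ _
      simp [FDRep.character, h1]
    rw [h3, pair_zero] at h2
    exact zero_ne_one h2
  · intro g
    rw [← regular_char, ← hs, Finset.sum_multiset_count, Finset.sum_apply]
    apply Finset.sum_congr rfl
    intro χ hχ
    rw [← hcount χ (hM χ (Multiset.mem_toFinset.1 hχ))]
    simp

end

section
variable {G Q : Type} [Group G] [Fintype G] [Group Q] [Fintype Q]

lemma sum_comp_hom (f : G →* Q) (hf : Function.Surjective f) :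
    ∃ k : ℂ, k ≠ 0 ∧ ∀ F : Q → ℂ, ∑ g, F (f g) = k * ∑ q, F q := by
  have key : ∀ F : Q → ℂ, ∑ g, F (f g) = (Nat.card f.ker : ℂ) * ∑ q, F q := by
    intro F
    rw [← Finset.sum_fiberwise Finset.univ f, Finset.mul_sum]
    apply Finset.sum_congr rfl
    intro q _
    have h1 : ∀ g ∈ Finset.univ.filter (fun g => f g = q), F (f g) = F q := by
      intro g hg
      rw [(Finset.mem_filter.1 hg).2]
    rw [Finset.sum_congr rfl h1, Finset.sum_const, nsmul_eq_mul]
    congr 2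
    rw [MonoidHom.card_fiber_eq_of_mem_range f (hf q) (hf 1), Nat.card_eq_fintype_card,
      Fintype.card_subtype]
    congr 1
    ext g
    simp [MonoidHom.mem_ker]
  exact ⟨_, by exact_mod_cast Nat.card_pos.ne', key⟩

lemma pair_comp (f : G →* Q) (hf : Function.Surjective f) (χ ψ : Q → ℂ) :
    pair (χ ∘ f) (ψ ∘ f) = pair χ ψ := by
  obtain ⟨k, hk, hF⟩ := sum_comp_hom f hf
  have h1 := hF (fun _ => 1)
  have h2 := hF (fun q => χ q * ψ q⁻¹)
  simp only [Finset.sum_const, Finset.card_univ, nsmul_eq_mul, mul_one] at h1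
  have hQ : (Fintype.card Q : ℂ) ≠ 0 := by exact_mod_cast Fintype.card_ne_zero
  simp only [pair, Function.comp_apply, map_inv, h2, Nat.card_eq_fintype_card, h1]
  field_simp

lemma codeg_comp (f : G →* Q) (hf : Function.Surjective f) (χ : Q → ℂ) :
    codeg (χ ∘ f) = codeg χ := by
  obtain ⟨k, hk, hF⟩ := sum_comp_hom f hf
  have h1 := hF (fun _ => 1)
  have h2 := hF (fun q => if q ∈ charKer χ then 1 else 0)
  simp only [Finset.sum_const, Finset.card_univ, nsmul_eq_mul, mul_one] at h1
  have h3 : (Nat.card (charKer (χ ∘ f)) : ℂ) = k * Nat.card (charKer χ) := by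
    rw [Finset.sum_boole, Finset.sum_boole] at h2
    rw [Nat.card_eq_fintype_card, Nat.card_eq_fintype_card, Fintype.card_subtype,
      Fintype.card_subtype, ← h2]
    congr 2
    ext g
    rw [Finset.mem_filter, Finset.mem_filter]
    simp [charKer]
  rw [codeg, codeg, h3, Nat.card_eq_fintype_card, Nat.card_eq_fintype_card, h1,
    mul_div_mul_left _ _ hk]
  simp

lemma irr_comp (f : G →* Q) (hf : Function.Surjective f) {χ : Q → ℂ} (hχ : IsIrrChar Q χ) :
    IsIrrChar G (χ ∘ f) := by
  obtain ⟨V, hV, rfl⟩ := hχ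
  have h : (FDRep.of (V.ρ.comp f : Representation ℂ G V)).character = V.character ∘ f := rfl
  refine ⟨_, ?_, h.symm⟩
  rw [isIrr_iff, h, pair_comp f hf]
  exact (isIrr_iff V).1 hV

lemma irr_degree {χ : G → ℂ} (hχ : IsIrrChar G χ) : ∃ d : ℕ, 0 < d ∧ χ 1 = d := by
  obtain ⟨V, hV, rfl⟩ := hχ
  refine ⟨_, Nat.pos_of_ne_zero fun h1 => ?_, FDRep.char_one V⟩
  have h2 := (isIrr_iff V).1 hV
  have : Subsingleton V := finrank_zero_iff.1 h1
  have h3 : V.character = 0 := by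
    ext g
    have h1 : V.ρ g = 0 := Subsingleton.elim _ _
    simp [FDRep.character, h1]
  rw [h3, pair_zero] at h2
  exact zero_ne_one h2

lemma irr_one (G : Type) [Group G] [Fintype G] : IsIrrChar G 1 := by
  have h : (FDRep.of (1 : Representation ℂ G ℂ)).character = 1 := by
    ext g
    show LinearMap.trace ℂ ℂ 1 = 1
    simp
  refine ⟨_, ?_, h.symm⟩
  rw [isIrr_iff, h]
  simp [pair]

lemma eq_one_of_const {χ : G → ℂ} (hχ : IsIrrChar G χ) (h : ∀ g, χ g = χ 1) : χ = 1 := by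
  obtain ⟨d, hd, h1⟩ := irr_degree hχ
  have h2 := pair_irr hχ hχ
  rw [if_pos rfl, pair] at h2
  simp_rw [fun g => (h g).trans h1] at h2
  have h3 : (d : ℂ) * d = 1 := by simpa using h2
  have h4 : d * d = 1 := by exact_mod_cast h3
  have h5 : d = 1 := by
    have := Nat.eq_one_of_mul_eq_one_right h4
    exact this
  ext g
  rw [h g, h1, h5]; simp

lemma deflate {χ : G → ℂ} (hχ : IsIrrChar G χ) : ∃ (N : Subgroup G) (_ : N.Normal),
    (N : Set G) = charKer χ ∧ ∃ ψ : G ⧸ N → ℂ, IsIrrChar (G ⧸ N) ψ ∧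
      χ = ψ ∘ QuotientGroup.mk' N ∧ charKer ψ = {1} := by
  obtain ⟨V, hV, rfl⟩ := hχ
  have hK : (V.ρ.ker : Set G) = charKer V.character := by
    ext g
    rw [mem_charKer_iff]; rfl
  let ρ' : Representation ℂ (G ⧸ V.ρ.ker) V := QuotientGroup.lift V.ρ.ker V.ρ (fun g hg => hg)
  have hcomp : V.character = (FDRep.of ρ').character ∘ QuotientGroup.mk' V.ρ.ker := rfl
  refine ⟨V.ρ.ker, inferInstance, hK, (FDRep.of ρ').character, ⟨_, ?_, rfl⟩, hcomp, ?_⟩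
  · rw [isIrr_iff, ← pair_comp (QuotientGroup.mk' V.ρ.ker) (QuotientGroup.mk'_surjective _),
      ← hcomp]
    exact (isIrr_iff V).1 hV
  · ext q
    obtain ⟨g, rfl⟩ := QuotientGroup.mk'_surjective _ q
    rw [mem_charKer_iff, Set.mem_singleton_iff]
    have : QuotientGroup.mk' V.ρ.ker g = 1 ↔ g ∈ V.ρ.ker := by
      rw [QuotientGroup.mk'_apply, QuotientGroup.eq_one_iff]
    rw [this]; rfl

lemma degree_sq_lt {χ : G → ℂ} (hχ : IsIrrChar G χ) (h1 : χ ≠ 1) {d : ℕ} (hd : χ 1 = d) :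
    1 + d * d ≤ Nat.card G := by
  obtain ⟨T, hT, hs⟩ := exists_irr G
  have h2 := hs 1
  rw [if_pos rfl] at h2
  have hdeg : ∀ ψ ∈ T, ∃ n : ℕ, ψ 1 = n := fun ψ hψ => by
    obtain ⟨n, -, h⟩ := irr_degree ((hT ψ).1 hψ)
    exact ⟨n, h⟩
  choose! n hn using hdeg
  have h3 : ∑ ψ ∈ T, n ψ * n ψ = Nat.card G := by
    have : ∑ ψ ∈ T, (n ψ : ℂ) * n ψ = Nat.card G := by
      rw [← h2]
      exact Finset.sum_congr rfl fun ψ hψ => by rw [hn ψ hψ]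
    exact_mod_cast this
  have hsub : ({1, χ} : Finset (G → ℂ)) ⊆ T := by
    intro ψ hψ
    rcases Finset.mem_insert.1 hψ with rfl | hψ
    · exact (hT _).2 (irr_one G)
    · rw [Finset.mem_singleton.1 hψ]; exact (hT _).2 hχ
  have h4 := Finset.sum_le_sum_of_subset (f := fun ψ => n ψ * n ψ) hsub
  rw [Finset.sum_pair h1.symm, h3] at h4
  have h5 : n 1 = 1 := by
    have := hn 1 ((hT _).2 (irr_one G))
    rw [Pi.one_apply] at this
    exact_mod_cast this.symm
  have h6 : n χ = d := by
    have := hn χ ((hT _).2 hχ)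
    rw [hd] at this
    exact_mod_cast this.symm
  rw [h5, h6] at h4
  omega

lemma exists_nontrivial_irr (G : Type) [Group G] [Fintype G] [Nontrivial G] :
    ∃ χ : G → ℂ, IsIrrChar G χ ∧ χ ≠ 1 := by
  obtain ⟨T, hT, hs⟩ := exists_irr G
  by_contra hcon
  push Not at hcon
  obtain ⟨g, hg⟩ := exists_ne (1 : G)
  have hT1 : T = {1} := by
    ext χ
    rw [hT, Finset.mem_singleton]
    exact ⟨hcon χ, fun h => h ▸ irr_one G⟩
  have := hs g
  rw [if_neg hg, hT1] at this
  simp at this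

lemma linear_of_degree_one {χ : G → ℂ} (hχ : IsIrrChar G χ) (h1 : χ 1 = 1) :
    ∃ lam : G →* ℂ, χ = lam := by
  obtain ⟨V, hV, rfl⟩ := hχ
  have hfr : finrank ℂ V = 1 := by
    rw [FDRep.char_one] at h1
    exact_mod_cast h1
  have key : ∀ g, V.ρ g = V.character g • (1 : V →ₗ[ℂ] V) := by
    intro g
    obtain ⟨v, hv0, hv⟩ := finrank_eq_one_iff'.1 hfr
    obtain ⟨c, hc⟩ := hv (V.ρ g v)
    have h2 : V.ρ g = c • (1 : V →ₗ[ℂ] V) := by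
      ext w
      obtain ⟨a, rfl⟩ := hv w
      simp [← hc, smul_comm a c v]
    have h3 : V.character g = c := by
      show LinearMap.trace ℂ V (V.ρ g) = c
      rw [h2, map_smul, LinearMap.trace_one, hfr]
      simp
    rw [h3, h2]
  refine ⟨{ toFun := V.character, map_one' := h1, map_mul' := fun a b => ?_ }, rfl⟩
  show LinearMap.trace ℂ V (V.ρ (a * b)) = _
  rw [map_mul, key a, key b, smul_mul_smul_comm, one_mul, map_smul, LinearMap.trace_one, hfr]
  simp

lemma comm_of_linear (h : ∀ χ : G → ℂ, IsIrrChar G χ → χ 1 = 1) (a b : G) : a * b = b * a := by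
  obtain ⟨T, hT, hs⟩ := exists_irr G
  have h1 := hs 1
  have h2 := hs (a * b * a⁻¹ * b⁻¹)
  have h3 : ∑ χ ∈ T, χ 1 * χ (a * b * a⁻¹ * b⁻¹) = ∑ χ ∈ T, χ 1 * χ 1 := by
    apply Finset.sum_congr rfl
    intro χ hχ
    obtain ⟨lam, rfl⟩ := linear_of_degree_one ((hT χ).1 hχ) (h χ ((hT χ).1 hχ))
    congr 1
    have ha : lam a * lam a⁻¹ = 1 := by rw [← map_mul]; simp
    have hb : lam b * lam b⁻¹ = 1 := by rw [← map_mul]; simp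
    simp only [map_mul, map_one]
    calc lam a * lam b * lam a⁻¹ * lam b⁻¹
        = (lam a * lam a⁻¹) * (lam b * lam b⁻¹) := by ring
      _ = 1 := by rw [ha, hb, one_mul]
  rw [h3, h1, if_pos rfl] at h2
  by_cases hg : a * b * a⁻¹ * b⁻¹ = 1
  · rw [mul_inv_eq_one, mul_inv_eq_iff_eq_mul] at hg
    exact hg
  · rw [if_neg hg] at h2
    exact absurd h2 (by exact_mod_cast Nat.card_pos.ne')

/-- All nontrivial irreducible characters have codegree `c`. -/
def Good (G : Type) [Group G] (c : ℂ) : Prop :=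
  ∀ χ : G → ℂ, IsIrrChar G χ → χ ≠ 1 → codeg χ = c

lemma Good.quot {c : ℂ} (h : Good G c) (f : G →* Q) (hf : Function.Surjective f) : Good Q c := by
  intro χ hχ h1
  rw [← codeg_comp f hf]
  refine h _ (irr_comp f hf hχ) fun h2 => h1 ?_
  ext q
  obtain ⟨g, rfl⟩ := hf q
  exact congrFun h2 g

lemma eq_one_of_integral {d : ℕ} {z : ℂ} (hz : IsIntegral ℤ z) (h : 1 + d * z = 0) : d = 1 := by
  have hd : (d : ℂ) ≠ 0 := by
    intro h0
    rw [h0] at h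
    simp at h
  have hz2 : z = algebraMap ℚ ℂ (-1 / d) := by
    have : z = -1 / d := by field_simp; linear_combination h
    rw [this]; simp
  rw [hz2, isIntegral_algebraMap_iff (algebraMap ℚ ℂ).injective,
    IsIntegrallyClosed.isIntegral_iff] at hz
  obtain ⟨m, hm⟩ := hz
  have hdq : (d : ℚ) ≠ 0 := by exact_mod_cast hd
  have h3 : (m : ℚ) * d = -1 := by
    have hm' : (m : ℚ) = -1 / d := hm
    rw [hm']; field_simp
  have h4 : (d : ℤ) * (-m) = 1 := by
    have : m * (d : ℤ) = -1 := by exact_mod_cast h3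
    linarith
  have h5 := Int.isUnit_iff.1 (IsUnit.of_mul_eq_one _ h4)
  omega

lemma simple_step [Nontrivial G] {c : ℂ} (h : Good G c)
    (hk : ∀ χ : G → ℂ, IsIrrChar G χ → χ ≠ 1 → charKer χ = {1}) :
    (∀ χ : G → ℂ, IsIrrChar G χ → χ 1 = 1) ∧ c = Nat.card G := by
  obtain ⟨χ₀, h₀, h₀1⟩ := exists_nontrivial_irr G
  obtain ⟨d, hd, hd1⟩ := irr_degree h₀
  have hG : (Nat.card G : ℂ) ≠ 0 := by exact_mod_cast Nat.card_pos.ne'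
  have hcod : ∀ χ : G → ℂ, IsIrrChar G χ → χ ≠ 1 → (Nat.card G : ℂ) / χ 1 = c := by
    intro χ hχ h1
    have := h χ hχ h1
    rw [codeg, hk χ hχ h1] at this
    simpa using this
  have hdeg : ∀ χ : G → ℂ, IsIrrChar G χ → χ ≠ 1 → χ 1 = d := by
    intro χ hχ h1
    have h2 := (hcod χ hχ h1).trans (hcod χ₀ h₀ h₀1).symm
    rw [hd1] at h2
    rw [div_eq_mul_inv, div_eq_mul_inv] at h2
    exact inv_injective (mul_left_cancel₀ hG h2)
  obtain ⟨T, hT, hs⟩ := exists_irr G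
  obtain ⟨g, hg⟩ := exists_ne (1 : G)
  have h2 := hs g
  rw [if_neg hg, ← Finset.add_sum_erase T _ ((hT 1).2 (irr_one G))] at h2
  have h3 : ∑ χ ∈ T.erase 1, χ 1 * χ g = d * ∑ χ ∈ T.erase 1, χ g := by
    rw [Finset.mul_sum]
    apply Finset.sum_congr rfl
    intro χ hχ
    rw [Finset.mem_erase] at hχ
    rw [hdeg χ ((hT χ).1 hχ.2) hχ.1]
  rw [h3] at h2
  have hintg : IsIntegral ℤ (∑ χ ∈ T.erase 1, χ g) := by
    apply IsIntegral.sum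
    intro χ hχ
    obtain ⟨V, -, rfl⟩ := (hT χ).1 (Finset.mem_of_mem_erase hχ)
    exact isIntegral_char V g
  have hd' : d = 1 := eq_one_of_integral hintg (by simpa using h2)
  subst hd'
  constructor
  · intro χ hχ
    by_cases h1 : χ = 1
    · rw [h1]; rfl
    · simpa using hdeg χ hχ h1
  · rw [← hcod χ₀ h₀ h₀1, hd1]; simp

lemma exists_prime [Nontrivial G] {c : ℂ} (h : Good G c) : ∃ p : ℕ, p.Prime ∧ c = p := by
  obtain ⟨N, hN⟩ := (Set.toFinite {N : Subgroup G | N.Normal ∧ N ≠ ⊤}).exists_maximal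
    ⟨⊥, inferInstance, bot_ne_top⟩
  have hNn : N.Normal := hN.prop.1
  have hNt : N ≠ ⊤ := hN.prop.2
  have hmax : ∀ M : Subgroup G, M.Normal → M ≠ ⊤ → N ≤ M → M = N := fun M h1 h2 h3 =>
    le_antisymm (hN.le_of_ge ⟨h1, h2⟩ h3) h3
  have : Nontrivial (G ⧸ N) := by
    rw [QuotientGroup.nontrivial_iff]
    exact hNt
  have hsimp : ∀ M : Subgroup (G ⧸ N), M.Normal → M = ⊥ ∨ M = ⊤ := by
    intro M hM
    rw [or_iff_not_imp_right]
    intro hMt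
    have h1 := hmax (M.comap (QuotientGroup.mk' N)) inferInstance (fun h2 => hMt (by
        rw [← Subgroup.map_comap_eq_self_of_surjective (QuotientGroup.mk'_surjective N) M, h2]
        exact Subgroup.map_top_of_surjective _ (QuotientGroup.mk'_surjective N)))
      (fun x hx => by
        rw [Subgroup.mem_comap, QuotientGroup.mk'_apply, (QuotientGroup.eq_one_iff x).2 hx]
        exact M.one_mem)
    rw [← Subgroup.map_comap_eq_self_of_surjective (QuotientGroup.mk'_surjective N) M, h1]
    exact QuotientGroup.map_mk'_self N
  have : IsSimpleGroup (G ⧸ N) := ⟨fun M hM => hsimp M hM⟩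
  obtain ⟨hlin, hc⟩ := simple_step (h.quot (QuotientGroup.mk' N) (QuotientGroup.mk'_surjective N))
    (by
      intro χ hχ h1
      obtain ⟨M, hM, hMk, -⟩ := deflate hχ
      rcases hsimp M hM with rfl | rfl
      · rw [← hMk]; rfl
      · exfalso
        apply h1
        apply eq_one_of_const hχ
        intro g
        have : g ∈ charKer χ := by rw [← hMk]; trivial
        exact this)
  have hcomm := comm_of_linear hlin
  let _ : CommGroup (G ⧸ N) := { (inferInstance : Group (G ⧸ N)) with mul_comm := hcomm }
  exact ⟨_, IsSimpleGroup.prime_card (α := G ⧸ N), hc⟩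

lemma final_step [Nontrivial G] {c : ℂ} (h : Good G c) :
    ∀ χ : G → ℂ, IsIrrChar G χ → χ 1 = 1 := by
  obtain ⟨p, hp, rfl⟩ := exists_prime h
  intro χ hχ
  by_cases h1 : χ = 1
  · rw [h1]; rfl
  obtain ⟨N, hN, hNk, ψ, hψ, hχψ, hψk⟩ := deflate hχ
  have hψ1 : ψ ≠ 1 := fun h2 => h1 (by rw [hχψ, h2]; rfl)
  have hgood := h.quot (QuotientGroup.mk' N) (QuotientGroup.mk'_surjective N)
  obtain ⟨d, hd, hd1⟩ := irr_degree hψ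
  have hlt := degree_sq_lt hψ hψ1 hd1
  have hcard : Nat.card (G ⧸ N) = p * d := by
    have h2 := hgood ψ hψ hψ1
    rw [codeg, hψk, hd1] at h2
    have hd0 : (d : ℂ) ≠ 0 := by exact_mod_cast hd.ne'
    have h3 : (Nat.card (G ⧸ N) : ℂ) = p * d := by
      rw [← h2]; simp [hd0]
    exact_mod_cast h3
  have hdp : d < p := by
    rw [hcard] at hlt
    by_contra hcon
    push Not at hcon
    have := Nat.mul_le_mul_right d hcon
    omega
  have hχ1 : χ 1 = d := by rw [hχψ, ← hd1]; simp
  by_cases hd2 : d = 1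
  · rw [hχ1, hd2]; simp
  exfalso
  have : Fact p.Prime := ⟨hp⟩
  obtain ⟨P⟩ : Nonempty (Sylow p (G ⧸ N)) := inferInstance
  have hnd : ¬ p ∣ d := fun h => absurd (Nat.le_of_dvd hd h) (by omega)
  have hPc : Nat.card P = p := by
    rw [Sylow.card_eq_multiplicity, hcard, Nat.factorization_mul hp.ne_zero hd.ne']
    simp [hp.factorization_self, Nat.factorization_eq_zero_of_not_dvd hnd]
  have hidx : P.index = d := by
    have := P.card_mul_index
    rw [hcard] at this
    have hPc' : Nat.card (P : Subgroup (G ⧸ N)) = p := hPc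
    rw [hPc'] at this
    exact Nat.eq_of_mul_eq_mul_left hp.pos this
  have hle : Nat.card (Sylow p (G ⧸ N)) ≤ d := by
    have := P.card_dvd_index
    rw [hidx] at this
    exact Nat.le_of_dvd hd this
  have hone : Nat.card (Sylow p (G ⧸ N)) = 1 := by
    have := card_sylow_modEq_one p (G ⧸ N)
    unfold Nat.ModEq at this
    rwa [Nat.mod_eq_of_lt (by omega), Nat.mod_eq_of_lt hp.one_lt] at this
  have hsub : Subsingleton (Sylow p (G ⧸ N)) := (Nat.card_eq_one_iff_unique.1 hone).1
  have hPn : (P : Subgroup (G ⧸ N)).Normal := Sylow.normal_of_subsingleton P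
  have hRc : Nat.card ((G ⧸ N) ⧸ (P : Subgroup (G ⧸ N))) = d := hidx
  have : Nontrivial ((G ⧸ N) ⧸ (P : Subgroup (G ⧸ N))) := by
    rw [← Finite.one_lt_card_iff_nontrivial, hRc]
    omega
  have hgR := hgood.quot (QuotientGroup.mk' (P : Subgroup (G ⧸ N)))
    (QuotientGroup.mk'_surjective _)
  obtain ⟨θ, hθ, hθ1⟩ := exists_nontrivial_irr ((G ⧸ N) ⧸ (P : Subgroup (G ⧸ N)))
  obtain ⟨e, he, he1⟩ := irr_degree hθ
  have h5 := hgR θ hθ hθ1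
  have hkpos : 0 < Nat.card (charKer θ) := by
    have : Nonempty (charKer θ) := ⟨⟨1, rfl⟩⟩
    exact Nat.card_pos
  rw [codeg, hRc, he1] at h5
  have hk0 : (Nat.card (charKer θ) : ℂ) ≠ 0 := by exact_mod_cast hkpos.ne'
  have he0 : (e : ℂ) ≠ 0 := by exact_mod_cast he.ne'
  have h6 : (d : ℂ) = p * (Nat.card (charKer θ) * e) := by
    rw [← h5]; field_simp
  have h7 : d = p * (Nat.card (charKer θ) * e) := by exact_mod_cast h6
  exact hnd ⟨_, h7⟩

lemma codeg_ne_one {χ : G → ℂ} (hχ : IsIrrChar G χ) (h1 : χ ≠ 1) : codeg χ ≠ 1 := by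
  obtain ⟨N, hN, hNk, ψ, hψ, hχψ, hψk⟩ := deflate hχ
  have hψ1 : ψ ≠ 1 := fun h2 => h1 (by rw [hχψ, h2]; rfl)
  obtain ⟨d, hd, hd1⟩ := irr_degree hψ
  have hlt := degree_sq_lt hψ hψ1 hd1
  rw [hχψ, codeg_comp _ (QuotientGroup.mk'_surjective N), codeg, hψk, hd1]
  intro h2
  have hd0 : (d : ℂ) ≠ 0 := by exact_mod_cast hd.ne'
  have h3 : (Nat.card (G ⧸ N) : ℂ) = d := by
    rw [div_eq_one_iff_eq hd0] at h2
    simpa using h2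
  have h4 : Nat.card (G ⧸ N) = d := by exact_mod_cast h3
  rw [h4] at hlt
  nlinarith

lemma codeg_one (G : Type) [Group G] [Fintype G] : codeg (1 : G → ℂ) = 1 := by
  have hG : (Nat.card G : ℂ) ≠ 0 := by exact_mod_cast Nat.card_pos.ne'
  have : charKer (1 : G → ℂ) = Set.univ := by ext; simp [charKer]
  rw [codeg, this, Nat.card_univ, div_self hG]
  simp

end

end CodAux


/-- If a finite group `G` has exactly two codegrees, then `G` is a nontrivial abelian group,
and in particular `G` is an M-group. -/
theorem nontrivial_abelian_of_card_codSet_eq_two (G : Type) [Group G] [Finite G]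
    (h : (codSet G).ncard = 2) :
    Nontrivial G ∧ (∀ a b : G, a * b = b * a) ∧ IsMGroup G := by

  have := Fintype.ofFinite G
  obtain ⟨a, b, hab, hset⟩ := Set.ncard_eq_two.1 h
  have hone : (1 : ℂ) ∈ codSet G := ⟨1, CodAux.irr_one G, CodAux.codeg_one G⟩
  obtain ⟨c, hc1, hc⟩ : ∃ c : ℂ, c ≠ 1 ∧ codSet G = {1, c} := by
    have h1 := hone
    rw [hset] at h1
    rcases h1 with h1 | h1
    · exact ⟨b, fun hb => hab (by rw [hb, ← h1]), by rw [hset, h1]⟩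
    · have h1 : (1 : ℂ) = b := h1
      exact ⟨a, fun ha => hab (by rw [ha, ← h1]), by rw [hset, h1, Set.pair_comm]⟩
  have hgood : CodAux.Good G c := by
    intro χ hχ h1
    have h2 : codeg χ ∈ codSet G := ⟨χ, hχ, rfl⟩
    rw [hc] at h2
    rcases h2 with h2 | h2
    · exact absurd h2 (CodAux.codeg_ne_one hχ h1)
    · exact h2
  have hnt : Nontrivial G := by
    have h2 : c ∈ codSet G := by rw [hc]; simp
    obtain ⟨χ, hχ, hχc⟩ := h2
    have h1 : χ ≠ 1 := by
      rintro rfl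
      exact hc1 (by rw [← hχc, CodAux.codeg_one])
    by_contra hcon
    rw [not_nontrivial_iff_subsingleton] at hcon
    exact h1 (CodAux.eq_one_of_const hχ fun g => by rw [Subsingleton.elim g 1])
  have hlin := CodAux.final_step hgood
  have hcomm := CodAux.comm_of_linear hlin
  refine ⟨hnt, hcomm, ?_⟩
  intro χ hχ
  obtain ⟨lam, rfl⟩ := CodAux.linear_of_degree_one hχ (hlin χ hχ)
  refine ⟨⊤, lam.comp (Subgroup.subtype ⊤), ?_⟩
  ext g
  have hG : (Nat.card G : ℂ) ≠ 0 := by exact_mod_cast Nat.card_pos.ne'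
  have h1 : ∀ x : G, x⁻¹ * g * x = g := fun x => by rw [hcomm (x⁻¹) g]; simp
  have hG' : (Fintype.card G : ℂ) ≠ 0 := by exact_mod_cast Fintype.card_ne_zero
  simp [indChar, h1, finsum_eq_sum_of_fintype, hG']
end

section
/- The special linear group SL(2,3) of 2×2 matrices of determinant 1 over the field with 3 elements is not an M-group; that is, SL(2,3) has an irreducible complex character that is not induced from any linear character of any subgroup. Consequently, the bound |cod(G)| ≤ 3 in the theorem 'if |cod(G)| ≤ 3 then G is an M-group' cannot be improved to |cod(G)| ≤ 4. -/
open scoped Classical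

abbrev SLG := Matrix.SpecialLinearGroup (Fin 2) (ZMod 3)
namespace SLX
def phi (A : SLG) : ZMod 3 := (1 - A.1 1 0 ^2) * (A.1 0 1 * A.1 1 1) + A.1 1 0 * (A.1 0 0 + A.1 1 1)
def lft (x : ZMod 3) : ℤ := if x = 0 then 0 else if x = 1 then 1 else -1
/-- quaternion coordinates over F_3 wrt 1, I=(0 1;-1 0), J=(1 1;1 -1), K=IJ=(1 -1;-1 -1) -/
def al (A : SLG) : ZMod 3 := -(A.1 0 0 + A.1 1 1)
def be (A : SLG) : ZMod 3 := -(A.1 0 1 - A.1 1 0)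
def p (A : SLG) : ZMod 3 := A.1 0 0 - A.1 1 1
def q (A : SLG) : ZMod 3 := A.1 0 1 + A.1 1 0
def ga (A : SLG) : ZMod 3 := p A + q A
def de (A : SLG) : ZMod 3 := p A - q A
def sc (A : SLG) (x : ZMod 3) : ℤ := if al A * be A * ga A * de A = 0 then 2 * lft x else - lft x
def q0 (A : SLG) : ℤ := sc A (al A)
def q1 (A : SLG) : ℤ := sc A (be A)
def q2 (A : SLG) : ℤ := sc A (ga A)
def q3 (A : SLG) : ℤ := sc A (de A)
set_option maxRecDepth 100000
theorem phi_mul : ∀ A B : SLG, phi (A * B) = phi A + phi B := by decide +kernel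
theorem q_mul : ∀ A B : SLG, 2 * q0 (A*B) = q0 A * q0 B - q1 A * q1 B - q2 A * q2 B - q3 A * q3 B ∧
  2 * q1 (A*B) = q0 A * q1 B + q1 A * q0 B + q2 A * q3 B - q3 A * q2 B ∧
  2 * q2 (A*B) = q0 A * q2 B - q1 A * q3 B + q2 A * q0 B + q3 A * q1 B ∧
  2 * q3 (A*B) = q0 A * q3 B + q1 A * q2 B - q2 A * q1 B + q3 A * q0 B := by decide +kernel
theorem sq_gen : ∀ g : SLG, ∃ x y : SLG, g = x * x * (y * y) := by decide +kernel
theorem crd : Fintype.card SLG = 24 := by decide +kernel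

def cls (A : SLG) : Fin 7 :=
  if phi A = 0 then (if al A = 0 then 2 else if al A = 1 then 0 else 1)
  else if phi A = 1 then (if al A = 1 then 3 else 5)
  else (if al A = 1 then 4 else 6)

def icls : Fin 7 → Fin 7 := ![0, 1, 2, 4, 3, 6, 5]

theorem cls_inv : ∀ A : SLG, cls A⁻¹ = icls (cls A) := by decide +kernel

theorem cls_conj : ∀ A B : SLG, cls A = cls B → ∃ h : SLG, h * A * h⁻¹ = B := by decide +kernel

theorem cls_surj : ∀ c : Fin 7, ∃ A : SLG, cls A = c := by decide +kernel

theorem cls_one : cls 1 = 0 := by decide +kernel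

theorem cls_phi : ∀ A : SLG, (phi A).val = (![0, 0, 0, 1, 2, 1, 2] : Fin 7 → ℕ) (cls A) := by
  decide +kernel

theorem cls_q0 : ∀ A : SLG, q0 A = (![2, -2, 0, -1, -1, 1, 1] : Fin 7 → ℤ) (cls A) := by
  decide +kernel

theorem cls_card : ∀ c : Fin 7, Fintype.card {A : SLG // cls A = c} =
    (![1, 1, 6, 4, 4, 4, 4] : Fin 7 → ℕ) c := by
  decide +kernel

theorem sum_cls (f : Fin 7 → ℂ) :
    ∑ g : SLG, f (cls g) = f 0 + f 1 + 6 * f 2 + 4 * f 3 + 4 * f 4 + 4 * f 5 + 4 * f 6 := by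
  rw [← Fintype.sum_fiberwise cls]
  have h : ∀ c : Fin 7, ∑ i : {A : SLG // cls A = c}, f (cls i.1) =
      ((![1, 1, 6, 4, 4, 4, 4] : Fin 7 → ℕ) c : ℂ) * f c := by
    intro c
    rw [Finset.sum_congr rfl (fun i _ => by rw [i.2])]
    rw [Finset.sum_const, nsmul_eq_mul, ← cls_card c, Finset.card_univ]
  have h' := Finset.sum_congr (rfl : (Finset.univ : Finset (Fin 7)) = _) (fun c _ => h c)
  refine Eq.trans (by convert h') ?_
  simp [Fin.sum_univ_succ]
  ring

theorem ncard : Nat.card SLG = 24 := by rw [Nat.card_eq_fintype_card, crd]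

noncomputable section

/-- The representation attached to a matrix representation. -/
def matRep {n : ℕ} (f : SLG →* Matrix (Fin n) (Fin n) ℂ) : FDRep ℂ SLG :=
  FDRep.of (V := Fin n → ℂ)
    ((Matrix.toLinAlgEquiv' (R := ℂ) (n := Fin n)).toRingEquiv.toMonoidHom.comp f)

theorem matRep_char {n : ℕ} (f : SLG →* Matrix (Fin n) (Fin n) ℂ) (g : SLG) :
    (matRep f).character g = (f g).trace := by
  change LinearMap.trace ℂ (Fin n → ℂ) (Matrix.toLin' (f g)) = _
  rw [Matrix.trace_toLin'_eq]

theorem zpow_phi {z : ℂ} (hz : z ^ 3 = 1) (A B : SLG) :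
    z ^ (phi (A * B)).val = z ^ (phi A).val * z ^ (phi B).val := by
  rw [phi_mul, ZMod.val_add, ← pow_add]
  conv_rhs => rw [← Nat.mod_add_div ((phi A).val + (phi B).val) 3, pow_add, pow_mul, hz, one_pow,
    mul_one]

theorem phi_one : (phi 1).val = 0 := by decide +kernel

theorem q_one : q0 1 = 2 ∧ q1 1 = 0 ∧ q2 1 = 0 ∧ q3 1 = 0 := by decide +kernel

def homL (z : ℂ) (hz : z ^ 3 = 1) : SLG →* Matrix (Fin 1) (Fin 1) ℂ where
  toFun A := !![z ^ (phi A).val]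
  map_one' := by ext i j; fin_cases i; fin_cases j; simp [phi_one]
  map_mul' A B := by
    ext i j; fin_cases i; fin_cases j; simp [zpow_phi hz, Matrix.mul_apply]

def quatMat (A : SLG) : Matrix (Fin 2) (Fin 2) ℂ :=
  !![(q0 A + Complex.I * q1 A) / 2, (q2 A + Complex.I * q3 A) / 2;
     (-q2 A + Complex.I * q3 A) / 2, (q0 A - Complex.I * q1 A) / 2]

theorem quatMat_mul (A B : SLG) : quatMat (A * B) = quatMat A * quatMat B := by
  obtain ⟨h0, h1, h2, h3⟩ := q_mul A B
  have h0 := congrArg (Int.cast : ℤ → ℂ) h0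
  have h1 := congrArg (Int.cast : ℤ → ℂ) h1
  have h2 := congrArg (Int.cast : ℤ → ℂ) h2
  have h3 := congrArg (Int.cast : ℤ → ℂ) h3
  push_cast at h0 h1 h2 h3
  have hI := Complex.I_sq
  unfold quatMat
  rw [Matrix.mul_fin_two]
  congr 1
  ext i j
  fin_cases i <;> fin_cases j <;> simp
  · linear_combination (1/4) * h0 + (Complex.I / 4) * h1 - (1/4) * (q1 A * q1 B + q3 A * q3 B) * hI
  · linear_combination (1/4) * h2 + (Complex.I / 4) * h3 - (1/4) * (q1 A * q3 B - q3 A * q1 B) * hI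
  · linear_combination -(1/4) * h2 + (Complex.I / 4) * h3 - (1/4) * (q3 A * q1 B - q1 A * q3 B) * hI
  · linear_combination (1/4) * h0 - (Complex.I / 4) * h1 - (1/4) * (q1 A * q1 B + q3 A * q3 B) * hI

theorem quatMat_one : quatMat 1 = 1 := by
  obtain ⟨h0, h1, h2, h3⟩ := q_one
  ext i j
  fin_cases i <;> fin_cases j <;> simp [quatMat, h0, h1, h2, h3]

def homW (z : ℂ) (hz : z ^ 3 = 1) : SLG →* Matrix (Fin 2) (Fin 2) ℂ where
  toFun A := z ^ (phi A).val • quatMat A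
  map_one' := by simp [phi_one, quatMat_one]
  map_mul' A B := by
    simp only [zpow_phi hz, quatMat_mul, Matrix.smul_mul, Matrix.mul_smul, smul_smul]
    rw [mul_comm]

def chiL (z : ℂ) : Fin 7 → ℂ := ![1, 1, 1, z, z ^ 2, z, z ^ 2]
def chiW (z : ℂ) : Fin 7 → ℂ := ![2, -2, 0, -z, -z ^ 2, z, z ^ 2]

theorem char_L (z : ℂ) (hz : z ^ 3 = 1) (g : SLG) :
    (matRep (homL z hz)).character g = chiL z (cls g) := by
  rw [matRep_char]
  simp only [homL, MonoidHom.coe_mk, OneHom.coe_mk, cls_phi]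
  generalize cls g = c
  fin_cases c <;> simp [chiL, Matrix.trace]

theorem char_W (z : ℂ) (hz : z ^ 3 = 1) (g : SLG) :
    (matRep (homW z hz)).character g = chiW z (cls g) := by
  rw [matRep_char]
  simp only [homW, MonoidHom.coe_mk, OneHom.coe_mk, cls_phi, Matrix.trace_smul]
  have : (quatMat g).trace = (q0 g : ℂ) := by
    simp [quatMat, Matrix.trace_fin_two]; ring
  rw [this, cls_q0]
  generalize cls g = c
  fin_cases c <;> simp [chiW]

theorem sum_pair (V W : FDRep ℂ SLG) (F K : Fin 7 → ℂ)
    (hF : ∀ g, V.character g = F (cls g)) (hK : ∀ g, W.character g = K (cls g)) :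
    ∑ g : SLG, V.character g * W.character g⁻¹ =
      F 0 * K 0 + F 1 * K 1 + 6 * (F 2 * K 2) + 4 * (F 3 * K 4) + 4 * (F 4 * K 3)
        + 4 * (F 5 * K 6) + 4 * (F 6 * K 5) := by
  have := sum_cls (fun c => F c * K (icls c))
  simp only [hF, hK, cls_inv]
  rw [this]
  simp [icls]

theorem simple_L (z : ℂ) (hz : z ^ 3 = 1) : CategoryTheory.Simple (matRep (homL z hz)) := by
  rw [FDRep.simple_iff_char_is_norm_one, sum_pair _ _ _ _ (char_L z hz) (char_L z hz), ncard]
  simp [chiL]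
  linear_combination 16 * hz

theorem simple_W (z : ℂ) (hz : z ^ 3 = 1) : CategoryTheory.Simple (matRep (homW z hz)) := by
  rw [FDRep.simple_iff_char_is_norm_one, sum_pair _ _ _ _ (char_W z hz) (char_W z hz), ncard]
  simp [chiW]
  linear_combination 16 * hz

theorem not_mono (z : ℂ) (hz : z ^ 3 = 1) :
    ¬ IsMonomialChar (matRep (homW z hz)).character := by
  rintro ⟨H, lam, h⟩
  have h1 := congrFun h 1
  rw [char_W, cls_one] at h1
  have h2 : indChar H lam 1 = (Nat.card H : ℂ)⁻¹ * 24 := by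
    unfold indChar
    have : ∀ x : SLG, (if h : x⁻¹ * 1 * x ∈ H then lam ⟨x⁻¹ * 1 * x, h⟩ else 0) = 1 := by
      intro x
      have hx : x⁻¹ * 1 * x = 1 := by group
      have hm : x⁻¹ * 1 * x ∈ H := by rw [hx]; exact H.one_mem
      rw [dif_pos hm]
      have : (⟨x⁻¹ * 1 * x, hm⟩ : H) = 1 := Subtype.ext hx
      rw [this, map_one]
    rw [finsum_congr this, finsum_eq_sum_of_fintype]
    simp only [Finset.sum_const, Finset.card_univ, crd]
    norm_num
  rw [h2] at h1
  have hpos : (Nat.card H : ℂ) ≠ 0 := by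
    exact_mod_cast Nat.card_pos.ne'
  have h12 : Nat.card H = 12 := by
    have : (Nat.card H : ℂ) * 2 = 24 := by
      rw [show (2 : ℂ) = chiW z 0 by simp [chiW], h1]
      field_simp
    have : Nat.card H * 2 = 24 := by exact_mod_cast this
    omega
  have hidx : H.index = 2 := by
    have := H.card_mul_index
    rw [h12, ncard] at this
    omega
  have htop : H = ⊤ := by
    rw [eq_top_iff]
    intro g _
    obtain ⟨x, y, rfl⟩ := sq_gen g
    exact H.mul_mem (Subgroup.mul_self_mem_of_index_two hidx x)
      (Subgroup.mul_self_mem_of_index_two hidx y)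
  rw [htop, Subgroup.index_top] at hidx
  omega

theorem exists_cls (V : FDRep ℂ SLG) : ∃ F : Fin 7 → ℂ, ∀ g, V.character g = F (cls g) := by
  choose r hr using cls_surj
  refine ⟨fun c => V.character (r c), fun g => ?_⟩
  obtain ⟨h, hh⟩ := cls_conj g (r (cls g)) (hr _).symm
  change _ = V.character (r (cls g))
  rw [← hh, FDRep.char_conj]

theorem codeg_eq (χ : SLG → ℂ) (F : Fin 7 → ℂ) (hF : ∀ g, χ g = F (cls g)) :
    codeg χ = (24 / (1 + (if F 1 = F 0 then 1 else 0) + 6 * (if F 2 = F 0 then 1 else 0)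
      + 4 * (if F 3 = F 0 then 1 else 0) + 4 * (if F 4 = F 0 then 1 else 0)
      + 4 * (if F 5 = F 0 then 1 else 0) + 4 * (if F 6 = F 0 then 1 else 0))) / F 0 := by
  have h := sum_cls (fun c => if F c = F 0 then 1 else 0)
  have hk : (Nat.card (charKer χ) : ℂ) = ∑ g : SLG, if F (cls g) = F 0 then (1 : ℂ) else 0 := by
    rw [Finset.sum_boole, Nat.card_eq_fintype_card]
    congr 1
    rw [Fintype.card_subtype]
    congr 1
    ext g
    simp [charKer, hF, cls_one]
  unfold codeg
  rw [hk, h, hF, cls_one, ncard]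
  simp

theorem orth (V W : FDRep ℂ SLG) (hV : CategoryTheory.Simple V) (hW : CategoryTheory.Simple W)
    (hne : V.character ≠ W.character) : ∑ g : SLG, V.character g * W.character g⁻¹ = 0 := by
  have : Invertible (Nat.card SLG : ℂ) := invertibleOfNonzero (by rw [ncard]; norm_num)
  have h := FDRep.char_orthonormal V W
  rw [if_neg (fun ⟨i⟩ => hne (FDRep.char_iso i)), ncard] at h
  rcases mul_eq_zero.mp h with h | h
  · norm_num at h
  · exact h

theorem codeg_L (z : ℂ) (hz : z ^ 3 = 1) :
    codeg (matRep (homL z hz)).character = 1 ∨ codeg (matRep (homL z hz)).character = 3 := by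
  rw [codeg_eq _ _ (char_L z hz)]
  by_cases h : z = 1
  · left; subst h; simp [chiL]; norm_num
  · right
    have h2 : z ^ 2 ≠ 1 := fun h2 => h (by linear_combination hz - z * h2)
    simp only [chiL, Matrix.cons_val, h, h2, if_true, if_false]; norm_num

theorem codeg_W (z : ℂ) (hz : z ^ 3 = 1) :
    codeg (matRep (homW z hz)).character = 12 := by
  rw [codeg_eq _ _ (char_W z hz)]
  have h1 : z ≠ 2 := by rintro rfl; norm_num at hz
  have h2 : -z ≠ 2 := by
    intro h
    obtain rfl : z = -2 := by linear_combination -h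
    norm_num at hz
  have h6 : (z ^ 2) ^ 3 = 1 := by rw [← pow_mul, mul_comm, pow_mul, hz, one_pow]
  have h3 : z ^ 2 ≠ 2 := by intro h; rw [h] at h6; norm_num at h6
  have h4 : -z ^ 2 ≠ 2 := by
    intro h
    have : z ^ 2 = -2 := by linear_combination -h
    rw [this] at h6; norm_num at h6
  have h5 : (-2 : ℂ) ≠ 2 := by norm_num
  simp only [chiW, Matrix.cons_val, h1, h2, h3, h4, h5, if_false]
  norm_num

theorem codeg_mem (V : FDRep ℂ SLG) (hV : CategoryTheory.Simple V) :
    codeg V.character ∈ ({1, 3, 4, 12} : Set ℂ) := by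
  obtain ⟨w, hw⟩ : ∃ w : ℂ, w ^ 2 + w + 1 = 0 := by
    obtain ⟨w, hw⟩ := IsAlgClosed.exists_pow_nat_eq (-3 : ℂ) (n := 2) (by norm_num)
    exact ⟨(-1 + w) / 2, by linear_combination hw / 4⟩
  have hw3 : w ^ 3 = 1 := by linear_combination (w - 1) * hw
  have hv3 : (w ^ 2) ^ 3 = 1 := by rw [← pow_mul, mul_comm, pow_mul, hw3, one_pow]
  by_cases hL : ∃ (z : ℂ) (hz : z ^ 3 = 1), V.character = (matRep (homL z hz)).character
  · obtain ⟨z, hz, h⟩ := hL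
    rw [h]
    rcases codeg_L z hz with h | h <;> rw [h] <;> simp
  by_cases hW : ∃ (z : ℂ) (hz : z ^ 3 = 1), V.character = (matRep (homW z hz)).character
  · obtain ⟨z, hz, h⟩ := hW
    rw [h, codeg_W z hz]; simp
  push Not at hL hW
  obtain ⟨F, hF⟩ := exists_cls V
  have oL : ∀ (z : ℂ) (hz : z ^ 3 = 1), _ := fun z hz =>
    (sum_pair V _ F _ hF (char_L z hz)).symm.trans (orth V _ hV (simple_L z hz) (hL z hz))
  have oW : ∀ (z : ℂ) (hz : z ^ 3 = 1), _ := fun z hz =>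
    (sum_pair V _ F _ hF (char_W z hz)).symm.trans (orth V _ hV (simple_W z hz) (hW z hz))
  have hn := (FDRep.simple_iff_char_is_norm_one V).mp hV
  rw [sum_pair V V F F hF hF, ncard] at hn
  have a0 := oL 1 (by norm_num)
  have a1 := oL w hw3
  have a2 := oL (w ^ 2) hv3
  have b0 := oW 1 (by norm_num)
  have b1 := oW w hw3
  have b2 := oW (w ^ 2) hv3
  simp only [chiL, chiW, Matrix.cons_val] at a0 a1 a2 b0 b1 b2
  have w4 : w ^ 4 = w := by linear_combination w * hw3
  rw [← pow_mul] at a2 b2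
  norm_num [w4] at a0 a1 a2 b0 b1 b2
  have e2 : w ^ 2 = -1 - w := by linear_combination hw
  rw [e2] at a1 a2 b1 b2
  have c0 : F 0 + F 1 + 6 * F 2 = 0 := by linear_combination (a0 + a1 + a2) / 3
  have c1 : F 1 = F 0 := by linear_combination -(b0 + b1 + b2) / 6
  have hd : 1 + 2 * w ≠ 0 := by
    intro h
    have : (3 : ℂ) = 0 := by linear_combination 4 * hw - (1 + 2 * w) * h
    norm_num at this
  have c3 : F 3 + F 5 = F 4 + F 6 := by
    apply mul_left_cancel₀ hd
    linear_combination (a2 - a1) / 4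
  have c4 : F 5 - F 3 = F 6 - F 4 := by
    apply mul_left_cancel₀ hd
    linear_combination (b2 - b1) / 4
  have c5 : F 3 + F 5 = 0 := by linear_combination (a0 - c0) / 8 + c3 / 2
  have c6 : F 5 - F 3 = 0 := by linear_combination (b0 + 2 * c1) / 8 + c4 / 2
  have f3 : F 3 = 0 := by linear_combination (c5 - c6) / 2
  have f5 : F 5 = 0 := by linear_combination (c5 + c6) / 2
  have f4 : F 4 = 0 := by linear_combination (c5 - c6 - c3 + c4) / 2
  have f6 : F 6 = 0 := by linear_combination (c5 + c6 - c3 - c4) / 2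
  have f2 : F 2 = - F 0 / 3 := by linear_combination (c0 - c1) / 6
  rw [f3, f4, f5, f6, f2, c1] at hn
  have h9 : (F 0) ^ 2 = 9 := by
    push_cast at hn
    linear_combination (3 / 8) * hn
  have hdim : F 0 = Module.finrank ℂ V := by
    rw [← FDRep.char_one, hF, cls_one]
  have h3 : F 0 = 3 := by
    rw [hdim] at h9 ⊢
    have h9 : (Module.finrank ℂ V) ^ 2 = 9 := by exact_mod_cast h9
    have : Module.finrank ℂ V = 3 := by nlinarith
    rw [this]; norm_num
  rw [codeg_eq _ F hF, f2, f3, f4, f5, f6, c1, h3]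
  norm_num

theorem cod_card : (codSet SLG).ncard ≤ 4 := by
  have hsub : codSet SLG ⊆ (({1, 3, 4, 12} : Finset ℂ) : Set ℂ) := by
    rintro c ⟨χ, ⟨V, hV, rfl⟩, rfl⟩
    simpa using codeg_mem V hV
  refine (Set.ncard_le_ncard hsub (Finset.finite_toSet _)).trans ?_
  rw [Set.ncard_coe_finset]
  exact Finset.card_le_four

end

end SLX

/-- `SL(2,3)` is not an M-group: it has an irreducible complex character that is not
monomial.  Consequently, the bound `|cod(G)| ≤ 3` in Theorem 1 cannot be improved to
`|cod(G)| ≤ 4`: it is not true that every finite group with at most four codegrees is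
an M-group. -/
theorem SL2_3_not_MGroup :
    (∃ χ : Matrix.SpecialLinearGroup (Fin 2) (ZMod 3) → ℂ,
      IsIrrChar (Matrix.SpecialLinearGroup (Fin 2) (ZMod 3)) χ ∧ ¬ IsMonomialChar χ) ∧
    ¬ (∀ (G : Type) [Group G] [Finite G], (codSet G).ncard ≤ 4 → IsMGroup G) := by
  have h1 : (1 : ℂ) ^ 3 = 1 := by norm_num
  have key : IsIrrChar (Matrix.SpecialLinearGroup (Fin 2) (ZMod 3))
      (SLX.matRep (SLX.homW 1 h1)).character := ⟨_, SLX.simple_W 1 h1, rfl⟩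
  refine ⟨⟨_, key, SLX.not_mono 1 h1⟩, fun h => ?_⟩
  exact SLX.not_mono 1 h1 (h (Matrix.SpecialLinearGroup (Fin 2) (ZMod 3)) SLX.cod_card _ key)
end

section
/- Let G be a finite group and N a normal subgroup of G. If G is a relative M-group with respect to N, then the quotient group G/N is an M-group. -/
open scoped Classical

/-- `χ` is a relative M-character of `G` with respect to the normal subgroup `N`:
there are a subgroup `H` with `N ≤ H ≤ G` and an irreducible character `θ` of `H`
such that `θ` induces to `χ` and the restriction of `θ` to `N` is an irreducible
character of `N`. -/
def IsRelMChar {G : Type} [Group G] (N : Subgroup G) (χ : G → ℂ) : Prop :=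
  ∃ (H : Subgroup G) (hNH : N ≤ H) (θ : ↥H → ℂ),
    IsIrrChar ↥H θ ∧ indChar H θ = χ ∧
    IsIrrChar ↥N (fun n : ↥N => θ ⟨(n : G), hNH n.2⟩)

/-- `G` is a relative M-group with respect to `N` when every irreducible complex character
of `G` is a relative M-character with respect to `N`. -/
def IsRelMGroup (G : Type) [Group G] (N : Subgroup G) : Prop :=
  ∀ χ : G → ℂ, IsIrrChar G χ → IsRelMChar N χ


open CategoryTheory in
theorem relM_inflate {G Q : Type} [Group G] [Finite G] [Group Q] [Finite Q] (f : G →* Q)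
    (c : ℕ) (hc : ∀ F : Q → ℂ, ∑ᶠ x : G, F (f x) = c * ∑ᶠ y : Q, F y)
    (χ : Q → ℂ) (hχ : IsIrrChar Q χ) : IsIrrChar G (fun g => χ (f g)) := by
  have := Fintype.ofFinite G
  have := Fintype.ofFinite Q
  obtain ⟨V, hV, rfl⟩ := hχ
  refine ⟨FDRep.of (V.ρ.comp f), ?_, rfl⟩
  rw [FDRep.simple_iff_char_is_norm_one] at hV ⊢
  have h1 := hc (fun y => V.character y * V.character y⁻¹)
  have h2 := hc (fun _ => 1)
  rw [finsum_eq_sum_of_fintype, finsum_eq_sum_of_fintype] at h1 h2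
  rw [hV] at h1
  simp only [Finset.sum_const, Finset.card_univ, nsmul_eq_mul, mul_one,
    ← Nat.card_eq_fintype_card] at h2
  rw [h2, ← h1]
  refine Finset.sum_congr rfl fun x _ => ?_
  rw [← map_inv]
  rfl

theorem relM_fiber {G : Type} [Group G] [Finite G] (N : Subgroup G) [N.Normal]
    (F : G ⧸ N → ℂ) :
    ∑ᶠ x : G, F (QuotientGroup.mk' N x) = (Nat.card N : ℂ) * ∑ᶠ y : G ⧸ N, F y := by
  have := Fintype.ofFinite G
  have := Fintype.ofFinite N
  have := Fintype.ofFinite (G ⧸ N)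
  rw [finsum_eq_sum_of_fintype, finsum_eq_sum_of_fintype,
    ← Finset.sum_fiberwise Finset.univ (fun x : G => QuotientGroup.mk' N x), Finset.mul_sum]
  refine Finset.sum_congr rfl fun y _ => ?_
  obtain ⟨g, rfl⟩ := QuotientGroup.mk'_surjective N y
  rw [Finset.sum_congr rfl (g := fun _ => F (QuotientGroup.mk' N g))
    (fun x hx => by rw [(Finset.mem_filter.1 hx).2]), Finset.sum_const, nsmul_eq_mul]
  congr 2
  rw [Nat.card_eq_fintype_card, ← Finset.card_univ]
  symm
  refine Finset.card_bij (fun n _ => g * n.1) ?_ ?_ ?_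
  · intro n _
    refine Finset.mem_filter.2 ⟨Finset.mem_univ _, ?_⟩
    exact QuotientGroup.eq.2 (by simp)
  · intro a _ b _ hab
    exact Subtype.ext (mul_left_cancel hab)
  · intro x hx
    have hx := (Finset.mem_filter.1 hx).2
    refine ⟨⟨g⁻¹ * x, ?_⟩, Finset.mem_univ _, by simp⟩
    exact QuotientGroup.eq.1 hx.symm

theorem relM_char_one_ne {G : Type} [Group G] [Finite G] (χ : G → ℂ) (h : IsIrrChar G χ) :
    χ 1 ≠ 0 := by
  have := Fintype.ofFinite G
  obtain ⟨V, hV, rfl⟩ := h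
  rw [FDRep.simple_iff_char_is_norm_one] at hV
  intro h0
  rw [FDRep.char_one] at h0
  have h0 : Module.finrank ℂ V = 0 := by exact_mod_cast h0
  have : Subsingleton V := Module.finrank_zero_iff.1 h0
  have hz : ∀ g, V.character g = 0 := fun g => by
    have : V.ρ g = 0 := LinearMap.ext fun x => Subsingleton.elim _ _
    rw [FDRep.character, this, map_zero]
  simp only [hz, mul_zero, Finset.sum_const_zero] at hV
  exact NeZero.ne (Nat.card G : ℂ) hV.symm

open CategoryTheory in
theorem relM_eq_one {G : Type} [Group G] [Finite G] (χ : G → ℂ) (h : IsIrrChar G χ)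
    (hs : ∑ᶠ g, χ g ≠ 0) (g : G) : χ g = 1 := by
  have := Fintype.ofFinite G
  rw [finsum_eq_sum_of_fintype] at hs
  obtain ⟨V, hV, rfl⟩ := h
  let T : FDRep ℂ G := FDRep.of (Representation.trivial ℂ G ℂ)
  have hT : ∀ g, T.character g = 1 := fun g => by
    change LinearMap.trace ℂ ℂ LinearMap.id = 1
    simp
  have hTs : Simple T := by
    rw [FDRep.simple_iff_char_is_norm_one]
    simp [hT]
  have := invertibleOfNonzero (NeZero.ne (Nat.card G : ℂ))
  have ho := FDRep.char_orthonormal V T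
  simp only [hT, mul_one] at ho
  by_cases hn : Nonempty (V ≅ T)
  · rw [FDRep.char_iso hn.some, hT]
  · rw [if_neg hn] at ho
    exact absurd ho (mul_ne_zero (inv_ne_zero (NeZero.ne _)) hs)

theorem relM_linear {G : Type} [Group G] (χ : G → ℂ) (h : IsIrrChar G χ)
    (h1 : χ 1 = 1) : ∃ l : G →* ℂ, ∀ g, l g = χ g := by
  obtain ⟨V, hV, rfl⟩ := h
  have h2 := h1
  rw [FDRep.char_one] at h2
  have h2 : Module.finrank ℂ V = 1 := by exact_mod_cast h2
  have key : ∀ u : V →ₗ[ℂ] V, u = LinearMap.trace ℂ V u • LinearMap.id := fun u => by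
    obtain ⟨c, hc, -⟩ := LinearMap.existsUnique_eq_smul_id_of_finrank_eq_one h2 u
    have : LinearMap.trace ℂ V u = c := by
      rw [hc, map_smul, LinearMap.trace_id, h2]; simp
    rw [this]; exact hc
  refine ⟨⟨⟨V.character, h1⟩, fun a b => ?_⟩, fun _ => rfl⟩
  change LinearMap.trace ℂ V (V.ρ (a * b)) = LinearMap.trace ℂ V (V.ρ a) * LinearMap.trace ℂ V (V.ρ b)
  rw [map_mul]
  conv_lhs => rw [key (V.ρ a)]
  rw [smul_mul_assoc, map_smul, smul_eq_mul]
  rfl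

/-- Extension by zero. -/
noncomputable def relMExt {G : Type} [Group G] (H : Subgroup G) (θ : ↥H → ℂ) (g : G) : ℂ :=
  if h : g ∈ H then θ ⟨g, h⟩ else 0

theorem relM_ind {G : Type} [Group G] (H : Subgroup G) (θ : ↥H → ℂ) (g : G) :
    indChar H θ g = (Nat.card H : ℂ)⁻¹ * ∑ᶠ x : G, relMExt H θ (x⁻¹ * g * x) := rfl

theorem relM_sum {G : Type} [Group G] [Finite G] (N H : Subgroup G) [N.Normal] (hNH : N ≤ H)
    (θ : ↥H → ℂ) (hk : ∀ n ∈ N, indChar H θ n = indChar H θ 1) :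
    ∑ᶠ n : N, θ ⟨n, hNH n.2⟩ = Nat.card N * θ 1 := by
  have := Fintype.ofFinite G
  have := Fintype.ofFinite N
  have hk' : ∀ n : N, ∑ x : G, relMExt H θ (x⁻¹ * n * x) = Nat.card G * θ 1 := fun n => by
    have := hk n n.2
    rw [relM_ind, relM_ind] at this
    have := mul_left_cancel₀ (inv_ne_zero (NeZero.ne (Nat.card H : ℂ))) this
    rw [finsum_eq_sum_of_fintype, finsum_eq_sum_of_fintype] at this
    rw [this]
    have h1 : relMExt H θ 1 = θ 1 := dif_pos H.one_mem
    simp [h1, Nat.card_eq_fintype_card]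
  have hx : ∀ x : G, ∑ n : N, relMExt H θ (x⁻¹ * n * x) = ∑ n : N, θ ⟨n, hNH n.2⟩ := fun x => by
    refine Fintype.sum_equiv (MulAut.conjNormal x⁻¹ : N ≃* N).toEquiv _ _ fun n => ?_
    have hm : x⁻¹ * n * x ∈ N := by
      simpa using ‹N.Normal›.conj_mem n n.2 x⁻¹
    rw [relMExt, dif_pos (hNH hm)]
    congr 2
    simp
  have hs : ∑ n : N, ∑ x : G, relMExt H θ (x⁻¹ * n * x)
      = ∑ x : G, ∑ n : N, relMExt H θ (x⁻¹ * n * x) := Finset.sum_comm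
  simp only [hk', hx, Finset.sum_const, Finset.card_univ, nsmul_eq_mul,
    ← Nat.card_eq_fintype_card] at hs
  rw [finsum_eq_sum_of_fintype]
  apply mul_left_cancel₀ (NeZero.ne (Nat.card G : ℂ))
  rw [← hs]; ring

theorem relM_descend {G : Type} [Group G] [Finite G] (N H : Subgroup G) [N.Normal] (hNH : N ≤ H)
    (l : H →* ℂ) (hl : ∀ n : N, l ⟨n, hNH n.2⟩ = 1) :
    ∃ m : (H.map (QuotientGroup.mk' N)) →* ℂ,
      ∀ g : G, indChar (H.map (QuotientGroup.mk' N)) m (QuotientGroup.mk' N g) = indChar H l g := by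
  have hmem : ∀ g : G, QuotientGroup.mk' N g ∈ H.map (QuotientGroup.mk' N) ↔ g ∈ H := fun g => by
    constructor
    · rintro ⟨k, hk, hkg⟩
      have : k⁻¹ * g ∈ N := QuotientGroup.eq.1 hkg
      simpa using H.mul_mem hk (hNH this)
    · exact fun hg => ⟨g, hg, rfl⟩
  let f := (QuotientGroup.mk' N).subgroupMap H
  have hf : Function.Surjective f := (QuotientGroup.mk' N).subgroupMap_surjective H
  have hker : f.ker ≤ l.toHomUnits.ker := by
    intro x hx
    have hx' : QuotientGroup.mk' N x.1 = 1 := congrArg Subtype.val (MonoidHom.mem_ker.1 hx)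
    have hxN : x.1 ∈ N := (QuotientGroup.eq_one_iff _).1 hx'
    rw [MonoidHom.mem_ker]
    exact Units.ext (hl ⟨x.1, hxN⟩)
  let m0 := f.liftOfSurjective hf ⟨l.toHomUnits, hker⟩
  have hm0 : ∀ x, m0 (f x) = l.toHomUnits x := fun x =>
    f.liftOfRightInverse_comp_apply _ _ ⟨l.toHomUnits, hker⟩ x
  refine ⟨(Units.coeHom ℂ).comp m0, fun g => ?_⟩
  have hext : ∀ x : G, relMExt (H.map (QuotientGroup.mk' N)) ((Units.coeHom ℂ).comp m0)
      (QuotientGroup.mk' N x) = relMExt H l x := fun x => by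
    by_cases hx : x ∈ H
    · rw [relMExt, relMExt, dif_pos hx, dif_pos ((hmem x).2 hx)]
      exact congrArg Units.val (hm0 ⟨x, hx⟩)
    · rw [relMExt, relMExt, dif_neg hx, dif_neg (fun h => hx ((hmem x).1 h))]
  have hcard : (Nat.card H : ℂ) = Nat.card N * Nat.card (H.map (QuotientGroup.mk' N)) := by
    have := relM_fiber N (fun y => if y ∈ H.map (QuotientGroup.mk' N) then 1 else 0)
    simp only [hmem] at this
    have := Fintype.ofFinite G
    have := Fintype.ofFinite (G ⧸ N)
    rw [finsum_eq_sum_of_fintype, finsum_eq_sum_of_fintype] at *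
    simp only [Finset.sum_boole] at *
    rw [Nat.card_eq_fintype_card (α := H),
      Nat.card_eq_fintype_card (α := H.map (QuotientGroup.mk' N)),
      Fintype.card_subtype, Fintype.card_subtype]
    assumption
  rw [relM_ind, relM_ind]
  have h3 := relM_fiber N (fun y => relMExt (H.map (QuotientGroup.mk' N))
    ((Units.coeHom ℂ).comp m0) (y⁻¹ * QuotientGroup.mk' N g * y))
  simp only [← map_inv, ← map_mul, hext] at h3
  rw [h3, hcard, mul_inv]
  have := NeZero.ne (Nat.card N : ℂ)
  field_simp

/-- If a finite group `G` is a relative M-group with respect to a normal subgroup `N`,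
then `G/N` is an M-group. -/
theorem quotient_mGroup_of_relMGroup (G : Type) [Group G] [Finite G]
    (N : Subgroup G) [N.Normal] (h : IsRelMGroup G N) :
    IsMGroup (G ⧸ N) := by
  intro χ hχ
  obtain ⟨H, hNH, θ, hθ, hind, hθN⟩ := h _ (relM_inflate (QuotientGroup.mk' N) (Nat.card N)
    (relM_fiber N) χ hχ)
  have hs := relM_sum N H hNH θ (fun n hn => by
    rw [hind]
    have : QuotientGroup.mk' N n = QuotientGroup.mk' N 1 := by
      rw [map_one]; exact (QuotientGroup.eq_one_iff _).2 hn
    simp only [this])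
  have h1 := relM_char_one_ne _ hθ
  have hone := relM_eq_one _ hθN (by
    rw [hs]
    exact mul_ne_zero (NeZero.ne _) h1)
  obtain ⟨l, hl⟩ := relM_linear θ hθ (hone 1)
  have hlθ : ⇑l = θ := funext hl
  obtain ⟨m, hm⟩ := relM_descend N H hNH l (fun n => by rw [hl]; exact hone n)
  refine ⟨_, m, funext fun y => ?_⟩
  obtain ⟨g, rfl⟩ := QuotientGroup.mk'_surjective N y
  rw [hm, hlθ, hind]
end

section
/- Let G = SL(2,3) and N = Z(G) its center (which has order 2). Then G/N is isomorphic to the alternating group A₄ and is an M-group, but G is not a relative M-group with respect to N: G has an irreducible complex character of degree 2 whose restriction to N is not irreducible, and this character is not a relative M-character with respect to N. -/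
open scoped Classical

abbrev SL3 := Matrix.SpecialLinearGroup (Fin 2) (ZMod 3)

def qc (g : SL3) : Fin 4 → ℤ :=
  -- coordinates mod 3
  let p := g.1 0 0; let q := g.1 0 1; let r := g.1 1 0; let s := g.1 1 1
  let a : ZMod 3 := -(p+s)
  let b : ZMod 3 := -(r-q)
  -- a + b i + c j + d k = [[a+c-d, -b+c+d],[b+c+d, a-c+d]]
  let u : ZMod 3 := -(p-s)   -- u = c-d
  let v : ZMod 3 := -(q+r)   -- v = c+d
  let c : ZMod 3 := -(u+v)
  let d : ZMod 3 := -(v-u)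
  let w : ZMod 3 → ℤ := fun x => if x = 0 then 0 else if x = 1 then 1 else -1
  let m : ℤ := if a * b * c * d = 0 then 2 else -1
  ![m * w a, m * w b, m * w c, m * w d]

def pr (a b : ZMod 3) : Fin 4 := if a = 0 then 3 else if b = 0 then 0 else if a = b then 1 else 2
def rx : Fin 4 → ZMod 3 := ![1,1,1,0]
def ry : Fin 4 → ZMod 3 := ![0,1,2,1]
def act (g : SL3) (i : Fin 4) : Fin 4 := pr (g.1 0 0 * rx i + g.1 0 1 * ry i) (g.1 1 0 * rx i + g.1 1 1 * ry i)

theorem act_mul : ∀ g h : SL3, ∀ i, act (g*h) i = act g (act h i) := by decide +kernel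
theorem qc_mul0 : ∀ g h : SL3, 2 * qc (g*h) 0 = qc g 0 * qc h 0 - qc g 1 * qc h 1 - qc g 2 * qc h 2 - qc g 3 * qc h 3 := by decide +kernel
theorem qc_mul1 : ∀ g h : SL3, 2 * qc (g*h) 1 = qc g 0 * qc h 1 + qc g 1 * qc h 0 + qc g 2 * qc h 3 - qc g 3 * qc h 2 := by decide +kernel
theorem qc_mul2 : ∀ g h : SL3, 2 * qc (g*h) 2 = qc g 0 * qc h 2 - qc g 1 * qc h 3 + qc g 2 * qc h 0 + qc g 3 * qc h 1 := by decide +kernel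
theorem qc_mul3 : ∀ g h : SL3, 2 * qc (g*h) 3 = qc g 0 * qc h 3 + qc g 1 * qc h 2 - qc g 2 * qc h 1 + qc g 3 * qc h 0 := by decide +kernel
theorem qc_sum : ∑ g : SL3, qc g 0 * qc g⁻¹ 0 = 24 := by decide +kernel
theorem sqs : ∀ g : SL3, ∃ a b : SL3, g = a^2*b^2 := by decide +kernel
theorem cardSL : Fintype.card SL3 = 24 := by decide +kernel
theorem act_ker : ∀ g : SL3, (∀ i, act g i = i) ↔ ∀ h, h * g = g * h := by decide +kernel
theorem ctr : ∀ g : SL3, (∀ h, h * g = g * h) ↔ (g = 1 ∨ g = -1) := by decide +kernel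

abbrev A4 := alternatingGroup (Fin 4)

def lab (a b : Fin 4) : ZMod 3 := if a = 3 then (b.1 : ZMod 3) else if b = 3 then (a.1 : ZMod 3) else -(a.1 : ZMod 3) - (b.1 : ZMod 3)
def pA (s : A4) : ZMod 3 := lab (s.1 0) (s.1 3)
theorem pA_mul : ∀ s t : A4, pA (s*t) = pA s + pA t := by decide +kernel
def cls (s : A4) : Fin 4 := if s = 1 then 0 else if pA s = 0 then 1 else if pA s = 1 then 2 else 3
theorem cls_conj : ∀ s t : A4, cls s = cls t → ∃ h : A4, h * s * h⁻¹ = t := by decide +kernel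
theorem cls_inv : ∀ s : A4, cls s⁻¹ = ![0,1,3,2] (cls s) := by decide +kernel
theorem cls_pA : ∀ s : A4, pA s = ![0,0,1,2] (cls s) := by decide +kernel
theorem cls_card : ∀ c : Fin 4, (Finset.univ.filter (fun s : A4 => cls s = c)).card = ![1,3,4,4] c := by decide +kernel
def lamA (s : A4) : ℤ := if s.1 0 = 0 ∨ s.1 0 = 1 then 1 else -1
theorem lamA_mul : ∀ s t : A4, pA s = 0 → pA t = 0 → lamA (s*t) = lamA s * lamA t := by decide +kernel
theorem lamA_ind : ∀ s : A4, ∑ x : A4, (if pA (x⁻¹ * s * x) = 0 then lamA (x⁻¹ * s * x) else 0) = 4 * ![3,-1,0,0] (cls s) := by decide +kernel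
theorem cardK : Fintype.card {s : A4 // pA s = 0} = 4 := by decide +kernel
theorem cardA : Fintype.card A4 = 12 := by decide +kernel
theorem cls_surj : ∀ c, ∃ s, cls s = c := by decide +kernel

theorem act_one : ∀ i, act 1 i = i := by decide +kernel

def actHom : SL3 →* Equiv.Perm (Fin 4) where
  toFun g := ⟨act g, act g⁻¹,
    fun i => by rw [← act_mul, inv_mul_cancel, act_one],
    fun i => by rw [← act_mul, mul_inv_cancel, act_one]⟩
  map_one' := by ext i; simp [act_one]
  map_mul' g h := by ext i; simp [act_mul]

theorem actHom_sign : ∀ g : SL3, Equiv.Perm.sign (actHom g) = 1 := by decide +kernel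
theorem actHom_surj : ∀ s : A4, ∃ g : SL3, ∀ i, act g i = s.1 i := by decide +kernel

def actA : SL3 →* A4 := actHom.codRestrict A4 (fun g => Equiv.Perm.mem_alternatingGroup.2 (actHom_sign g))

theorem actA_surj : Function.Surjective actA := by
  intro s
  obtain ⟨g, hg⟩ := actHom_surj s
  refine ⟨g, ?_⟩
  ext i
  exact congrArg Fin.val (hg i)

theorem actA_ker : actA.ker = Subgroup.center SL3 := by
  ext g
  rw [MonoidHom.mem_ker, Subgroup.mem_center_iff, ← act_ker]
  constructor
  · intro h i
    have := congrArg (fun s : A4 => s.1 i) h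
    exact this
  · intro h
    ext i
    exact congrArg Fin.val (h i)

noncomputable section

theorem quotIso : Nonempty ((SL3 ⧸ Subgroup.center SL3) ≃* A4) :=
  ⟨(QuotientGroup.quotientMulEquivOfEq actA_ker.symm).trans
    (QuotientGroup.quotientKerEquivOfSurjective actA actA_surj)⟩

theorem card_center : Nat.card (Subgroup.center SL3) = 2 := by
  have h : ((Subgroup.center SL3 : Subgroup SL3) : Set SL3) = {1, -1} := by
    ext g
    rw [SetLike.mem_coe, Subgroup.mem_center_iff, ctr]; simp
  have h1 : (1 : SL3) ≠ -1 := by decide +kernel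
  have h2 : Nat.card ((Subgroup.center SL3 : Subgroup SL3) : Set SL3) = 2 := by
    rw [h, Nat.card_coe_set_eq, Set.ncard_pair h1]
  exact h2

/-- Norm one. -/
theorem irr_norm {G : Type} [Group G] [Fintype G] {χ : G → ℂ} (h : IsIrrChar G χ) :
    ∑ g : G, χ g * χ g⁻¹ = Nat.card G := by
  obtain ⟨V, hV, rfl⟩ := h
  exact (FDRep.simple_iff_char_is_norm_one V).1 hV

theorem irr_conj {G : Type} [Group G] {χ : G → ℂ} (h : IsIrrChar G χ) (g x : G) :
    χ (x * g * x⁻¹) = χ g := by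
  obtain ⟨V, hV, rfl⟩ := h
  exact V.char_conj g x

theorem irr_one {G : Type} [Group G] {χ : G → ℂ} (h : IsIrrChar G χ) :
    ∃ n : ℕ, χ 1 = n := by
  obtain ⟨V, hV, rfl⟩ := h
  exact ⟨_, V.char_one⟩

theorem irr_orth {G : Type} [Group G] [Fintype G] {χ ψ : G → ℂ} (h : IsIrrChar G χ)
    (h' : IsIrrChar G ψ) (hne : χ ≠ ψ) : ∑ g : G, χ g * ψ g⁻¹ = 0 := by
  obtain ⟨V, hV, rfl⟩ := h
  obtain ⟨W, hW, rfl⟩ := h'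
  have := invertibleOfNonzero (NeZero.ne (Nat.card G : ℂ))
  have h := FDRep.char_orthonormal V W
  rw [if_neg (fun ⟨i⟩ => hne (FDRep.char_iso i))] at h
  exact (mul_eq_zero.1 h).resolve_left (inv_ne_zero (NeZero.ne _))

/-- Linear characters are irreducible. -/
theorem irr_lin {G : Type} [Group G] [Fintype G] (l : G →* ℂ) : IsIrrChar G l := by
  let ρ : G →* (ℂ →ₗ[ℂ] ℂ) := (Algebra.lmul ℂ ℂ).toMonoidHom.comp l
  have hc : ∀ g, (FDRep.of ρ).character g = l g := by
    intro g
    change LinearMap.trace ℂ ℂ (ρ g) = l g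
    rw [LinearMap.trace_eq_matrix_trace ℂ (Module.Basis.singleton Unit ℂ)]
    simp [Matrix.trace, LinearMap.toMatrix_apply, ρ]
  refine ⟨FDRep.of ρ, ?_, (funext hc).symm⟩
  rw [FDRep.simple_iff_char_is_norm_one]
  simp only [hc, ← map_mul, mul_inv_cancel, map_one]
  simp

theorem indChar_eq_sum {G : Type} [Group G] [Fintype G] (H : Subgroup G) (θ : ↥H → ℂ) (g : G) :
    indChar H θ g = (Nat.card H : ℂ)⁻¹ *
      ∑ x : G, if h : x⁻¹ * g * x ∈ H then θ ⟨x⁻¹ * g * x, h⟩ else 0 := by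
  unfold indChar
  rw [finsum_eq_sum_of_fintype]

theorem mono_lin {G : Type} [Group G] [Fintype G] (l : G →* ℂ) : IsMonomialChar (l : G → ℂ) := by
  refine ⟨⊤, l.comp (Subgroup.subtype ⊤), ?_⟩
  funext g
  rw [indChar_eq_sum]
  have : ∀ x : G, l x⁻¹ * l g * l x = l g := by
    intro x
    rw [mul_right_comm, ← map_mul, inv_mul_cancel, map_one, one_mul]
  have hs : ∀ x : G, (if h : x⁻¹ * g * x ∈ (⊤ : Subgroup G) then
      (l.comp (Subgroup.subtype ⊤)) ⟨x⁻¹ * g * x, h⟩ else 0) = l g := by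
    intro x
    rw [dif_pos (Subgroup.mem_top _)]
    show l (x⁻¹ * g * x) = l g
    rw [map_mul, map_mul, this]
  rw [Finset.sum_congr rfl (fun x _ => hs x)]
  simp

theorem mono_transport {Q A : Type} [Group Q] [Group A] [Fintype Q] [Fintype A] (e : Q ≃* A)
    {f : A → ℂ} (h : IsMonomialChar f) : IsMonomialChar (fun q => f (e q)) := by
  obtain ⟨H, l, rfl⟩ := h
  refine ⟨H.comap e.toMonoidHom, l.comp (e.toMonoidHom.subgroupComap H), ?_⟩
  funext q
  rw [indChar_eq_sum, indChar_eq_sum]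
  have hc : Nat.card (H.comap e.toMonoidHom) = Nat.card H :=
    Nat.card_congr (e.toEquiv.subtypeEquiv (fun a => Iff.rfl))
  rw [hc]
  congr 1
  symm
  refine Fintype.sum_equiv e.toEquiv _ _ (fun x => ?_)
  by_cases hx : (e x)⁻¹ * e q * e x ∈ H
  · have hx' : x⁻¹ * q * x ∈ H.comap e.toMonoidHom := by
      simpa [Subgroup.mem_comap] using hx
    rw [dif_pos hx', dif_pos (by exact hx)]
    simp only [MonoidHom.comp_apply]
    congr 1
    apply Subtype.ext
    show e (x⁻¹ * q * x) = (e x)⁻¹ * e q * e x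
    simp
  · have hx' : ¬ x⁻¹ * q * x ∈ H.comap e.toMonoidHom := by
      simpa [Subgroup.mem_comap] using hx
    rw [dif_neg hx', dif_neg (by exact hx)]

/-- The Klein four-group. -/
def K4 : Subgroup A4 where
  carrier := {s | pA s = 0}
  one_mem' := by show pA 1 = 0; decide +kernel
  mul_mem' {a b} ha hb := by
    show pA (a * b) = 0
    rw [pA_mul, show pA a = 0 from ha, show pA b = 0 from hb, add_zero]
  inv_mem' {a} ha := by
    show pA a⁻¹ = 0
    have h := pA_mul a a⁻¹
    have h1 : pA 1 = 0 := by decide +kernel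
    rw [mul_inv_cancel, h1, show pA a = 0 from ha, zero_add] at h
    exact h.symm

def lamK : K4 →* ℂ where
  toFun s := (lamA s.1 : ℂ)
  map_one' := by
    have : lamA 1 = 1 := by decide +kernel
    simp [this]
  map_mul' s t := by
    have := lamA_mul s.1 t.1 s.2 t.2
    rw [Subgroup.coe_mul, this]; push_cast; rfl

theorem mono_three : IsMonomialChar (fun s : A4 => ((![3,-1,0,0] (cls s) : ℤ) : ℂ)) := by
  refine ⟨K4, lamK, ?_⟩
  funext s
  rw [indChar_eq_sum]
  have hc : Nat.card K4 = 4 := by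
    have : Nat.card {s : A4 // pA s = 0} = 4 := by
      rw [Nat.card_eq_fintype_card]
      convert cardK
    exact this
  rw [hc]
  have h : (∑ x : A4, if h : x⁻¹ * s * x ∈ K4 then lamK ⟨x⁻¹ * s * x, h⟩ else 0)
      = ((∑ x : A4, (if pA (x⁻¹ * s * x) = 0 then lamA (x⁻¹ * s * x) else 0) : ℤ) : ℂ) := by
    push_cast
    refine Finset.sum_congr rfl (fun x _ => ?_)
    by_cases hx : pA (x⁻¹ * s * x) = 0
    · rw [dif_pos (show x⁻¹ * s * x ∈ K4 from hx), if_pos hx]; rfl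
    · rw [dif_neg (show ¬ x⁻¹ * s * x ∈ K4 from hx), if_neg hx]
  rw [h, lamA_ind]
  push_cast
  ring


/-- The linear characters of A4. -/
def linA (z : ℂ) (hz : z ^ 3 = 1) : A4 →* ℂ where
  toFun s := AddChar.zmodChar 3 hz (pA s)
  map_one' := by
    have : pA 1 = 0 := by decide +kernel
    rw [this, AddChar.map_zero_eq_one]
  map_mul' s t := by rw [pA_mul, AddChar.map_add_eq_mul]

theorem sum_cls (F : Fin 4 → ℂ) : ∑ s : A4, F (cls s) = F 0 + 3 * F 1 + 4 * F 2 + 4 * F 3 := by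
  have h : ∀ c, (∑ s : A4 with cls s = c, F (cls s)) = (![1,3,4,4] c : ℕ) * F c := by
    intro c
    rw [← cls_card c, ← nsmul_eq_mul, ← Finset.sum_const]
    refine Finset.sum_congr rfl (fun s hs => ?_)
    rw [(Finset.mem_filter.1 hs).2]
  rw [← Finset.sum_fiberwise Finset.univ cls]
  simp only [h, Fin.sum_univ_four]
  simp

theorem mgroup_of_iso {Q : Type} [Group Q] [Fintype Q] (e : Q ≃* A4) : IsMGroup Q := by
  intro χ hχ
  by_cases hl : ∃ l : Q →* ℂ, χ = l
  · obtain ⟨l, rfl⟩ := hl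
    exact mono_lin l
  · push Not at hl
    -- class values
    choose r hr using cls_surj
    let F : Fin 4 → ℂ := fun c => χ (e.symm (r c))
    have hF : ∀ s : A4, χ (e.symm s) = F (cls s) := by
      intro s
      obtain ⟨h, hh⟩ := cls_conj s (r (cls s)) (hr _).symm
      simp only [F]
      rw [← hh, map_mul, map_mul, map_inv, irr_conj hχ]
    have hnorm := irr_norm hχ
    have hcard : Nat.card Q = 12 := by
      rw [Nat.card_congr e.toEquiv, Nat.card_eq_fintype_card, ← cardA]
    rw [hcard, ← e.symm.toEquiv.sum_comp] at hnorm
    have hnorm' : F 0 * F 0 + 3 * (F 1 * F 1) + 4 * (F 2 * F 3) + 4 * (F 3 * F 2) = 12 := by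
      have := sum_cls (fun c => F c * F (![0,1,3,2] c))
      simp only [← cls_inv, ← hF] at this
      simp only [MulEquiv.toEquiv_eq_coe, MulEquiv.coe_toEquiv, ← map_inv] at hnorm
      rw [hnorm] at this
      simpa using this.symm
    have horth : ∀ z : ℂ, z ^ 3 = 1 → F 0 + 3 * F 1 + 4 * (F 2 * z ^ 2) + 4 * (F 3 * z) = 0 := by
      intro z hz
      have h := irr_orth hχ (irr_lin ((linA z hz).comp e.toMonoidHom)) (hl _)
      rw [← e.symm.toEquiv.sum_comp] at h
      have h2 := sum_cls (fun c => F c * AddChar.zmodChar 3 hz (![0,0,1,2] (![0,1,3,2] c)))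
      simp only [← cls_inv, ← cls_pA, ← hF] at h2
      have h3 : ∑ s : A4, χ (e.symm s) * AddChar.zmodChar 3 hz (pA s⁻¹) = 0 := by
        rw [← h]
        refine Finset.sum_congr rfl (fun s _ => ?_)
        simp [linA]
      rw [h3] at h2
      have v2 : (2 : ZMod 3).val = 2 := rfl
      have v1 : (1 : ZMod 3).val = 1 := rfl
      have h4 := h2.symm
      simp [AddChar.zmodChar_apply, v1, v2] at h4
      simpa using h4
    obtain ⟨w, hw⟩ : ∃ w : ℂ, IsPrimitiveRoot w 3 := ⟨_, Complex.isPrimitiveRoot_exp 3 (by norm_num)⟩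
    have hw3 : w ^ 3 = 1 := hw.pow_eq_one
    have hw1 : w ≠ 1 := hw.ne_one (by norm_num)
    have hq : w ^ 2 + w + 1 = 0 := by
      have : (w - 1) * (w ^ 2 + w + 1) = 0 := by linear_combination hw3
      exact (mul_eq_zero.1 this).resolve_left (sub_ne_zero.2 hw1)
    have o1 := horth 1 (by norm_num)
    have o2 := horth w hw3
    have o3 := horth (w ^ 2) (by rw [← pow_mul, mul_comm, pow_mul, hw3, one_pow])
    have hw4 : (w ^ 2) ^ 2 = w := by linear_combination w * hw3
    rw [hw4] at o3
    have e0 : F 0 = -3 * F 1 := by linear_combination (o1 + o2 + o3) / 3 - (4/3) * (F 2 + F 3) * hq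
    -- multiply by inverse values and add up
    have e2 : F 2 = 0 := by
      linear_combination (o1 + w * o2 + w ^ 2 * o3) / 12 - (1/12) * (F 0 + 3 * F 1) * hq
        - (1/3) * F 2 * 2 * hw3 - (1/3) * F 3 * (hq) - (1/3) * F 3 * w * hw3
    have e3 : F 3 = 0 := by
      linear_combination (o1 + w ^ 2 * o2 + w * o3) / 12 - (1/12) * (F 0 + 3 * F 1) * hq
        - (1/3) * F 3 * 2 * hw3 - (1/3) * F 2 * (hq) - (1/3) * F 2 * w * hw3
    have sq : (F 0 - 3) * (F 0 + 3) = 0 := by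
      rw [e2, e3] at hnorm'
      linear_combination (3/4) * hnorm' + (1/4) * (F 0 - 3 * F 1) * e0
    obtain ⟨n, hn⟩ := irr_one hχ
    have hF0 : F 0 = n := by
      have h1 : cls 1 = 0 := by decide +kernel
      rw [← hn, ← h1, ← hF, map_one]
    have f0 : F 0 = 3 := by
      rcases mul_eq_zero.1 sq with h | h
      · linear_combination h
      · exfalso
        rw [hF0] at h
        have : ((n + 3 : ℕ) : ℂ) = 0 := by push_cast; exact h
        exact absurd (Nat.cast_eq_zero.1 this) (by omega)
    have f1 : F 1 = -1 := by linear_combination (1/3) * e0 - (1/3) * f0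
    have key : χ = fun q => (fun s : A4 => ((![3,-1,0,0] (cls s) : ℤ) : ℂ)) (e q) := by
      funext q
      have := hF (e q)
      rw [e.symm_apply_apply] at this
      rw [this]
      show F (cls (e q)) = ((![3,-1,0,0] (cls (e q)) : ℤ) : ℂ)
      generalize cls (e q) = c
      fin_cases c <;> simp [f0, f1, e2, e3]
    rw [key]
    exact mono_transport e mono_three

/-- The 2-dimensional (quaternionic) representation. -/
def matQ (g : SL3) : Matrix (Fin 2) (Fin 2) ℂ :=
  (1 / 2 : ℂ) • !![(qc g 0 : ℂ) + qc g 1 * Complex.I, (qc g 2 : ℂ) + qc g 3 * Complex.I;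
     -(qc g 2 : ℂ) + qc g 3 * Complex.I, (qc g 0 : ℂ) - qc g 1 * Complex.I]

theorem matQ_one : matQ 1 = 1 := by
  have h0 : qc 1 0 = 2 := by decide +kernel
  have h1 : qc 1 1 = 0 := by decide +kernel
  have h2 : qc 1 2 = 0 := by decide +kernel
  have h3 : qc 1 3 = 0 := by decide +kernel
  ext i j
  fin_cases i <;> fin_cases j <;> simp [matQ, h0, h1, h2, h3]

theorem matQ_mul (g h : SL3) : matQ (g * h) = matQ g * matQ h := by
  have h0 := congrArg (Int.cast (R := ℂ)) (qc_mul0 g h)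
  have h1 := congrArg (Int.cast (R := ℂ)) (qc_mul1 g h)
  have h2 := congrArg (Int.cast (R := ℂ)) (qc_mul2 g h)
  have h3 := congrArg (Int.cast (R := ℂ)) (qc_mul3 g h)
  push_cast at h0 h1 h2 h3
  have hI := Complex.I_sq
  ext i j
  fin_cases i <;> fin_cases j <;> simp [matQ, Matrix.mul_apply, Fin.sum_univ_two]
  · linear_combination (1/4) * h0 + (1/4) * Complex.I * h1 - (1/4 : ℂ) * (qc g 1 * qc h 1 + qc g 3 * qc h 3) * hI
  · linear_combination (1/4) * h2 + (1/4) * Complex.I * h3 - (1/4 : ℂ) * (qc g 1 * qc h 3 - qc g 3 * qc h 1) * hI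
  · linear_combination -(1/4) * h2 + (1/4) * Complex.I * h3 - (1/4 : ℂ) * (qc g 3 * qc h 1 - qc g 1 * qc h 3) * hI
  · linear_combination (1/4) * h0 - (1/4) * Complex.I * h1 - (1/4 : ℂ) * (qc g 1 * qc h 1 + qc g 3 * qc h 3) * hI

def matQHom : SL3 →* Matrix (Fin 2) (Fin 2) ℂ where
  toFun := matQ
  map_one' := matQ_one
  map_mul' := matQ_mul

def chiQ (g : SL3) : ℂ := (qc g 0 : ℂ)

theorem irr_chiQ : IsIrrChar SL3 chiQ := by
  let ρ : SL3 →* ((Fin 2 → ℂ) →ₗ[ℂ] (Fin 2 → ℂ)) :=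
    (Matrix.toLinAlgEquiv' (R := ℂ) (n := Fin 2)).toAlgHom.toMonoidHom.comp matQHom
  have hc : ∀ g, (FDRep.of ρ).character g = chiQ g := by
    intro g
    change LinearMap.trace ℂ (Fin 2 → ℂ) (Matrix.toLin' (matQ g)) = chiQ g
    rw [Matrix.trace_toLin'_eq]
    simp [Matrix.trace, matQ, chiQ]
    ring
  refine ⟨FDRep.of ρ, ?_, (funext hc).symm⟩
  rw [FDRep.simple_iff_char_is_norm_one]
  simp only [hc, chiQ]
  rw [Nat.card_eq_fintype_card, cardSL]
  exact_mod_cast congrArg (Int.cast (R := ℂ)) qc_sum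

theorem chiQ_one : chiQ 1 = 2 := by
  have h0 : qc 1 0 = 2 := by decide +kernel
  simp [chiQ, h0]

theorem chiQ_ctr : ∀ g : SL3, (∀ h, h * g = g * h) → qc g 0 * qc g⁻¹ 0 = 4 := by decide +kernel

theorem not_irr_res : ¬ IsIrrChar ↥(Subgroup.center SL3)
    (fun n : ↥(Subgroup.center SL3) => chiQ (n : SL3)) := by
  intro h
  have : Fintype (Subgroup.center SL3) := Fintype.ofFinite _
  have h1 := irr_norm h
  have h2 : ∀ n : Subgroup.center SL3, chiQ (n : SL3) * chiQ ((n⁻¹ : Subgroup.center SL3) : SL3) = 4 := by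
    intro n
    have := chiQ_ctr n.1 (Subgroup.mem_center_iff.1 n.2)
    unfold chiQ
    exact_mod_cast congrArg (Int.cast (R := ℂ)) this
  simp only [h2, Finset.sum_const, Finset.card_univ, ← Nat.card_eq_fintype_card, card_center] at h1
  norm_num at h1

theorem not_relM : ¬ IsRelMChar (Subgroup.center SL3) chiQ := by
  rintro ⟨H, hNH, θ, hθ, hind, hres⟩
  have hval : ∀ n (hn : n ∈ Subgroup.center SL3), chiQ n = (H.index : ℂ) * θ ⟨n, hNH hn⟩ := by
    intro n hn
    have hx : ∀ x : SL3, x⁻¹ * n * x = n := by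
      intro x
      rw [mul_assoc, ← Subgroup.mem_center_iff.1 hn x, inv_mul_cancel_left]
    rw [← hind, indChar_eq_sum]
    have hs : ∀ x : SL3, (if h : x⁻¹ * n * x ∈ H then θ ⟨x⁻¹ * n * x, h⟩ else 0)
        = θ ⟨n, hNH hn⟩ := by
      intro x
      simp only [hx, hNH hn, dif_pos]
    rw [Finset.sum_congr rfl (fun x _ => hs x), Finset.sum_const, Finset.card_univ]
    rw [← Nat.card_eq_fintype_card, ← H.card_mul_index, nsmul_eq_mul]
    have : (Nat.card H : ℂ) ≠ 0 := NeZero.ne _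
    push_cast
    field_simp
  obtain ⟨d, hd⟩ := irr_one hθ
  have h1 := hval 1 (Subgroup.one_mem _)
  have h1' : H.index * d = 2 := by
    have : (2 : ℂ) = H.index * d := by rw [← hd, ← chiQ_one]; exact h1
    exact_mod_cast this.symm
  have hdvd : H.index ∣ 2 := ⟨d, h1'.symm⟩
  rcases (Nat.dvd_prime Nat.prime_two).1 hdvd with h | h
  · apply not_irr_res
    convert hres using 2 with n
    rw [hval n.1 n.2, h]; simp
  · have : H = ⊤ := by
      rw [eq_top_iff]
      intro g _
      obtain ⟨a, b, rfl⟩ := sqs g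
      exact H.mul_mem (H.sq_mem_of_index_two h a) (H.sq_mem_of_index_two h b)
    rw [this, Subgroup.index_top] at h
    norm_num at h


end

/-- For `G = SL(2,3)` and `N = Z(G)` its center (of order 2): `G/N` is isomorphic to the
alternating group `A₄` and is an M-group, but `G` is not a relative M-group with respect
to `N`; indeed `G` has an irreducible character of degree 2 whose restriction to `N` is
not irreducible and which is not a relative M-character with respect to `N`. -/
theorem SL2_3_not_relMGroup_center :
    Nat.card (Subgroup.center (Matrix.SpecialLinearGroup (Fin 2) (ZMod 3))) = 2 ∧
    Nonempty ((Matrix.SpecialLinearGroup (Fin 2) (ZMod 3) ⧸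
        Subgroup.center (Matrix.SpecialLinearGroup (Fin 2) (ZMod 3))) ≃*
      alternatingGroup (Fin 4)) ∧
    IsMGroup (Matrix.SpecialLinearGroup (Fin 2) (ZMod 3) ⧸
      Subgroup.center (Matrix.SpecialLinearGroup (Fin 2) (ZMod 3))) ∧
    ¬ IsRelMGroup (Matrix.SpecialLinearGroup (Fin 2) (ZMod 3))
      (Subgroup.center (Matrix.SpecialLinearGroup (Fin 2) (ZMod 3))) ∧
    ∃ χ : Matrix.SpecialLinearGroup (Fin 2) (ZMod 3) → ℂ,
      IsIrrChar (Matrix.SpecialLinearGroup (Fin 2) (ZMod 3)) χ ∧ χ 1 = 2 ∧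
      ¬ IsIrrChar ↥(Subgroup.center (Matrix.SpecialLinearGroup (Fin 2) (ZMod 3)))
        (fun n : ↥(Subgroup.center (Matrix.SpecialLinearGroup (Fin 2) (ZMod 3))) =>
          χ (n : Matrix.SpecialLinearGroup (Fin 2) (ZMod 3))) ∧
      ¬ IsRelMChar (Subgroup.center (Matrix.SpecialLinearGroup (Fin 2) (ZMod 3))) χ := by
  refine ⟨card_center, quotIso, ?_, fun h => not_relM (h _ irr_chiQ),
    chiQ, irr_chiQ, chiQ_one, not_irr_res, not_relM⟩
  have : Fintype (SL3 ⧸ Subgroup.center SL3) := Fintype.ofFinite _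
  obtain ⟨e⟩ := quotIso
  exact mgroup_of_iso e
end
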